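/- Let q = 2^s with q > 2 and m ≥ 2. The invariant ring S_m[z]^{O_{2m+1}(F_q)} is a free module over F_q[H], H = {ξ_0, ξ_1,...,ξ_m, e_1,...,e_m}, of rank Π_{i=1}^{m−1} q^i/2; equivalently, 2·Π_{i=1}^m (q^i+1) · Π_{j=1}^m (q^{2m−j}(q^j−1)/2) divided by |O_{2m+1}(F_q)| = q^{m^2} Π_{k=1}^m (q^{2k}−1) equals Π_{i=1}^{m−1} q^i/2. -/

import Mathlib

open MvPolynomial
open scoped Classical

/-- Variable index set for `S_m[z] = F_q[y_1,…,y_m,x_m,…,x_1,z]`: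
`none` is `z`, `some (inl j)` is `y_j`, `some (inr j)` is `x_j`. -/
abbrev OIdx (m : ℕ) := Option (Fin m ⊕ Fin m)

/-- The action of an invertible linear map `g` of `V = ι → F` on the polynomial
ring on `V`, so that `eval v (act g f) = eval (g v) f`. -/
noncomputable def act {F : Type*} [Field F] {ι : Type*} [Fintype ι] [DecidableEq ι]
    (g : (ι → F) ≃ₗ[F] (ι → F)) : MvPolynomial ι F →ₐ[F] MvPolynomial ι F :=
  MvPolynomial.aeval fun i => ∑ j, MvPolynomial.C (g (Pi.single j 1) i) * MvPolynomial.X j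

/-- The complete Steenrod operator `P(t)`, the algebra homomorphism determined
by `v ↦ v + v^q t` on degree-one elements; `P^k f = (stP q σ F f).coeff k`. -/
noncomputable def stP (q : ℕ) (σ : Type*) (F : Type*) [Field F] :
    MvPolynomial σ F →ₐ[F] Polynomial (MvPolynomial σ F) :=
  MvPolynomial.aeval fun i =>
    Polynomial.C (MvPolynomial.X i) + Polynomial.C (MvPolynomial.X i ^ q) * Polynomial.X

/-- The quadratic form `ξ_0 = z^2 + Σ x_j y_j`. -/
noncomputable def xiZero (m : ℕ) (F : Type*) [Field F] : MvPolynomial (OIdx m) F :=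
  X none ^ 2 + ∑ j : Fin m, X (some (Sum.inr j)) * X (some (Sum.inl j))

/-- `ξ̄_0 = Σ_j x_j y_j`. -/
noncomputable def xiBar (m : ℕ) (F : Type*) [Field F] : MvPolynomial (OIdx m) F :=
  ∑ j : Fin m, X (some (Sum.inr j)) * X (some (Sum.inl j))

/-- `ξ_i = Σ_j (x_j y_j^{q^i} + y_j x_j^{q^i})` for `i ≥ 1`. -/
noncomputable def xiGen (q m : ℕ) (F : Type*) [Field F] (i : ℕ) : MvPolynomial (OIdx m) F :=
  ∑ j : Fin m, (X (some (Sum.inr j)) * X (some (Sum.inl j)) ^ q ^ i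
    + X (some (Sum.inl j)) * X (some (Sum.inr j)) ^ q ^ i)

/-- The sum of the natural monomials attached to a finite set `T` of base-`q`
exponents: the sum over all perfect matchings of `T` (fixed-point-free
involutions `π` of `T`) of the products `Π_{a < π a} ξ_{π a - a}^{q^a}`. -/
noncomputable def natSum (q m : ℕ) (F : Type*) [Field F] (T : Finset ℕ) :
    MvPolynomial (OIdx m) F :=
  ∑ π ∈ Finset.univ.filter
      (fun π : Equiv.Perm {x : ℕ // x ∈ T} => (∀ a, π (π a) = a) ∧ ∀ a, π a ≠ a),
    ∏ a ∈ Finset.univ.filter (fun a : {x : ℕ // x ∈ T} => (a : ℕ) < (π a : ℕ)),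
      xiGen q m F ((π a : ℕ) - (a : ℕ)) ^ q ^ (a : ℕ)

/-- `u_m`, the sum of all natural monomials of degree `1 + q + ⋯ + q^{2m-1}`
and natural degree `m`. -/
noncomputable def uM (q m : ℕ) (F : Type*) [Field F] : MvPolynomial (OIdx m) F :=
  natSum q m F (Finset.range (2 * m))

/-- `u_{m-1}`, interpreted inside `S_m`. -/
noncomputable def uM1 (q m : ℕ) (F : Type*) [Field F] : MvPolynomial (OIdx m) F :=
  natSum q m F (Finset.range (2 * m - 2))

/-- `δ_1 = Σ_{0<j<k<2m-1} ξ_j ξ_k δ_{jk}`. -/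
noncomputable def deltaOne (q m : ℕ) (F : Type*) [Field F] : MvPolynomial (OIdx m) F :=
  ∑ j ∈ Finset.Icc 1 (2 * m - 2), ∑ k ∈ Finset.Icc 1 (2 * m - 2),
    if j < k then
      xiGen q m F j * xiGen q m F k *
        natSum q m F (((Finset.Icc 1 (2 * m - 2)).erase j).erase k)
    else 0

/-- The product `Π_{v ∈ F_q^{2m}} (t + ℓ_v)`; its coefficient of `t^{q^{2m-i}}`
is the Dickson invariant `d_{i,m}` of `GL_{2m}(F_q)`. -/
noncomputable def dickP (m : ℕ) (F : Type*) [Field F] [Fintype F] :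
    Polynomial (MvPolynomial (OIdx m) F) :=
  ∏ c : (Fin m ⊕ Fin m) → F,
    (Polynomial.X + Polynomial.C (∑ i, MvPolynomial.C (c i) * X (some i)))

/-- The orthogonal invariants: `eSeq … b1 (i-1) = e_i`, where
`e_1 = u_m^{q/2-1} u_{m-1}^{q/2} z + b_1` and `e_{i+1} = P^{q^{2m-1-i}/2}(e_i)`. -/
noncomputable def eSeq (q m s : ℕ) (F : Type*) [Field F]
    (b1 : MvPolynomial (OIdx m) F) : ℕ → MvPolynomial (OIdx m) F
  | 0 => uM q m F ^ (2 ^ (s - 1) - 1) * uM1 q m F ^ 2 ^ (s - 1) * X none + b1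
  | k + 1 => ((stP q (OIdx m) F) (eSeq q m s F b1 k)).coeff
      (2 ^ (s * (2 * m - 2 - k) - 1))

/-- The sum over all perfect matchings of `T` of the products of the entries `N a b`
over the matched pairs `a < b`: the Pfaffian of `N` on `T` up to signs. -/
noncomputable def pf {R : Type*} [CommRing R] (N : ℕ → ℕ → R) (T : Finset ℕ) : R :=
  ∑ π ∈ Finset.univ.filter
      (fun π : Equiv.Perm {x : ℕ // x ∈ T} => (∀ a, π (π a) = a) ∧ ∀ a, π a ≠ a),
    ∏ a ∈ Finset.univ.filter (fun a : {x : ℕ // x ∈ T} => (a : ℕ) < (π a : ℕ)),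
      N (a : ℕ) (π a : ℕ)

/-- The fixed-point-free involutions of `T`, extended by the identity. -/
noncomputable def matchings (T : Finset ℕ) : Finset (Equiv.Perm ℕ) :=
  (Finset.univ.filter
      (fun π : Equiv.Perm {x : ℕ // x ∈ T} => (∀ a, π (π a) = a) ∧ ∀ a, π a ≠ a)).image
    (fun π => Equiv.Perm.ofSubtype π)

lemma mem_matchings {T : Finset ℕ} {π : Equiv.Perm ℕ} :
    π ∈ matchings T ↔ (∀ x, π (π x) = x) ∧ ∀ x, π x ≠ x ↔ x ∈ T := by
  simp only [matchings, Finset.mem_image, Finset.mem_filter, Finset.mem_univ, true_and]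
  constructor
  · rintro ⟨σ, ⟨h1, h2⟩, rfl⟩
    have hin : ∀ x (hx : x ∈ T), Equiv.Perm.ofSubtype σ x = (σ ⟨x, hx⟩ : ℕ) := fun x hx =>
      Equiv.Perm.ofSubtype_apply_of_mem (p := fun y => y ∈ T) σ hx
    have hout : ∀ x (_ : x ∉ T), Equiv.Perm.ofSubtype σ x = x := fun x hx =>
      Equiv.Perm.ofSubtype_apply_of_not_mem (p := fun y => y ∈ T) σ hx
    refine ⟨fun x => ?_, fun x => ?_⟩
    · by_cases hx : x ∈ T
      · rw [hin x hx, hin _ (σ ⟨x, hx⟩).2]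
        simp [h1]
      · rw [hout x hx, hout x hx]
    · by_cases hx : x ∈ T
      · rw [hin x hx]
        simp only [hx, iff_true]
        exact fun h => h2 ⟨x, hx⟩ (Subtype.ext h)
      · simp [hout x hx, hx]
  · rintro ⟨h1, h2⟩
    have hT : ∀ x, x ∈ T ↔ π x ∈ T := fun x => by
      rw [← h2, ← h2, h1]; exact ne_comm
    refine ⟨π.subtypePerm (fun x => (hT x).symm), ⟨fun a => ?_, fun a => ?_⟩, ?_⟩
    · ext; simp [h1]
    · intro h
      exact (h2 a).2 a.2 (congrArg Subtype.val h)
    · apply Equiv.Perm.ofSubtype_subtypePerm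
      exact fun x => (h2 x).1

lemma pf_eq_matchings {R : Type*} [CommRing R] (N : ℕ → ℕ → R) (T : Finset ℕ) :
    pf N T = ∑ π ∈ matchings T, ∏ x ∈ T, if x < π x then N x (π x) else 1 := by
  rw [pf, matchings, Finset.sum_image (fun _ _ _ _ h => Equiv.Perm.ofSubtype_injective h)]
  refine Finset.sum_congr rfl fun σ _ => ?_
  rw [Finset.prod_filter, ← Finset.prod_coe_sort T]
  refine Finset.prod_congr rfl fun a _ => ?_
  rw [Equiv.Perm.ofSubtype_apply_of_mem (p := fun y => y ∈ T) σ a.2]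

lemma pf_empty {R : Type*} [CommRing R] (N : ℕ → ℕ → R) : pf N ∅ = 1 := by
  have : matchings ∅ = {1} := by
    ext π
    rw [mem_matchings, Finset.mem_singleton]
    constructor
    · rintro ⟨_, h⟩
      ext x
      simpa using h x
    · rintro rfl
      simp
  rw [pf_eq_matchings, this]
  simp

lemma pf_expand {R : Type*} [CommRing R] {N : ℕ → ℕ → R} (hN : ∀ a b, N a b = N b a)
    {T : Finset ℕ} {a : ℕ} (ha : a ∈ T) :
    pf N T = ∑ b ∈ T.erase a, N a b * pf N ((T.erase a).erase b) := by
  rw [pf_eq_matchings]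
  have hm : ∀ π ∈ matchings T, π a ∈ T.erase a := fun π hπ => by
    rw [mem_matchings] at hπ
    rw [Finset.mem_erase, ← hπ.2, hπ.1]
    exact ⟨(hπ.2 a).2 ha, ((hπ.2 a).2 ha).symm⟩
  rw [← Finset.sum_fiberwise_of_maps_to hm]
  refine Finset.sum_congr rfl fun b hb => ?_
  obtain ⟨hba, hbT⟩ := Finset.mem_erase.1 hb
  rw [pf_eq_matchings, Finset.mul_sum]
  have key : ∀ π ∈ matchings ((T.erase a).erase b), π a = a ∧ π b = b := fun π hπ => by
    rw [mem_matchings] at hπ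
    constructor
    · by_contra h
      exact absurd ((hπ.2 a).1 h) (by simp)
    · by_contra h
      exact absurd ((hπ.2 b).1 h) (by simp)
  refine Finset.sum_bij' (fun π _ => Equiv.swap a b * π) (fun π _ => Equiv.swap a b * π)
    ?_ ?_ ?_ ?_ ?_
  · intro π hπ
    rw [Finset.mem_filter, mem_matchings] at hπ
    obtain ⟨⟨h1, h2⟩, h3⟩ := hπ
    have h4 : π b = a := by rw [← h3, h1]
    have hval : ∀ x, x ≠ a → x ≠ b → (Equiv.swap a b * π) x = π x := fun x hxa hxb => by
      rw [Equiv.Perm.mul_apply, Equiv.swap_apply_of_ne_of_ne]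
      · intro h; apply hxb; rw [← h1 x, h, h3]
      · intro h; apply hxa; rw [← h1 x, h, h4]
    have hva : (Equiv.swap a b * π) a = a := by simp [h3]
    have hvb : (Equiv.swap a b * π) b = b := by simp [h4]
    rw [mem_matchings]
    refine ⟨fun x => ?_, fun x => ?_⟩
    · by_cases hxa : x = a
      · rw [hxa, hva, hva]
      by_cases hxb : x = b
      · rw [hxb, hvb, hvb]
      rw [hval x hxa hxb, hval, h1]
      · intro h; apply hxb; rw [← h1 x, h, h3]
      · intro h; apply hxa; rw [← h1 x, h, h4]
    · by_cases hxa : x = a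
      · rw [hxa, hva]; simp
      by_cases hxb : x = b
      · rw [hxb, hvb]; simp
      rw [hval x hxa hxb, h2]; simp [hxa, hxb]
  · intro π hπ
    obtain ⟨ka, kb⟩ := key π hπ
    rw [mem_matchings] at hπ
    obtain ⟨h1, h2⟩ := hπ
    have hval : ∀ x, x ≠ a → x ≠ b → (Equiv.swap a b * π) x = π x := fun x hxa hxb => by
      rw [Equiv.Perm.mul_apply, Equiv.swap_apply_of_ne_of_ne]
      · intro h; apply hxa; rw [← h1 x, h, ka]
      · intro h; apply hxb; rw [← h1 x, h, kb]
    have hva : (Equiv.swap a b * π) a = b := by simp [ka]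
    have hvb : (Equiv.swap a b * π) b = a := by simp [kb]
    rw [Finset.mem_filter, mem_matchings]
    refine ⟨⟨fun x => ?_, fun x => ?_⟩, hva⟩
    · by_cases hxa : x = a
      · rw [hxa, hva, hvb]
      by_cases hxb : x = b
      · rw [hxb, hvb, hva]
      rw [hval x hxa hxb, hval, h1]
      · intro h; apply hxa; rw [← h1 x, h, ka]
      · intro h; apply hxb; rw [← h1 x, h, kb]
    · by_cases hxa : x = a
      · rw [hxa, hva]; simp [ha, hba]
      by_cases hxb : x = b
      · rw [hxb, hvb]; simp [hbT, hba.symm]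
      rw [hval x hxa hxb, h2]; simp [hxa, hxb]
  · intro π _; rw [← mul_assoc, Equiv.swap_mul_self, one_mul]
  · intro π _; rw [← mul_assoc, Equiv.swap_mul_self, one_mul]
  · intro π hπ
    rw [Finset.mem_filter, mem_matchings] at hπ
    obtain ⟨⟨h1, h2⟩, h3⟩ := hπ
    have h4 : π b = a := by rw [← h3, h1]
    rw [← Finset.mul_prod_erase T _ ha, ← Finset.mul_prod_erase (T.erase a) _ hb, ← mul_assoc]
    congr 1
    · rw [h3, h4]
      rcases lt_or_gt_of_ne hba with h | h
      · simp [h, h.not_gt, hN a b]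
      · simp [h, h.not_gt]
    · refine Finset.prod_congr rfl fun x hx => ?_
      simp only [Finset.mem_erase] at hx
      rw [Equiv.Perm.mul_apply, Equiv.swap_apply_of_ne_of_ne]
      · intro h; apply hx.1; rw [← h1 x, h, h3]
      · intro h; apply hx.2.1; rw [← h1 x, h, h4]

lemma pf_map {R R' : Type*} [CommRing R] [CommRing R'] (f : R →+* R') (N : ℕ → ℕ → R)
    (T : Finset ℕ) : f (pf N T) = pf (fun a b => f (N a b)) T := by
  simp [pf, map_sum, map_prod]

lemma pf_congr {R : Type*} [CommRing R] {N N' : ℕ → ℕ → R} {T : Finset ℕ}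
    (h : ∀ a ∈ T, ∀ b ∈ T, a < b → N a b = N' a b) : pf N T = pf N' T := by
  unfold pf
  refine Finset.sum_congr rfl fun σ _ => Finset.prod_congr rfl fun a ha => ?_
  exact h _ a.2 _ (σ a).2 (Finset.mem_filter.1 ha).2

/-- Pfaffians of a shifted set. -/
lemma pf_shift {R : Type*} [CommRing R] {N : ℕ → ℕ → R} (hN : ∀ a b, N a b = N b a)
    (c : ℕ) (T : Finset ℕ) :
    pf N (T.image (· + c)) = pf (fun a b => N (a + c) (b + c)) T := by
  induction hn : T.card using Nat.strong_induction_on generalizing T with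
  | _ n ih =>
    rcases T.eq_empty_or_nonempty with rfl | ⟨a, ha⟩
    · simp [pf_empty]
    · rw [pf_expand hN (Finset.mem_image_of_mem _ ha),
        pf_expand (fun a b => hN _ _) ha, ← Finset.image_erase (add_left_injective c),
        Finset.sum_image (fun _ _ _ _ h => add_left_injective c h)]
      refine Finset.sum_congr rfl fun b hb => ?_
      rw [← Finset.image_erase (add_left_injective c)]
      congr 1
      refine ih _ ?_ _ rfl
      have := Finset.card_erase_of_mem ha
      have := Finset.card_erase_of_mem hb
      have := Finset.card_pos.2 ⟨a, ha⟩
      omega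

/-- The alternating relation: `∑_{i∈I} N j i · pf (I∖i)` is a Pfaffian if `j ∉ I`. -/
lemma pf_insert {R : Type*} [CommRing R] {N : ℕ → ℕ → R} (hN : ∀ a b, N a b = N b a)
    {I : Finset ℕ} {j : ℕ} (hj : j ∉ I) :
    ∑ i ∈ I, N j i * pf N (I.erase i) = pf N (insert j I) := by
  rw [pf_expand hN (Finset.mem_insert_self j I), Finset.erase_insert hj]

lemma sum_sum_symm_eq_zero {R : Type*} [CommRing R] [CharP R 2] (I : Finset ℕ)
    (f : ℕ → ℕ → R) (hf : ∀ a b, f a b = f b a) :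
    ∑ i ∈ I, ∑ j ∈ I.erase i, f i j = 0 := by
  induction I using Finset.induction_on with
  | empty => simp
  | insert a I ha ih =>
    rw [Finset.sum_insert ha, Finset.erase_insert ha]
    have : ∀ i ∈ I, ∑ j ∈ (insert a I).erase i, f i j = f a i + ∑ j ∈ I.erase i, f i j := by
      intro i hi
      rw [Finset.erase_insert_of_ne (by rintro rfl; exact ha hi),
        Finset.sum_insert (fun h => ha (Finset.mem_of_mem_erase h)), hf]
    rw [Finset.sum_congr rfl this, Finset.sum_add_distrib, ih, add_zero, CharTwo.add_self_eq_zero]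

lemma sum_mul_pf_erase_eq_zero {R : Type*} [CommRing R] [CharP R 2] {N : ℕ → ℕ → R}
    (hN : ∀ a b, N a b = N b a) (hN0 : ∀ a, N a a = 0) {I : Finset ℕ} {j : ℕ} (hj : j ∈ I) :
    ∑ i ∈ I, N j i * pf N (I.erase i) = 0 := by
  rw [← Finset.add_sum_erase I _ hj, hN0, zero_mul, zero_add]
  have : ∀ i ∈ I.erase j, N j i * pf N (I.erase i)
      = ∑ k ∈ (I.erase j).erase i, N j i * N j k * pf N (((I.erase j).erase i).erase k) := by
    intro i hi
    have hij := (Finset.mem_erase.1 hi).1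
    rw [pf_expand hN (a := j) (Finset.mem_erase.2 ⟨hij.symm, hj⟩), Finset.mul_sum,
      Finset.erase_right_comm]
    exact Finset.sum_congr rfl fun _ _ => by ring
  rw [Finset.sum_congr rfl this]
  refine sum_sum_symm_eq_zero (I.erase j) (fun i k => N j i * N j k *
    pf N (((I.erase j).erase i).erase k)) fun a b => ?_
  rw [Finset.erase_right_comm]
  ring

/-- The Plücker relation for Pfaffians. -/
lemma pf_plucker {R : Type*} [CommRing R] [CharP R 2] {N : ℕ → ℕ → R}
    (hN : ∀ a b, N a b = N b a) (hN0 : ∀ a, N a a = 0) {I J : Finset ℕ} (hIJ : I ⊆ J) :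
    ∑ j ∈ J \ I, pf N (insert j I) * pf N (J.erase j) = 0 := by
  have h1 : ∑ j ∈ J, (∑ i ∈ I, N j i * pf N (I.erase i)) * pf N (J.erase j) = 0 := by
    simp only [Finset.sum_mul]
    rw [Finset.sum_comm]
    refine Finset.sum_eq_zero fun i hi => ?_
    have := sum_mul_pf_erase_eq_zero hN hN0 (hIJ hi)
    calc _ = pf N (I.erase i) * ∑ j ∈ J, N i j * pf N (J.erase j) := by
          rw [Finset.mul_sum]
          exact Finset.sum_congr rfl fun j _ => by rw [hN i j]; ring
      _ = 0 := by rw [this, mul_zero]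
  rw [← Finset.sum_sdiff hIJ] at h1
  rw [Finset.sum_eq_zero (s := I), add_zero] at h1
  · rw [← h1]
    refine Finset.sum_congr rfl fun j hj => ?_
    rw [pf_insert hN (Finset.mem_sdiff.1 hj).2]
  · intro j hj
    rw [sum_mul_pf_erase_eq_zero hN hN0 hj, zero_mul]

/-- Adding a multiple of a row to another row does not change a Pfaffian. -/
lemma pf_row_op {R : Type*} [CommRing R] [CharP R 2] {N N' : ℕ → ℕ → R}
    (hN : ∀ a b, N a b = N b a) (hN0 : ∀ a, N a a = 0) (hN' : ∀ a b, N' a b = N' b a)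
    {T : Finset ℕ} {a b : ℕ} (ha : a ∈ T) (hb : b ∈ T) (hab : a ≠ b) (c : R)
    (h : ∀ x ∈ T, x ≠ a → N' a x = N a x + c * N b x)
    (h' : ∀ x ∈ T, ∀ y ∈ T, x ≠ a → y ≠ a → N' x y = N x y) :
    pf N' T = pf N T := by
  rw [pf_expand hN' ha, pf_expand hN ha]
  have h1 : ∑ x ∈ T.erase a, N b x * pf N ((T.erase a).erase x) = 0 :=
    sum_mul_pf_erase_eq_zero hN hN0 (Finset.mem_erase.2 ⟨hab.symm, hb⟩)
  have h2 : ∀ x ∈ T.erase a, N' a x * pf N' ((T.erase a).erase x)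
      = N a x * pf N ((T.erase a).erase x) + c * (N b x * pf N ((T.erase a).erase x)) := by
    intro x hx
    obtain ⟨hxa, hxT⟩ := Finset.mem_erase.1 hx
    rw [h x hxT hxa, pf_congr (N := N') (N' := N)]
    · ring
    · intro y hy z hz _
      simp only [Finset.mem_erase] at hy hz
      exact h' y hy.2.2 z hz.2.2 hy.2.1 hz.2.1
  rw [Finset.sum_congr rfl h2, Finset.sum_add_distrib, ← Finset.mul_sum, h1, mul_zero, add_zero]

lemma pf_eq_zero_of_odd {R : Type*} [CommRing R] {N : ℕ → ℕ → R} (hN : ∀ a b, N a b = N b a)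
    {T : Finset ℕ} (hT : Odd T.card) : pf N T = 0 := by
  induction hn : T.card using Nat.strong_induction_on generalizing T with
  | _ n ih =>
    rcases T.eq_empty_or_nonempty with rfl | ⟨a, ha⟩
    · simp at hT
    · rw [pf_expand hN ha]
      refine Finset.sum_eq_zero fun b hb => ?_
      have h1 := Finset.card_erase_of_mem ha
      have h2 := Finset.card_erase_of_mem hb
      have h3 := Finset.card_pos.2 ⟨a, ha⟩
      have h4 := Finset.card_pos.2 ⟨b, hb⟩
      rw [ih _ (by omega) (by obtain ⟨k, hk⟩ := hT; exact ⟨k - 1, by omega⟩) rfl, mul_zero]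

/-- The split alternating form in characteristic `2`. -/
noncomputable def bform (R : Type*) [CommRing R] (m : ℕ) :
    LinearMap.BilinForm R (Fin m ⊕ Fin m → R) :=
  LinearMap.mk₂ R (fun u v => ∑ j, (u (Sum.inr j) * v (Sum.inl j) + u (Sum.inl j) * v (Sum.inr j)))
    (fun a b c => by
      rw [← Finset.sum_add_distrib]
      exact Finset.sum_congr rfl fun j _ => by simp only [Pi.add_apply]; ring)
    (fun a b c => by
      rw [Finset.smul_sum]
      exact Finset.sum_congr rfl fun j _ => by simp only [Pi.smul_apply, smul_eq_mul]; ring)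
    (fun a b c => by
      rw [← Finset.sum_add_distrib]
      exact Finset.sum_congr rfl fun j _ => by simp only [Pi.add_apply]; ring)
    (fun a b c => by
      rw [Finset.smul_sum]
      exact Finset.sum_congr rfl fun j _ => by simp only [Pi.smul_apply, smul_eq_mul]; ring)

lemma bform_apply {R : Type*} [CommRing R] {m : ℕ} (u v : Fin m ⊕ Fin m → R) :
    bform R m u v
      = ∑ j, (u (Sum.inr j) * v (Sum.inl j) + u (Sum.inl j) * v (Sum.inr j)) := rfl

lemma bform_comm {R : Type*} [CommRing R] {m : ℕ} (u v : Fin m ⊕ Fin m → R) :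
    bform R m u v = bform R m v u := by
  simp only [bform_apply]
  exact Finset.sum_congr rfl fun j _ => by ring

lemma bform_self {R : Type*} [CommRing R] [CharP R 2] {m : ℕ} (u : Fin m ⊕ Fin m → R) :
    bform R m u u = 0 := by
  rw [bform_apply]
  exact Finset.sum_eq_zero fun j _ => by rw [mul_comm, CharTwo.add_self_eq_zero]

lemma bform_map {R R' : Type*} [CommRing R] [CommRing R'] (f : R →+* R') {m : ℕ}
    (u v : Fin m ⊕ Fin m → R) :
    f (bform R m u v) = bform R' m (fun i => f (u i)) (fun i => f (v i)) := by
  simp [bform_apply]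

lemma bform_nondegenerate (K : Type*) [Field K] (m : ℕ) : (bform K m).Nondegenerate := by
  have h : ∀ u, (∀ v, bform K m u v = 0) → u = 0 := by
    intro u hu
    ext i
    rcases i with j | j
    · have := hu (Pi.single (Sum.inr j) 1)
      simpa [bform_apply, Pi.single_apply] using this
    · have := hu (Pi.single (Sum.inl j) 1)
      simpa [bform_apply, Pi.single_apply] using this
  exact ⟨h, fun u hu => h u fun v => by rw [bform_comm]; exact hu v⟩

lemma add_pow_pow_two {R : Type*} [CommRing R] [CharP R 2] {s q : ℕ} (hq : q = 2 ^ s) (a : ℕ)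
    (x y : R) : (x + y) ^ q ^ a = x ^ q ^ a + y ^ q ^ a := by
  rw [hq, ← pow_mul, add_pow_char_pow]

lemma sum_pow_pow_two {R ι : Type*} [CommRing R] [CharP R 2] {s q : ℕ} (hq : q = 2 ^ s) (a : ℕ)
    (t : Finset ι) (f : ι → R) : (∑ i ∈ t, f i) ^ q ^ a = ∑ i ∈ t, f i ^ q ^ a := by
  rw [hq, ← pow_mul, sum_pow_char_pow]

/-- The Gram matrix of the Frobenius twists of `v`. -/
noncomputable def gram {R : Type*} [CommRing R] (q : ℕ) {m : ℕ} (v : Fin m ⊕ Fin m → R)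
    (a b : ℕ) : R :=
  bform R m (fun i => v i ^ q ^ a) (fun i => v i ^ q ^ b)

lemma gram_comm {R : Type*} [CommRing R] (q : ℕ) {m : ℕ} (v : Fin m ⊕ Fin m → R)
    (a b : ℕ) : gram q v a b = gram q v b a := bform_comm _ _

lemma gram_self {R : Type*} [CommRing R] [CharP R 2] (q : ℕ) {m : ℕ} (v : Fin m ⊕ Fin m → R)
    (a : ℕ) : gram q v a a = 0 := bform_self _

lemma gram_add {R : Type*} [CommRing R] [CharP R 2] {s q : ℕ} (hq : q = 2 ^ s) {m : ℕ}
    (v : Fin m ⊕ Fin m → R) (a b c : ℕ) : gram q v (a + c) (b + c) = gram q v a b ^ q ^ c := by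
  simp only [gram, bform_apply]
  rw [sum_pow_pow_two hq]
  refine Finset.sum_congr rfl fun j _ => ?_
  rw [add_pow_pow_two hq]
  simp only [pow_add, pow_mul, mul_pow]

lemma gram_map {R R' : Type*} [CommRing R] [CommRing R'] (f : R →+* R') (q : ℕ) {m : ℕ}
    (v : Fin m ⊕ Fin m → R) (a b : ℕ) :
    f (gram q v a b) = gram q (fun i => f (v i)) a b := by
  simp [gram, bform_map]

/-- The additive polynomial function `t ↦ ∑_j a_j t^{q^j}` as an `F`-linear map. -/
noncomputable def addLin (F : Type*) {K : Type*} [Field F] [Fintype F] [CommRing K] [Algebra F K]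
    (d : ℕ) (a : ℕ → K) : K →ₗ[F] K :=
  ∑ j ∈ Finset.range d,
    a j • ((FiniteField.frobeniusAlgHom F K) ^ j : K →ₐ[F] K).toLinearMap

lemma addLin_apply {F K : Type*} [Field F] [Fintype F] [CommRing K] [Algebra F K]
    (d : ℕ) (a : ℕ → K) (t : K) :
    addLin F d a t = ∑ j ∈ Finset.range d, a j * t ^ Fintype.card F ^ j := by
  simp only [addLin, LinearMap.sum_apply, LinearMap.smul_apply, smul_eq_mul, AlgHom.toLinearMap_apply]
  refine Finset.sum_congr rfl fun j _ => ?_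
  congr 1
  clear * -
  induction j with
  | zero => simp
  | succ j ih =>
    rw [pow_succ', AlgHom.mul_apply, ih, FiniteField.coe_frobeniusAlgHom]
    show (t ^ Fintype.card F ^ j) ^ Fintype.card F = _
    rw [← pow_mul, pow_succ]

/-- An additive polynomial with too many roots vanishes. -/
lemma eq_zero_of_forall_span {F K : Type*} [Field F] [Fintype F] [Field K] [Algebra F K]
    {ι : Type*} [Finite ι] {v : ι → K} {d : ℕ} (f : Polynomial K) (L : K →ₗ[F] K)
    (hf : ∀ t, f.eval t = L t) (hv : ∀ i, L (v i) = 0)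
    (hd : d ≤ Module.finrank F (Submodule.span F (Set.range v)))
    (hdeg : f.natDegree < Fintype.card F ^ d) : f = 0 := by
  by_contra hne
  have hle : Submodule.span F (Set.range v) ≤ LinearMap.ker L := by
    rw [Submodule.span_le]
    rintro _ ⟨i, rfl⟩
    exact hv i
  have : FiniteDimensional F (Submodule.span F (Set.range v)) :=
    FiniteDimensional.span_of_finite F (Set.finite_range v)
  have hfin : Finite (Submodule.span F (Set.range v)) := Module.finite_of_finite F
  have hcard := Module.natCard_eq_pow_finrank (K := F) (V := Submodule.span F (Set.range v))
  have hsub : (Submodule.span F (Set.range v) : Set K) ⊆ (f.roots.toFinset : Set K) := by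
    intro t ht
    simp only [Finset.mem_coe, Multiset.mem_toFinset, Polynomial.mem_roots hne, Polynomial.IsRoot]
    rw [hf]
    exact hle ht
  have h1 := Set.ncard_le_ncard hsub (Finset.finite_toSet _)
  rw [Set.ncard_coe_finset] at h1
  have h2 : (Submodule.span F (Set.range v) : Set K).ncard
      = Nat.card (Submodule.span F (Set.range v)) := rfl
  have h3 := (Multiset.toFinset_card_le f.roots).trans (Polynomial.card_roots' f)
  have h4 : Fintype.card F ^ d ≤ Fintype.card F ^ Module.finrank F (Submodule.span F (Set.range v)) :=
    Nat.pow_le_pow_right Fintype.card_pos hd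
  rw [Nat.card_eq_fintype_card (α := F)] at hcard
  omega

/-- The Frobenius twists of `v` satisfy no short linear relation if the coordinates of `v`
span a large space. -/
lemma coeff_eq_zero_of_sum_twist {F K : Type*} [Field F] [Fintype F] [Field K] [Algebra F K]
    {ι : Type*} [Finite ι] {v : ι → K} {d : ℕ}
    (hd : d ≤ Module.finrank F (Submodule.span F (Set.range v))) (a : ℕ → K)
    (ha : ∀ i, ∑ j ∈ Finset.range d, a j * v i ^ Fintype.card F ^ j = 0) :
    ∀ j < d, a j = 0 := by
  have hc : 1 < Fintype.card F := Fintype.one_lt_card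
  set f : Polynomial K :=
    ∑ j ∈ Finset.range d, Polynomial.C (a j) * Polynomial.X ^ Fintype.card F ^ j with hf
  have h0 : f = 0 := by
    refine eq_zero_of_forall_span f (addLin F d a) (fun t => ?_) (fun i => ?_) hd ?_
    · rw [hf, addLin_apply, Polynomial.eval_finsetSum]
      simp
    · rw [addLin_apply]; exact ha i
    · refine lt_of_le_of_lt (Polynomial.natDegree_sum_le_of_forall_le (n := Fintype.card F ^ d - 1)
        _ _ fun j hj => ?_) (Nat.sub_lt (pow_pos Fintype.card_pos _) one_pos)
      refine (Polynomial.natDegree_C_mul_X_pow_le _ _).trans ?_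
      have := Nat.pow_lt_pow_right hc (Finset.mem_range.1 hj)
      omega
  intro j hj
  have := congrArg (fun g => Polynomial.coeff g (Fintype.card F ^ j)) h0
  simp only [hf, Polynomial.finsetSum_coeff, Polynomial.coeff_C_mul, Polynomial.coeff_X_pow,
    Polynomial.coeff_zero] at this
  rw [Finset.sum_eq_single j] at this
  · simpa using this
  · intro b _ hb
    rw [if_neg, mul_zero]
    exact fun h => hb (Nat.pow_right_injective hc h).symm
  · intro h; exact absurd (Finset.mem_range.2 hj) h

/-- The Frobenius twists of `v` are independent if the coordinates of `v` span a large space. -/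
lemma linearIndependent_twist {F K : Type*} [Field F] [Fintype F] [Field K] [Algebra F K]
    {ι : Type*} [Finite ι] {v : ι → K} {d : ℕ}
    (hd : d ≤ Module.finrank F (Submodule.span F (Set.range v))) :
    LinearIndependent K (fun (j : Fin d) (i : ι) => v i ^ Fintype.card F ^ (j : ℕ)) := by
  rw [Fintype.linearIndependent_iff]
  intro g hg j
  have := coeff_eq_zero_of_sum_twist hd (fun k => if h : k < d then g ⟨k, h⟩ else 0)
    (fun i => by
      have h1 := congrFun hg i
      simp only [Finset.sum_apply, Pi.smul_apply, smul_eq_mul, Pi.zero_apply] at h1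
      rw [Finset.sum_range, ← h1]
      exact Finset.sum_congr rfl fun k _ => by simp) j j.2
  simpa using this

/-- The vector `∑_{i∈T} pf(T∖i) F^i v`. -/
noncomputable def pfVec {R : Type*} [CommRing R] (q : ℕ) {m : ℕ} (v : Fin m ⊕ Fin m → R)
    (T : Finset ℕ) : Fin m ⊕ Fin m → R :=
  fun i => ∑ k ∈ T, pf (gram q v) (T.erase k) * v i ^ q ^ k

lemma bform_twist_pfVec {R : Type*} [CommRing R] (q : ℕ) {m : ℕ}
    (v : Fin m ⊕ Fin m → R) (T : Finset ℕ) (j : ℕ) :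
    bform R m (fun i => v i ^ q ^ j) (pfVec q v T)
      = ∑ k ∈ T, gram q v j k * pf (gram q v) (T.erase k) := by
  have : pfVec q v T = ∑ k ∈ T, pf (gram q v) (T.erase k) • fun i => v i ^ q ^ k := by
    ext i; simp [pfVec]
  rw [this, map_sum]
  exact Finset.sum_congr rfl fun k _ => by
    rw [map_smul, smul_eq_mul, mul_comm]; rfl

lemma bform_twist_pfVec_of_mem {R : Type*} [CommRing R] [CharP R 2] (q : ℕ) {m : ℕ}
    (v : Fin m ⊕ Fin m → R) {T : Finset ℕ} {j : ℕ} (hj : j ∈ T) :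
    bform R m (fun i => v i ^ q ^ j) (pfVec q v T) = 0 := by
  rw [bform_twist_pfVec]
  exact sum_mul_pf_erase_eq_zero (gram_comm q v) (gram_self q v) hj

lemma bform_twist_pfVec_of_notMem {R : Type*} [CommRing R] (q : ℕ) {m : ℕ}
    (v : Fin m ⊕ Fin m → R) {T : Finset ℕ} {j : ℕ} (hj : j ∉ T) :
    bform R m (fun i => v i ^ q ^ j) (pfVec q v T) = pf (gram q v) (insert j T) := by
  rw [bform_twist_pfVec, pf_insert (gram_comm q v) hj]

/-- A subset of maximal size of `D` with nonzero Pfaffian. -/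
lemma exists_max_pf {R : Type*} [CommRing R] [Nontrivial R] (N : ℕ → ℕ → R) (D : Finset ℕ) :
    ∃ T ⊆ D, pf N T ≠ 0 ∧ ∀ T' ⊆ D, T.card < T'.card → pf N T' = 0 := by
  have hne : (D.powerset.filter fun T => pf N T ≠ 0).Nonempty :=
    ⟨∅, by simp [pf_empty]⟩
  obtain ⟨T, hT, hmax⟩ := Finset.exists_max_image _ Finset.card hne
  simp only [Finset.mem_filter, Finset.mem_powerset] at hT hmax
  refine ⟨T, hT.1, hT.2, fun T' hT' hlt => ?_⟩
  by_contra h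
  exact absurd (hmax T' ⟨hT', h⟩) (not_le.2 hlt)

/-- The vectors attached to a maximal nonvanishing Pfaffian are orthogonal to all twists in
the range. -/
lemma bform_pfVec_insert_of_max {R : Type*} [CommRing R] [CharP R 2] (q : ℕ) {m : ℕ}
    (v : Fin m ⊕ Fin m → R) {D T : Finset ℕ} (hTD : T ⊆ D)
    (hmax : ∀ T' ⊆ D, T.card < T'.card → pf (gram q v) T' = 0) {a : ℕ} (ha : a ∈ D)
    (haT : a ∉ T) {j : ℕ} (hj : j ∈ D) :
    bform R m (fun i => v i ^ q ^ j) (pfVec q v (insert a T)) = 0 := by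
  by_cases h : j ∈ insert a T
  · exact bform_twist_pfVec_of_mem q v h
  · rw [bform_twist_pfVec_of_notMem q v h]
    refine hmax _ ?_ ?_
    · exact Finset.insert_subset hj (Finset.insert_subset ha hTD)
    · rw [Finset.card_insert_of_notMem h, Finset.card_insert_of_notMem haT]; omega

/-- Extracting coefficients from a relation among twists indexed by a subset. -/
lemma coeff_eq_zero_of_sum_twist_subset {F K : Type*} [Field F] [Fintype F] [Field K]
    [Algebra F K] {ι : Type*} [Finite ι] {v : ι → K} {d : ℕ}
    (hd : d ≤ Module.finrank F (Submodule.span F (Set.range v))) (a : ℕ → K) {T : Finset ℕ}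
    (hT : T ⊆ Finset.range d)
    (ha : ∀ i, ∑ j ∈ T, a j * v i ^ Fintype.card F ^ j = 0) :
    ∀ j ∈ T, a j = 0 := by
  intro j hj
  have := coeff_eq_zero_of_sum_twist hd (fun k => if k ∈ T then a k else 0) (fun i => by
    rw [← Finset.sum_subset hT (fun k _ hk => by simp only [hk, if_false, zero_mul]), ← ha i]
    exact Finset.sum_congr rfl fun k hk => by simp only [hk, if_true]) j (Finset.mem_range.1 (hT hj))
  simpa [hj] using this

/-- The twists of a vector with independent coordinates span the whole space. -/
lemma eq_zero_of_bform_twist {F K : Type*} [Field F] [Fintype F] [Field K] [Algebra F K]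
    {m : ℕ} {v : Fin m ⊕ Fin m → K}
    (hd : 2 * m ≤ Module.finrank F (Submodule.span F (Set.range v))) (y : Fin m ⊕ Fin m → K)
    (hy : ∀ j < 2 * m, bform K m (fun i => v i ^ Fintype.card F ^ j) y = 0) : y = 0 := by
  have hspan := (linearIndependent_twist hd).span_eq_top_of_card_eq_finrank' (by simp; ring)
  refine (bform_nondegenerate K m).2 _ fun w => ?_
  have hw : w ∈ (⊤ : Submodule K (Fin m ⊕ Fin m → K)) := trivial
  rw [← hspan] at hw
  induction hw using Submodule.span_induction with
  | mem x hx =>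
    obtain ⟨j, rfl⟩ := hx
    exact hy j j.2
  | zero => simp
  | add x y _ _ hx hy => simp [hx, hy]
  | smul c x _ hx => simp [hx]

/-- If the coordinates of `v` are independent over `F` then the full Pfaffian does not vanish. -/
lemma pf_gram_ne_zero {F K : Type*} [Field F] [Fintype F] [Field K] [Algebra F K] [CharP K 2]
    {m : ℕ} {v : Fin m ⊕ Fin m → K}
    (hd : 2 * m ≤ Module.finrank F (Submodule.span F (Set.range v))) :
    pf (gram (Fintype.card F) v) (Finset.range (2 * m)) ≠ 0 := by
  set q := Fintype.card F with hq
  obtain ⟨T, hTD, hT, hmax⟩ := exists_max_pf (gram q v) (Finset.range (2 * m))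
  by_cases hTe : T = Finset.range (2 * m)
  · rwa [← hTe]
  exfalso
  obtain ⟨a, ha, haT⟩ := Finset.exists_of_ssubset (Finset.ssubset_iff_subset_ne.2 ⟨hTD, hTe⟩)
  have h0 : pfVec q v (insert a T) = 0 := eq_zero_of_bform_twist hd _ fun j hj =>
    bform_pfVec_insert_of_max q v hTD hmax ha haT (by simpa using hj)
  have h1 := coeff_eq_zero_of_sum_twist_subset hd (fun k => pf (gram q v) ((insert a T).erase k))
    (Finset.insert_subset ha hTD) (fun i => congrFun h0 i) a (Finset.mem_insert_self a T)
  rw [Finset.erase_insert haT] at h1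
  exact hT h1

lemma finrank_le_of_isotropic {K : Type*} [Field K] {m : ℕ}
    (W : Submodule K (Fin m ⊕ Fin m → K)) (hW : ∀ x ∈ W, ∀ y ∈ W, bform K m x y = 0) :
    Module.finrank K W ≤ m := by
  have h1 : W ≤ (bform K m).orthogonal W := fun x hx => by
    rw [LinearMap.BilinForm.mem_orthogonal_iff]
    exact fun y hy => hW y hy x hx
  have h2 := Submodule.finrank_mono h1
  rw [LinearMap.BilinForm.finrank_orthogonal (bform_nondegenerate K m)] at h2
  have h3 : Module.finrank K (Fin m ⊕ Fin m → K) = 2 * m := by simp; ring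
  omega

/-- Kernel and image of an additive polynomial of low degree. -/
lemma le_finrank_addLin {F K : Type*} [Field F] [Fintype F] [Field K] [Algebra F K]
    {ι : Type*} [Finite ι] {v : ι → K} {d e : ℕ} (κ : ℕ → K)
    (hd : d + e ≤ Module.finrank F (Submodule.span F (Set.range v)) + 1)
    (hκ : ∃ j < d, κ j ≠ 0) :
    e ≤ Module.finrank F (Submodule.span F (Set.range fun i => addLin F d κ (v i))) := by
  set V := Submodule.span F (Set.range v)
  set L := addLin F d κ
  have : FiniteDimensional F V := FiniteDimensional.span_of_finite F (Set.finite_range v)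
  have h1 : Submodule.span F (Set.range fun i => L (v i)) = LinearMap.range (L.domRestrict V) := by
    rw [LinearMap.range_domRestrict, Submodule.map_span, ← Set.range_comp]; rfl
  rw [h1]
  have h2 := LinearMap.finrank_range_add_finrank_ker (L.domRestrict V)
  by_contra hlt
  have h3 : d ≤ Module.finrank F (LinearMap.ker (L.domRestrict V)) := by
    have : Module.finrank F (Submodule.span F (Set.range v)) = Module.finrank F V := rfl
    omega
  set f := V.subtype ∘ₗ (LinearMap.ker (L.domRestrict V)).subtype
  have hinj : Function.Injective f :=
    (Submodule.subtype_injective V).comp (Submodule.subtype_injective _)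
  have h4 : Module.finrank F (Submodule.span F (Set.range f))
      = Module.finrank F (LinearMap.ker (L.domRestrict V)) := by
    rw [← LinearMap.coe_range, Submodule.span_eq, LinearMap.finrank_range_of_inj hinj]
  have hfin : Finite (LinearMap.ker (L.domRestrict V)) := Module.finite_of_finite F
  obtain ⟨j, hj, hjne⟩ := hκ
  refine hjne (coeff_eq_zero_of_sum_twist (v := f) (d := d) (by rw [h4]; exact h3) κ
    (fun x => ?_) j hj)
  have := x.2
  rw [LinearMap.mem_ker, LinearMap.domRestrict_apply] at this
  rw [← addLin_apply]
  exact this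

lemma exists_pf_erase_ne_zero {F K : Type*} [Field F] [Fintype F] [Field K] [Algebra F K]
    [CharP K 2] {s m : ℕ} (hq : Fintype.card F = 2 ^ s) (hm : 2 ≤ m) {v : Fin m ⊕ Fin m → K}
    (hd : 2 * m - 1 ≤ Module.finrank F (Submodule.span F (Set.range v))) :
    ∃ k, m - 1 ≤ k ∧ k < 2 * m - 1 ∧
      pf (gram (Fintype.card F) v) ((Finset.range (2 * m - 1)).erase k) ≠ 0 := by
  set q := Fintype.card F with hqdef
  by_contra! hcon
  set D := Finset.range (2 * m - 1) with hD
  set κ : ℕ → K := fun k => pf (gram q v) (D.erase k) with hκ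
  have hmem : ∀ {j}, j ∈ D ↔ j < 2 * m - 1 := by simp [hD]
  by_cases hall : ∀ k ∈ D, κ k = 0
  · obtain ⟨T, hTD, hT, hmax⟩ := exists_max_pf (gram q v) D
    have hTcard : T.card + 3 ≤ 2 * m := by
      have h1 := Finset.card_le_card hTD
      have h2 : D.card = 2 * m - 1 := by simp [hD]
      have hodd : ¬ Odd T.card := fun h => hT (pf_eq_zero_of_odd (gram_comm q v) h)
      by_contra hlt
      have h3 : T.card = 2 * m - 1 ∨ T.card = 2 * m - 2 := by omega
      rcases h3 with h3 | h3
      · exact hodd ⟨m - 1, by omega⟩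
      · have h4 : (D \ T).card = 1 := by rw [Finset.card_sdiff_of_subset hTD]; omega
        obtain ⟨k, hk⟩ := Finset.card_eq_one.1 h4
        have hk1 : k ∈ D \ T := by rw [hk]; simp
        have h5 : T = D.erase k := by
          rw [Finset.erase_eq, ← hk, Finset.sdiff_sdiff_eq_self hTD]
        exact hT (by rw [h5]; exact hall k (Finset.mem_sdiff.1 hk1).1)
    have h2 : 1 < (D \ T).card := by
      rw [Finset.card_sdiff_of_subset hTD]; simp [hD]; omega
    obtain ⟨a, ha, b, hb, hab⟩ := Finset.one_lt_card.1 h2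
    rw [Finset.mem_sdiff] at ha hb
    have hli := linearIndependent_twist hd
    set Y := Submodule.span K (Set.range
      fun (j : Fin (2 * m - 1)) (i : Fin m ⊕ Fin m) => v i ^ Fintype.card F ^ (j : ℕ))
    have hY : Module.finrank K Y = 2 * m - 1 := by
      have := finrank_span_eq_card hli
      simpa using this
    have hmemO : ∀ a ∈ D, a ∉ T → pfVec q v (insert a T) ∈ (bform K m).orthogonal Y := by
      intro a ha haT
      rw [LinearMap.BilinForm.mem_orthogonal_iff]
      intro w hw
      show bform K m w _ = 0
      induction hw using Submodule.span_induction with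
      | mem x hx =>
        obtain ⟨j, rfl⟩ := hx
        exact bform_pfVec_insert_of_max q v hTD hmax ha haT (hmem.2 j.2)
      | zero => simp
      | add x y _ _ hx hy => simp [hx, hy]
      | smul c x _ hx => simp [hx]
    have hO : Module.finrank K ((bform K m).orthogonal Y) ≤ 1 := by
      rw [LinearMap.BilinForm.finrank_orthogonal (bform_nondegenerate K m), hY]
      have h3 : Module.finrank K (Fin m ⊕ Fin m → K) = 2 * m := by simp; ring
      omega
    obtain ⟨⟨z, hz⟩, hzs⟩ := finrank_le_one_iff.1 hO
    obtain ⟨ca, hca⟩ := hzs ⟨_, hmemO a ha.1 ha.2⟩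
    obtain ⟨cb, hcb⟩ := hzs ⟨_, hmemO b hb.1 hb.2⟩
    have hca' := congrArg Subtype.val hca
    have hcb' := congrArg Subtype.val hcb
    simp only [SetLike.mk_smul_mk] at hca' hcb'
    have hcoef : ∀ α β : K, α • pfVec q v (insert a T) + β • pfVec q v (insert b T) = 0 →
        α = 0 := by
      intro α β h
      have := coeff_eq_zero_of_sum_twist_subset hd
        (fun k => α * (if k ∈ insert a T then pf (gram q v) ((insert a T).erase k) else 0)
          + β * (if k ∈ insert b T then pf (gram q v) ((insert b T).erase k) else 0))
        (T := insert a (insert b T))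
        (Finset.insert_subset ha.1 (Finset.insert_subset hb.1 hTD)) (fun i => by
          refine Eq.trans ?_ (congrFun h i)
          simp only [Pi.add_apply, Pi.smul_apply, smul_eq_mul, pfVec, Finset.mul_sum, add_mul,
            Finset.sum_add_distrib]
          congr 1
          · rw [← Finset.sum_subset (s₁ := insert a T)
              (Finset.insert_subset_insert _ (Finset.subset_insert _ _))
              (fun k _ hk => by simp only [hk, if_false, mul_zero, zero_mul])]
            exact Finset.sum_congr rfl fun k hk => by simp only [hk, if_true, mul_assoc, q]
          · rw [← Finset.sum_subset (s₁ := insert b T) (Finset.subset_insert _ _)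
              (fun k _ hk => by simp only [hk, if_false, mul_zero, zero_mul])]
            exact Finset.sum_congr rfl fun k hk => by simp only [hk, if_true, mul_assoc, q])
        a (Finset.mem_insert_self _ _)
      have h1 : a ∉ insert b T := by simp [hab, ha.2]
      simp only [Finset.mem_insert_self, if_true, Finset.erase_insert ha.2, h1, if_false,
        mul_zero, add_zero] at this
      exact (mul_eq_zero.1 this).resolve_right hT
    have h3 : cb = 0 := hcoef cb (-ca) (by rw [← hca', ← hcb']; module)
    have h4 : (1 : K) = 0 := by
      have hb0 : pfVec q v (insert b T) = 0 := by rw [← hcb', h3, zero_smul]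
      have := coeff_eq_zero_of_sum_twist_subset hd
        (fun k => pf (gram q v) ((insert b T).erase k))
        (Finset.insert_subset hb.1 hTD) (fun i => congrFun hb0 i) b (Finset.mem_insert_self b T)
      rw [Finset.erase_insert hb.2] at this
      exact absurd this hT
    exact one_ne_zero h4
  · push Not at hall
    obtain ⟨k0, hk0, hk0ne⟩ := hall
    have hzero : ∀ k ∈ D, m - 1 ≤ k → κ k = 0 := fun k hk h => hcon k h (hmem.1 hk)
    have hk0' : k0 < m - 1 := by
      by_contra h
      exact hk0ne (hzero k0 hk0 (by omega))
    set ω := pfVec q v D with hω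
    have hωL : ∀ i, ω i = ∑ k ∈ Finset.range (m - 1), κ k * v i ^ q ^ k := fun i => by
      rw [hω, pfVec]
      symm
      refine Finset.sum_subset (fun k hk => hmem.2 ?_) (fun k hk hk' => ?_)
      · have := Finset.mem_range.1 hk; omega
      · have h0 : κ k = 0 := hzero k hk (by simpa using hk')
        rw [h0, zero_mul]
    have hfr : m + 1 ≤ Module.finrank F (Submodule.span F (Set.range ω)) := by
      have := le_finrank_addLin (F := F) (v := v) (d := m - 1) (e := m + 1) κ (by omega)
        ⟨k0, hk0', hk0ne⟩
      have h1 : ω = fun i => addLin F (m - 1) κ (v i) := by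
        ext i
        rw [addLin_apply, hωL]
      rw [h1]
      exact this
    have hli := linearIndependent_twist hfr
    have hgram0 : ∀ c ≤ m, gram q ω 0 c = 0 := by
      intro c hc
      have h1 : (fun i => ω i ^ q ^ c)
          = ∑ k ∈ Finset.range (m - 1), κ k ^ q ^ c • fun i => v i ^ q ^ (k + c) := by
        ext i
        rw [hωL, sum_pow_pow_two hq]
        simp only [Finset.sum_apply, Pi.smul_apply, smul_eq_mul]
        exact Finset.sum_congr rfl fun k _ => by rw [mul_pow, ← pow_mul, ← pow_add]
      rw [gram, h1, map_sum]
      refine Finset.sum_eq_zero fun k hk => ?_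
      rw [map_smul, bform_comm]
      simp only [pow_zero, pow_one]
      rw [show (fun i => ω i) = pfVec q v D from rfl, bform_twist_pfVec_of_mem, smul_zero]
      have := Finset.mem_range.1 hk
      exact hmem.2 (by omega)
    have hgram : ∀ a ≤ m, ∀ b ≤ m, gram q ω a b = 0 := by
      intro a ha b hb
      wlog hab : a ≤ b generalizing a b
      · rw [gram_comm]; exact this b hb a ha (by omega)
      obtain ⟨c, rfl⟩ := Nat.exists_eq_add_of_le hab
      have := gram_add hq ω 0 c a
      rw [zero_add, add_comm] at this
      rw [this, hgram0 c (by omega), zero_pow (pow_pos (by simp [q]; exact Fintype.card_pos) _).ne']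
    have := finrank_le_of_isotropic (Submodule.span K (Set.range
      fun (j : Fin (m + 1)) (i : Fin m ⊕ Fin m) => ω i ^ Fintype.card F ^ (j : ℕ))) (by
        intro x hx y hy
        induction hx using Submodule.span_induction with
        | mem x hx =>
          obtain ⟨a, rfl⟩ := hx
          induction hy using Submodule.span_induction with
          | mem y hy =>
            obtain ⟨b, rfl⟩ := hy
            exact hgram a (by omega) b (by omega)
          | zero => simp
          | add x y _ _ hx hy => simp [hx, hy]
          | smul c x _ hx => simp [hx]
        | zero => simp
        | add x y _ _ hx hy => simp [hx, hy]
        | smul c x _ hx => simp [hx])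
    rw [finrank_span_eq_card hli] at this
    simp at this

/-- The generic vector `(y_1,…,y_m,x_1,…,x_m)`. -/
noncomputable def genVec (m : ℕ) (F : Type*) [Field F] :
    Fin m ⊕ Fin m → MvPolynomial (OIdx m) F := fun i => X (some i)

/-- The Pfaffian in the elements `ξ_j` attached to a finite set of exponents. -/
noncomputable abbrev gpf (q m : ℕ) (F : Type*) [Field F] (T : Finset ℕ) :
    MvPolynomial (OIdx m) F := pf (gram q (genVec m F)) T

lemma gram_zero_left {q m : ℕ} {F : Type*} [Field F] (i : ℕ) :
    gram q (genVec m F) 0 i = xiGen q m F i := by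
  simp [gram, bform_apply, xiGen, genVec]

lemma gram_genVec {q m s : ℕ} {F : Type*} [Field F] [CharP F 2] (hq : q = 2 ^ s) (a c : ℕ) :
    gram q (genVec m F) a (c + a) = xiGen q m F c ^ q ^ a := by
  rw [← gram_zero_left, ← gram_add hq, zero_add]

lemma natSum_eq_gpf {q m s : ℕ} {F : Type*} [Field F] [CharP F 2] (hq : q = 2 ^ s)
    (T : Finset ℕ) : natSum q m F T = gpf q m F T := by
  refine (pf_congr (N := fun a b => xiGen q m F (b - a) ^ q ^ a) ?_ : _ = _)
  intro a _ b _ hab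
  obtain ⟨c, rfl⟩ := Nat.exists_eq_add_of_le' hab.le
  rw [gram_genVec hq, Nat.add_sub_cancel]

lemma finrank_span_genVec (m : ℕ) (F K : Type*) [Field F] [Field K] [Algebra F K]
    [Algebra (MvPolynomial (OIdx m) F) K] [IsFractionRing (MvPolynomial (OIdx m) F) K]
    [IsScalarTower F (MvPolynomial (OIdx m) F) K] :
    Module.finrank F (Submodule.span F (Set.range
      fun i => algebraMap (MvPolynomial (OIdx m) F) K (genVec m F i))) = 2 * m := by
  have h : LinearIndependent F
      (fun i => algebraMap (MvPolynomial (OIdx m) F) K (genVec m F i)) := by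
    have h1 := (linearIndependent_X (OIdx m) F).comp (some : Fin m ⊕ Fin m → OIdx m)
      (Option.some_injective _)
    exact h1.map' (IsScalarTower.toAlgHom F (MvPolynomial (OIdx m) F) K).toLinearMap
      (LinearMap.ker_eq_bot.2 (IsFractionRing.injective (MvPolynomial (OIdx m) F) K))
  rw [finrank_span_eq_card h]
  simp; ring

lemma gpf_range_ne_zero {q m : ℕ} {F : Type*} [Field F] [Fintype F] [CharP F 2]
    (hF : Fintype.card F = q) : gpf q m F (Finset.range (2 * m)) ≠ 0 := by
  intro h
  have h1 := congrArg (algebraMap _ (FractionRing (MvPolynomial (OIdx m) F))) h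
  rw [gpf, pf_map, map_zero] at h1
  simp only [gram_map, ← hF] at h1
  exact pf_gram_ne_zero (finrank_span_genVec m F _).ge h1

lemma gpf_range_sub_two_ne_zero {q m : ℕ} {F : Type*} [Field F] [Fintype F] [CharP F 2]
    (hF : Fintype.card F = q) (hm : 1 ≤ m) : gpf q m F (Finset.range (2 * m - 2)) ≠ 0 := by
  obtain ⟨n, rfl⟩ : ∃ n, m = n + 1 := ⟨m - 1, by omega⟩
  intro h
  let φ : MvPolynomial (OIdx (n + 1)) F →+* MvPolynomial (OIdx n) F :=
    (aeval (R := F) fun i : OIdx (n + 1) => match i with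
      | none => X none
      | some (Sum.inl j) => Fin.lastCases 0 (fun k => X (some (Sum.inl k))) j
      | some (Sum.inr j) => Fin.lastCases 0 (fun k => X (some (Sum.inr k))) j).toRingHom
  have hq0 : q ≠ 0 := by rw [← hF]; exact Fintype.card_ne_zero
  have h1 := congrArg φ h
  rw [gpf, pf_map, map_zero] at h1
  refine gpf_range_ne_zero (m := n) hF ?_
  rw [← h1]
  have h2 : 2 * (n + 1) - 2 = 2 * n := by omega
  rw [h2]
  refine pf_congr fun a _ b _ _ => ?_
  rw [gram_map]
  simp only [gram, bform_apply, Fin.sum_univ_castSucc]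
  simp [φ, genVec, hq0]

/-- The linear form with coefficients `c` in the variables `y_j, x_j`. -/
noncomputable def linForm {m : ℕ} {F : Type*} [Field F] (c : Fin m ⊕ Fin m → F) :
    MvPolynomial (OIdx m) F := ∑ i, C (c i) * X (some i)

lemma linForm_injective {m : ℕ} {F : Type*} [Field F] :
    Function.Injective (linForm : (Fin m ⊕ Fin m → F) → MvPolynomial (OIdx m) F) := by
  intro c c' h
  ext i
  have := congrArg (MvPolynomial.coeff (Finsupp.single (some i) 1)) h
  simpa [linForm, coeff_sum, coeff_C_mul, coeff_X, Finsupp.single_left_inj,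
    -Fintype.sum_sum_type] using this

lemma pfVec_genVec_eq_zero {q m : ℕ} {F : Type*} [Field F] [Fintype F] [CharP F 2]
    (hF : Fintype.card F = q) : pfVec q (genVec m F) (Finset.range (2 * m + 1)) = 0 := by
  have h := eq_zero_of_bform_twist (F := F) (finrank_span_genVec m F
    (FractionRing (MvPolynomial (OIdx m) F))).ge
    (fun i => algebraMap _ _ (pfVec q (genVec m F) (Finset.range (2 * m + 1)) i)) (fun j hj => by
      have h1 := bform_twist_pfVec_of_mem q (genVec m F) (T := Finset.range (2 * m + 1)) (j := j)
        (by simp; omega)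
      have h2 := congrArg (algebraMap _ (FractionRing (MvPolynomial (OIdx m) F))) h1
      rw [bform_map, map_zero] at h2
      rw [hF]
      simpa using h2)
  ext1 i
  refine IsFractionRing.injective _ (FractionRing (MvPolynomial (OIdx m) F)) ?_
  have := congrFun h i
  rw [Pi.zero_apply, map_zero]
  exact this

lemma sum_gpf_linForm_eq_zero {q m : ℕ} {F : Type*} [Field F] [Fintype F] [CharP F 2]
    (hF : Fintype.card F = q) (c : Fin m ⊕ Fin m → F) :
    ∑ k ∈ Finset.range (2 * m + 1),
      gpf q m F ((Finset.range (2 * m + 1)).erase k) * linForm c ^ q ^ k = 0 := by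
  set κ := fun k => gpf q m F ((Finset.range (2 * m + 1)).erase k)
  have h : addLin F (2 * m + 1) κ (linForm c) = 0 := by
    have h0 : linForm c = ∑ i, c i • genVec m F i := by
      simp [linForm, genVec, smul_eq_C_mul]
    rw [h0, map_sum]
    refine Finset.sum_eq_zero fun i _ => ?_
    rw [map_smul, addLin_apply, hF]
    have := congrFun (pfVec_genVec_eq_zero (m := m) hF) i
    rw [pfVec, Pi.zero_apply] at this
    rw [this, smul_zero]
  rw [addLin_apply, hF] at h
  exact h

lemma dickP_monic (m : ℕ) (F : Type*) [Field F] [Fintype F] : (dickP m F).Monic :=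
  Polynomial.monic_prod_of_monic _ _ fun _ _ => Polynomial.monic_X_add_C _

lemma dickP_natDegree (m : ℕ) (F : Type*) [Field F] [Fintype F] :
    (dickP m F).natDegree = Fintype.card F ^ (2 * m) := by
  rw [dickP, Polynomial.natDegree_prod_of_monic _ _ fun _ _ => Polynomial.monic_X_add_C _]
  simp only [Polynomial.natDegree_X_add_C]
  simp [two_mul]

lemma dickP_eval {m : ℕ} {F : Type*} [Field F] [Fintype F] [CharP F 2] (c : Fin m ⊕ Fin m → F) :
    (dickP m F).eval (linForm c) = 0 := by
  rw [dickP, Polynomial.eval_prod]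
  refine Finset.prod_eq_zero (Finset.mem_univ c) ?_
  simp only [Polynomial.eval_add, Polynomial.eval_X, Polynomial.eval_C]
  exact CharTwo.add_self_eq_zero _

/-- The Dickson polynomial is additive, with Pfaffian coefficients. -/
lemma C_mul_dickP {q m : ℕ} {F : Type*} [Field F] [Fintype F] [CharP F 2]
    (hF : Fintype.card F = q) :
    Polynomial.C (gpf q m F (Finset.range (2 * m))) * dickP m F
      = ∑ k ∈ Finset.range (2 * m + 1),
        Polynomial.C (gpf q m F ((Finset.range (2 * m + 1)).erase k)) * Polynomial.X ^ q ^ k := by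
  have hq1 : 1 < q := by rw [← hF]; exact Fintype.one_lt_card
  rw [← sub_eq_zero]
  refine Polynomial.eq_zero_of_natDegree_lt_card_of_eval_eq_zero _ linForm_injective
    (fun c => ?_) ?_
  · rw [Polynomial.eval_sub, Polynomial.eval_mul, dickP_eval, mul_zero, zero_sub, neg_eq_zero,
      Polynomial.eval_finsetSum, ← sum_gpf_linForm_eq_zero hF c]
    exact Finset.sum_congr rfl fun k _ => by simp
  · have hcard : Fintype.card (Fin m ⊕ Fin m → F) = q ^ (2 * m) := by simp [hF, two_mul]
    rw [hcard]
    have hu : (Finset.range (2 * m + 1)).erase (2 * m) = Finset.range (2 * m) := by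
      rw [Finset.range_add_one, Finset.erase_insert (by simp)]
    rw [Finset.sum_range_succ, hu, sub_add_eq_sub_sub, sub_right_comm, ← mul_sub]
    have h1 : (dickP m F - Polynomial.X ^ q ^ (2 * m)).natDegree < q ^ (2 * m) := by
      have hpos : 0 < q ^ (2 * m) := pow_pos (by omega) _
      by_cases h0 : dickP m F - Polynomial.X ^ q ^ (2 * m) = 0
      · rw [h0]; simpa using hpos
      have h2 : (dickP m F).degree = ((q ^ (2 * m) : ℕ) : WithBot ℕ) := by
        rw [Polynomial.degree_eq_natDegree (dickP_monic m F).ne_zero, dickP_natDegree, hF]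
      rw [← Nat.cast_lt (α := WithBot ℕ), ← Polynomial.degree_eq_natDegree h0, ← h2]
      refine Polynomial.degree_sub_lt_left (by rw [h2, Polynomial.degree_X_pow])
        (dickP_monic m F).ne_zero ?_
      rw [dickP_monic, Polynomial.Monic.leadingCoeff (Polynomial.monic_X_pow _)]
    refine lt_of_le_of_lt (Polynomial.natDegree_sub_le _ _) (max_lt ?_ ?_)
    · exact lt_of_le_of_lt (Polynomial.natDegree_C_mul_le _ _) h1
    · refine lt_of_le_of_lt (Polynomial.natDegree_sum_le_of_forall_le (n := q ^ (2 * m) - 1)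
        _ _ fun j hj => ?_) (Nat.sub_lt (pow_pos (by omega) _) one_pos)
      refine (Polynomial.natDegree_C_mul_X_pow_le _ _).trans ?_
      have := Nat.pow_lt_pow_right hq1 (Finset.mem_range.1 hj)
      omega

lemma gpf_mul_dickP_coeff {q m : ℕ} {F : Type*} [Field F] [Fintype F] [CharP F 2]
    (hF : Fintype.card F = q) {k : ℕ} (hk : k < 2 * m + 1) :
    gpf q m F (Finset.range (2 * m)) * (dickP m F).coeff (q ^ k)
      = gpf q m F ((Finset.range (2 * m + 1)).erase k) := by
  have hq1 : 1 < q := by rw [← hF]; exact Fintype.one_lt_card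
  rw [← Polynomial.coeff_C_mul, C_mul_dickP hF, Polynomial.finsetSum_coeff,
    Finset.sum_eq_single k]
  · simp
  · intro b _ hb
    rw [Polynomial.coeff_C_mul, Polynomial.coeff_X_pow, if_neg, mul_zero]
    exact fun h => hb (Nat.pow_right_injective hq1 h).symm
  · intro h; exact absurd (Finset.mem_range.2 hk) h

/-- `p` has constant coefficient `f`, coefficient `f'` at `Q`, and no other coefficients
between `n` and `Q`. -/
def HasShift {R : Type*} [CommRing R] (Q n : ℕ) (p : Polynomial R) (f f' : R) : Prop :=
  p.coeff 0 = f ∧ p.coeff Q = f' ∧ ∀ j, n < j → j < Q → p.coeff j = 0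

lemma HasShift.mono {R : Type*} [CommRing R] {Q n n' : ℕ} {p : Polynomial R} {f f' : R}
    (h : HasShift Q n p f f') (hn : n ≤ n') : HasShift Q n' p f f' :=
  ⟨h.1, h.2.1, fun j hj => h.2.2 j (by omega)⟩

lemma HasShift.add {R : Type*} [CommRing R] {Q n : ℕ} {p p' : Polynomial R} {f f' g g' : R}
    (h : HasShift Q n p f f') (h' : HasShift Q n p' g g') :
    HasShift Q n (p + p') (f + g) (f' + g') :=
  ⟨by rw [Polynomial.coeff_add, h.1, h'.1], by rw [Polynomial.coeff_add, h.2.1, h'.2.1],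
    fun j hj hjQ => by rw [Polynomial.coeff_add, h.2.2 j hj hjQ, h'.2.2 j hj hjQ, add_zero]⟩

lemma HasShift.sum {R ι : Type*} [CommRing R] {Q n : ℕ} (t : Finset ι) {p : ι → Polynomial R}
    {f f' : ι → R} (h : ∀ i ∈ t, HasShift Q n (p i) (f i) (f' i)) :
    HasShift Q n (∑ i ∈ t, p i) (∑ i ∈ t, f i) (∑ i ∈ t, f' i) := by
  induction t using Finset.induction_on with
  | empty => exact ⟨by simp, by simp, fun j _ _ => by simp⟩
  | insert a t ha ih =>
    rw [Finset.sum_insert ha, Finset.sum_insert ha, Finset.sum_insert ha]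
    exact (h a (Finset.mem_insert_self a t)).add
      (ih fun i hi => h i (Finset.mem_insert_of_mem hi))

lemma HasShift.mul {R : Type*} [CommRing R] {Q n n' : ℕ} {p p' : Polynomial R} {f f' g g' : R}
    (h : HasShift Q n p f f') (h' : HasShift Q n' p' g g') (hn : n + n' < Q) :
    HasShift Q (n + n') (p * p') (f * g) (f' * g + f * g') := by
  refine ⟨by rw [Polynomial.mul_coeff_zero, h.1, h'.1], ?_, fun j hj hjQ => ?_⟩
  · rw [Polynomial.coeff_mul, ← h.1, ← h'.1, ← h.2.1, ← h'.2.1,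
      Finset.sum_eq_add_of_mem (a := (Q, 0)) (b := (0, Q)) (by simp) (by simp)
      (by simp; omega)]
    rintro ⟨a, b⟩ hab ⟨h1, h2⟩
    rw [Finset.HasAntidiagonal.mem_antidiagonal] at hab
    simp only at hab ⊢
    have hb : b ≠ 0 := by rintro rfl; exact h1 (by rw [← hab]; simp)
    have ha : a ≠ 0 := by rintro rfl; exact h2 (by rw [← hab]; simp)
    by_cases han : n < a
    · rw [h.2.2 a han (by omega), zero_mul]
    · rw [h'.2.2 b (by omega) (by omega), mul_zero]
  · rw [Polynomial.coeff_mul]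
    refine Finset.sum_eq_zero ?_
    rintro ⟨a, b⟩ hab
    rw [Finset.HasAntidiagonal.mem_antidiagonal] at hab
    simp only at hab ⊢
    by_cases han : n < a
    · rw [h.2.2 a han (by omega), zero_mul]
    · rw [h'.2.2 b (by omega) (by omega), mul_zero]

lemma stP_X {q : ℕ} {σ F : Type*} [Field F] (i : σ) :
    stP q σ F (X i) = Polynomial.C (X i) + Polynomial.C (X i ^ q) * Polynomial.X := by
  simp [stP]

lemma stP_X_pow {q s : ℕ} {σ F : Type*} [Field F] [CharP F 2] (hq : q = 2 ^ s) (i : σ) (a : ℕ) :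
    stP q σ F (X i) ^ q ^ a = Polynomial.C (X i ^ q ^ a)
      + Polynomial.C (X i ^ q ^ (a + 1)) * Polynomial.X ^ q ^ a := by
  rw [stP_X, add_pow_pow_two hq, mul_pow, ← Polynomial.C_pow, ← Polynomial.C_pow, ← pow_mul,
    pow_succ']

lemma stP_gram {q m s : ℕ} {F : Type*} [Field F] [CharP F 2] (hq : q = 2 ^ s) (a b : ℕ) :
    stP q (OIdx m) F (gram q (genVec m F) a b)
      = Polynomial.C (gram q (genVec m F) a b)
        + Polynomial.C (gram q (genVec m F) (a + 1) b) * Polynomial.X ^ q ^ a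
        + Polynomial.C (gram q (genVec m F) a (b + 1)) * Polynomial.X ^ q ^ b
        + Polynomial.C (gram q (genVec m F) (a + 1) (b + 1)) * Polynomial.X ^ (q ^ a + q ^ b) := by
  have := gram_map (stP q (OIdx m) F).toRingHom q (genVec m F) a b
  refine this.trans ?_
  simp only [gram, bform_apply, genVec, AlgHom.toRingHom_eq_coe, RingHom.coe_coe, stP_X_pow hq,
    map_sum, Finset.sum_mul, ← Finset.sum_add_distrib]
  refine Finset.sum_congr rfl fun j _ => ?_
  simp only [map_add, map_mul, pow_add]
  ring

lemma hasShift_gram {q m s : ℕ} {F : Type*} [Field F] [CharP F 2] (hq : q = 2 ^ s) (h2 : 2 < q)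
    {a b : ℕ} (hab : a ≠ b) (k : ℕ) :
    HasShift (q ^ k) ((if a < k then q ^ a else 0) + (if b < k then q ^ b else 0))
      (stP q (OIdx m) F (gram q (genVec m F) a b)) (gram q (genVec m F) a b)
      (if a = k then gram q (genVec m F) (k + 1) b else
        if b = k then gram q (genVec m F) a (k + 1) else 0) := by
  have hinj : ∀ {x y : ℕ}, q ^ x = q ^ y ↔ x = y := (Nat.pow_right_injective (by omega)).eq_iff
  have hlt : ∀ {x y : ℕ}, q ^ x < q ^ y ↔ x < y := (Nat.pow_lt_pow_iff_right (by omega))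
  have hpos : ∀ x, 0 < q ^ x := fun x => pow_pos (by omega) x
  have hne : q ^ a + q ^ b ≠ q ^ k := by
    intro h
    have ha : a < k := hlt.1 (by have := hpos b; omega)
    have hb : b < k := hlt.1 (by have := hpos a; omega)
    obtain ⟨l, rfl⟩ : ∃ l, k = l + 1 := ⟨k - 1, by omega⟩
    have h1 := Nat.pow_le_pow_right (n := q) (by omega) (Nat.lt_succ_iff.1 ha)
    have h2 := Nat.pow_le_pow_right (n := q) (by omega) (Nat.lt_succ_iff.1 hb)
    have := hpos l
    rw [pow_succ] at h
    nlinarith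
  rw [stP_gram hq]
  simp only [HasShift, Polynomial.coeff_add, Polynomial.coeff_C, Polynomial.coeff_C_mul,
    Polynomial.coeff_X_pow]
  refine ⟨?_, ?_, fun j hj hjk => ?_⟩
  · have h1 := hpos a
    have h2 := hpos b
    simp [h1.ne, h2.ne, (Nat.add_pos_left h1 _).ne]
  · have h1 := (hpos k).ne'
    simp only [h1, if_false, hne.symm, hinj, zero_add, mul_zero, add_zero, eq_comm (a := k)]
    by_cases ha : a = k
    · have hb : b ≠ k := fun h => hab (ha.trans h.symm)
      simp [ha, hb]
    · by_cases hb : b = k <;> simp [ha, hb]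
  · have h0 : j ≠ 0 := by omega
    have ha : j ≠ q ^ a := by
      rintro rfl
      rw [if_pos (hlt.1 hjk)] at hj
      omega
    have hb : j ≠ q ^ b := by
      rintro rfl
      rw [if_pos (hlt.1 hjk)] at hj
      omega
    have hc : j ≠ q ^ a + q ^ b := by
      rintro rfl
      have h1 : a < k := hlt.1 (by have := hpos b; omega)
      have h2 : b < k := hlt.1 (by have := hpos a; omega)
      rw [if_pos h1, if_pos h2] at hj
      omega
    simp [h0, ha, hb, hc]

/-- The total exponent below `k` of a finite set. -/
def lowExp (q k : ℕ) (T : Finset ℕ) : ℕ := ∑ a ∈ T, if a < k then q ^ a else 0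

lemma lowExp_erase {q k : ℕ} {T : Finset ℕ} {a : ℕ} (ha : a ∈ T) :
    (if a < k then q ^ a else 0) + lowExp q k (T.erase a) = lowExp q k T :=
  Finset.add_sum_erase T (fun a => if a < k then q ^ a else 0) ha

lemma lowExp_lt {q : ℕ} (h2 : 2 < q) (k : ℕ) (T : Finset ℕ) : lowExp q k T < q ^ k := by
  have h1 : lowExp q k T ≤ ∑ a ∈ Finset.range k, q ^ a := by
    rw [lowExp, ← Finset.sum_filter]
    refine Finset.sum_le_sum_of_subset fun a ha => ?_
    exact Finset.mem_range.2 (Finset.mem_filter.1 ha).2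
  refine h1.trans_lt ?_
  clear h1
  induction k with
  | zero => simp
  | succ k ih =>
    rw [Finset.sum_range_succ, pow_succ]
    have : q ^ k * 3 ≤ q ^ k * q := Nat.mul_le_mul_left _ h2
    omega

lemma lowExp_add_two_lt {q : ℕ} (h2 : 2 < q) {k : ℕ} (hk : 1 ≤ k) {T : Finset ℕ} (hT : 0 ∉ T) :
    2 + lowExp q k T < q ^ k := by
  have h1 : lowExp q k T ≤ ∑ a ∈ Finset.Ico 1 k, q ^ a := by
    rw [lowExp, ← Finset.sum_filter]
    refine Finset.sum_le_sum_of_subset fun a ha => ?_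
    rw [Finset.mem_filter] at ha
    have : a ≠ 0 := by rintro rfl; exact hT ha.1
    exact Finset.mem_Ico.2 ⟨by omega, ha.2⟩
  refine (Nat.add_le_add_left h1 2).trans_lt ?_
  clear h1
  induction k, hk using Nat.le_induction with
  | base => simpa using h2
  | succ k hk ih =>
    rw [Finset.sum_Ico_succ_top hk, pow_succ]
    have : q ^ k * 3 ≤ q ^ k * q := Nat.mul_le_mul_left _ h2
    omega

lemma hasShift_gpf_of_notMem {q m s : ℕ} {F : Type*} [Field F] [CharP F 2] (hq : q = 2 ^ s)
    (h2 : 2 < q) {k : ℕ} {T : Finset ℕ} (hk : k ∉ T) :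
    HasShift (q ^ k) (lowExp q k T) (stP q (OIdx m) F (gpf q m F T)) (gpf q m F T) 0 := by
  induction hn : T.card using Nat.strong_induction_on generalizing T with
  | _ n ih =>
    rcases T.eq_empty_or_nonempty with rfl | ⟨a, ha⟩
    · have hpos : q ^ k ≠ 0 := pow_ne_zero _ (by omega)
      rw [gpf, pf_empty, map_one]
      refine ⟨by simp, by rw [Polynomial.coeff_one, if_neg hpos], fun j hj _ => ?_⟩
      have : j ≠ 0 := by omega
      simp [Polynomial.coeff_one, this]
    · rw [gpf, pf_expand (gram_comm _ _) ha, map_sum]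
      have h0 : (0 : MvPolynomial (OIdx m) F) = ∑ b ∈ T.erase a, 0 := by simp
      rw [h0]
      refine HasShift.sum _ fun b hb => ?_
      rw [map_mul]
      have hba := Finset.mem_erase.1 hb
      have hc1 := Finset.card_erase_of_mem ha
      have hc2 := Finset.card_erase_of_mem hb
      have hc3 := Finset.card_pos.2 ⟨a, ha⟩
      have h1 := ih _ (by omega) (T := (T.erase a).erase b)
        (fun h => hk (Finset.mem_of_mem_erase (Finset.mem_of_mem_erase h))) rfl
      have hlow : ((if a < k then q ^ a else 0) + (if b < k then q ^ b else 0))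
          + lowExp q k ((T.erase a).erase b) = lowExp q k T := by
        rw [add_assoc, lowExp_erase hb, lowExp_erase ha]
      have h3 := (hasShift_gram (m := m) (F := F) hq h2 hba.1.symm k).mul h1
        (by rw [hlow]; exact lowExp_lt h2 k T)
      rw [hlow] at h3
      convert h3 using 1
      have ha' : a ≠ k := fun h => hk (h ▸ ha)
      have hb' : b ≠ k := fun h => hk (h ▸ hba.2)
      simp [ha', hb']

lemma hasShift_gpf_of_mem {q m s : ℕ} {F : Type*} [Field F] [CharP F 2] (hq : q = 2 ^ s)
    (h2 : 2 < q) {k : ℕ} {T : Finset ℕ} (hk : k ∈ T) (hk1 : k + 1 ∉ T) :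
    HasShift (q ^ k) (lowExp q k T) (stP q (OIdx m) F (gpf q m F T)) (gpf q m F T)
      (gpf q m F (insert (k + 1) (T.erase k))) := by
  rw [gpf, pf_expand (gram_comm _ _) hk, map_sum, gpf,
    ← pf_insert (gram_comm q (genVec m F)) (fun h => hk1 (Finset.mem_of_mem_erase h))]
  refine HasShift.sum _ fun b hb => ?_
  rw [map_mul]
  have hba := Finset.mem_erase.1 hb
  have h1 := hasShift_gpf_of_notMem (m := m) (F := F) hq h2 (k := k) (T := (T.erase k).erase b)
    (fun h => Finset.notMem_erase k T (Finset.mem_of_mem_erase h))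
  have hlow : ((if k < k then q ^ k else 0) + (if b < k then q ^ b else 0))
      + lowExp q k ((T.erase k).erase b) = lowExp q k T := by
    rw [add_assoc, lowExp_erase hb, lowExp_erase hk]
  have h3 := (hasShift_gram (m := m) (F := F) hq h2 hba.1.symm k).mul h1
    (by rw [hlow]; exact lowExp_lt h2 k T)
  rw [hlow] at h3
  convert h3 using 1
  simp

lemma coeff_sq_two_mul {R : Type*} [CommRing R] [CharP R 2] (p : Polynomial R) (i : ℕ) :
    (p ^ 2).coeff (2 * i) = p.coeff i ^ 2 := by
  have : ExpChar R 2 := ExpChar.prime Nat.prime_two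
  rw [← Polynomial.map_frobenius_expand, Polynomial.coeff_map, mul_comm 2 i,
    Polynomial.coeff_expand_mul (by norm_num)]
  rfl

lemma coeff_mul_of_eq_C_add {R : Type*} [CommRing R] {M n : ℕ} {p : Polynomial R} {u : R}
    (hp : ∃ r, p = Polynomial.C u + Polynomial.X ^ M * r) (hn : n < M) (g : Polynomial R) :
    (p * g).coeff n = u * g.coeff n := by
  obtain ⟨r, rfl⟩ := hp
  rw [add_mul, Polynomial.coeff_add, Polynomial.coeff_C_mul, mul_assoc, Polynomial.coeff_X_pow_mul',
    if_neg (by omega), add_zero]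

lemma pow_eq_C_add {R : Type*} [CommRing R] {M : ℕ} {p : Polynomial R} {u : R}
    (hp : ∃ r, p = Polynomial.C u + Polynomial.X ^ M * r) (k : ℕ) :
    ∃ r, p ^ k = Polynomial.C (u ^ k) + Polynomial.X ^ M * r := by
  obtain ⟨r, rfl⟩ := hp
  induction k with
  | zero => exact ⟨0, by simp⟩
  | succ k ih =>
    obtain ⟨r', hr'⟩ := ih
    refine ⟨Polynomial.C (u ^ k) * r + r' * (Polynomial.C u + Polynomial.X ^ M * r), ?_⟩
    rw [pow_succ, hr', pow_succ, Polynomial.C_mul]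
    ring

/-- Rows of the matrix of Steenrod twists, restricted to the rows below `c`. -/
noncomputable def twistRow (q m : ℕ) (F : Type*) [Field F] (c a : ℕ) :
    Fin m ⊕ Fin m → Polynomial (MvPolynomial (OIdx m) F) := fun i =>
  if a < c then Polynomial.C (genVec m F i ^ q ^ a)
      + Polynomial.X ^ q ^ a * Polynomial.C (genVec m F i ^ q ^ (a + 1))
    else Polynomial.C (genVec m F i ^ q ^ a)

lemma bform_add_smul_left {R : Type*} [CommRing R] {m : ℕ} (t : R) (u u' v : Fin m ⊕ Fin m → R) :
    bform R m (fun i => u i + t * u' i) v = bform R m u v + t * bform R m u' v := by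
  have : (fun i => u i + t * u' i) = u + t • u' := rfl
  rw [this, map_add, map_smul, LinearMap.add_apply, LinearMap.smul_apply, smul_eq_mul]

lemma stP_gram_eq_bform {q m s : ℕ} {F : Type*} [Field F] [CharP F 2] (hq : q = 2 ^ s)
    {a b c : ℕ} (ha : a < c) (hb : b < c) :
    stP q (OIdx m) F (gram q (genVec m F) a b)
      = bform _ m (twistRow q m F c a) (twistRow q m F c b) := by
  have h : ∀ a < c, twistRow q m F c a = fun i => stP q (OIdx m) F (X (some i)) ^ q ^ a := by
    intro a ha
    ext1 i
    rw [stP_X_pow hq, twistRow, if_pos ha, genVec, mul_comm (Polynomial.X ^ _)]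
  rw [h a ha, h b hb]
  exact gram_map (stP q (OIdx m) F).toRingHom q (genVec m F) a b

lemma twistRow_succ_self (q m : ℕ) (F : Type*) [Field F] (c : ℕ) :
    twistRow q m F (c + 1) c = fun i => twistRow q m F c c i
      + Polynomial.X ^ q ^ c * twistRow q m F c (c + 1) i := by
  ext1 i
  simp [twistRow]

lemma twistRow_succ_of_ne (q m : ℕ) (F : Type*) [Field F] {c a : ℕ} (h : a ≠ c) :
    twistRow q m F (c + 1) a = twistRow q m F c a := by
  ext1 i
  have : a < c + 1 ↔ a < c := by omega
  simp only [twistRow, this]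

/-- The Gram matrix of `twistRow`. -/
noncomputable def twistGram (q m : ℕ) (F : Type*) [Field F] (c a b : ℕ) :
    Polynomial (MvPolynomial (OIdx m) F) :=
  bform _ m (twistRow q m F c a) (twistRow q m F c b)

lemma twistGram_succ_self (q m : ℕ) (F : Type*) [Field F] {c x : ℕ} (h : x ≠ c) :
    twistGram q m F (c + 1) c x
      = twistGram q m F c c x + Polynomial.X ^ q ^ c * twistGram q m F c (c + 1) x := by
  rw [twistGram, twistRow_succ_self, twistRow_succ_of_ne _ _ _ h, bform_add_smul_left]
  rfl

lemma twistGram_succ_of_ne (q m : ℕ) (F : Type*) [Field F] {c x y : ℕ} (hx : x ≠ c) (hy : y ≠ c) :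
    twistGram q m F (c + 1) x y = twistGram q m F c x y := by
  rw [twistGram, twistRow_succ_of_ne _ _ _ hx, twistRow_succ_of_ne _ _ _ hy]
  rfl

lemma twistGram_comm (q m : ℕ) (F : Type*) [Field F] (c x y : ℕ) :
    twistGram q m F c x y = twistGram q m F c y x := bform_comm _ _

lemma twistGram_self (q m : ℕ) (F : Type*) [Field F] [CharP F 2] (c x : ℕ) :
    twistGram q m F c x x = 0 := bform_self _

lemma twistGram_zero (q m : ℕ) (F : Type*) [Field F] (x y : ℕ) :
    twistGram q m F 0 x y = Polynomial.C (gram q (genVec m F) x y) := by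
  rw [gram, bform_map]
  have : ∀ x, twistRow q m F 0 x = fun i => Polynomial.C (genVec m F i ^ q ^ x) := by
    intro x
    ext1 i
    simp [twistRow]
  rw [twistGram, this, this]

lemma stP_gpf_range {q m s : ℕ} {F : Type*} [Field F] [CharP F 2] (hq : q = 2 ^ s) (n : ℕ) :
    ∃ r, stP q (OIdx m) F (gpf q m F (Finset.range (n + 1)))
      = Polynomial.C (gpf q m F (Finset.range (n + 1))) + Polynomial.X ^ q ^ n * r := by
  have h0 : stP q (OIdx m) F (gpf q m F (Finset.range (n + 1)))
      = pf (twistGram q m F (n + 1)) (Finset.range (n + 1)) := by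
    have := pf_map (stP q (OIdx m) F).toRingHom (gram q (genVec m F)) (Finset.range (n + 1))
    refine this.trans (pf_congr fun a ha b hb _ => ?_)
    exact stP_gram_eq_bform hq (Finset.mem_range.1 ha) (Finset.mem_range.1 hb)
  have hstep : ∀ c ≤ n, pf (twistGram q m F c) (Finset.range (n + 1))
      = Polynomial.C (gpf q m F (Finset.range (n + 1))) := by
    intro c
    induction c with
    | zero =>
      intro _
      rw [gpf, pf_map]
      exact pf_congr fun a _ b _ _ => twistGram_zero q m F a b
    | succ c ih =>
      intro hc
      rw [← ih (by omega)]
      exact pf_row_op (twistGram_comm _ _ _ _) (twistGram_self _ _ _ _) (twistGram_comm _ _ _ _)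
        (a := c) (b := c + 1) (Finset.mem_range.2 (by omega)) (Finset.mem_range.2 (by omega))
        (by omega) (Polynomial.X ^ q ^ c) (fun x _ hx => twistGram_succ_self _ _ _ hx)
        fun x _ y _ hx hy => twistGram_succ_of_ne _ _ _ hx hy
  have hn : n ∈ Finset.range (n + 1) := Finset.self_mem_range_succ n
  refine ⟨∑ b ∈ (Finset.range (n + 1)).erase n, twistGram q m F n (n + 1) b
    * pf (twistGram q m F n) (((Finset.range (n + 1)).erase n).erase b), ?_⟩
  rw [h0, ← hstep n le_rfl, pf_expand (twistGram_comm _ _ _ _) hn,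
    pf_expand (twistGram_comm _ _ _ _) hn, Finset.mul_sum, ← Finset.sum_add_distrib]
  refine Finset.sum_congr rfl fun b hb => ?_
  rw [twistGram_succ_self _ _ _ (Finset.mem_erase.1 hb).1,
    pf_congr (N := twistGram q m F (n + 1)) (N' := twistGram q m F n)]
  · ring
  · intro x hx y hy _
    exact twistGram_succ_of_ne _ _ _ (Finset.mem_erase.1 (Finset.mem_of_mem_erase hx)).1
      (Finset.mem_erase.1 (Finset.mem_of_mem_erase hy)).1

/-- The sum of `g` over the pairs in `V`. -/
def pairSum {R : Type*} [CommRing R] (g : ℕ → ℕ → R) (V : Finset ℕ) : R :=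
  ∑ a ∈ V, ∑ b ∈ V, if a < b then g a b else 0

lemma pairSum_congr {R : Type*} [CommRing R] {g g' : ℕ → ℕ → R} {V : Finset ℕ}
    (h : ∀ a ∈ V, ∀ b ∈ V, a < b → g a b = g' a b) : pairSum g V = pairSum g' V :=
  Finset.sum_congr rfl fun a ha => Finset.sum_congr rfl fun b hb => by
    by_cases hab : a < b
    · rw [if_pos hab, if_pos hab, h a ha b hb hab]
    · rw [if_neg hab, if_neg hab]

lemma pairSum_insert {R : Type*} [CommRing R] {g : ℕ → ℕ → R} (hg : ∀ a b, g a b = g b a)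
    {W : Finset ℕ} {k : ℕ} (hk : k ∉ W) :
    pairSum g (insert k W) = pairSum g W + ∑ b ∈ W, g k b := by
  simp only [pairSum, Finset.sum_insert hk, lt_irrefl, if_false, zero_add,
    Finset.sum_add_distrib]
  rw [← add_assoc, ← Finset.sum_add_distrib, add_comm]
  congr 1
  refine Finset.sum_congr rfl fun b hb => ?_
  have : b ≠ k := fun h => hk (h ▸ hb)
  rcases lt_or_gt_of_ne this with h | h
  · rw [if_neg (by omega), if_pos h, zero_add, hg]
  · rw [if_pos h, if_neg (by omega), add_zero]

/-- The polynomial `ξ_0 Pf(V) + ∑_{a<b} ξ_a ξ_b Pf(V ∖ {a,b})`. -/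
noncomputable def quadPf (q m : ℕ) (F : Type*) [Field F] (V : Finset ℕ) :
    MvPolynomial (OIdx m) F :=
  xiZero m F * gpf q m F V + pairSum (fun a b => gram q (genVec m F) 0 a
    * gram q (genVec m F) 0 b * gpf q m F ((V.erase a).erase b)) V

lemma hasShift_xiZero {q m s : ℕ} {F : Type*} [Field F] [CharP F 2] (hq : q = 2 ^ s)
    (h2 : 2 < q) {k : ℕ} (hk : 1 ≤ k) :
    HasShift (q ^ k) 2 (stP q (OIdx m) F (xiZero m F)) (xiZero m F) 0 := by
  have h : stP q (OIdx m) F (xiZero m F) = Polynomial.C (xiZero m F)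
      + Polynomial.C (xiGen q m F 1) * Polynomial.X
      + Polynomial.C (xiZero m F ^ q) * Polynomial.X ^ 2 := by
    have e := sum_pow_pow_two (R := MvPolynomial (OIdx m) F) hq 1 Finset.univ
      (fun j : Fin m => X (some (Sum.inr j)) * X (some (Sum.inl j)))
    have e' := add_pow_pow_two (R := MvPolynomial (OIdx m) F) hq 1
    simp only [pow_one] at e e'
    have hs : ∀ f g f' g' : Fin m → Polynomial (MvPolynomial (OIdx m) F),
        ∑ j, (f j + f' j * Polynomial.X) * (g j + g' j * Polynomial.X)
          = ∑ j, f j * g j + (∑ j, (f j * g' j + g j * f' j)) * Polynomial.X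
            + (∑ j, f' j * g' j) * Polynomial.X ^ 2 := by
      intro f g f' g'
      simp only [Finset.sum_mul, ← Finset.sum_add_distrib]
      exact Finset.sum_congr rfl fun j _ => by ring
    simp only [xiZero, xiGen, e', e, pow_one, map_add, map_sum, map_mul, map_pow, stP_X,
      CharTwo.add_sq, mul_pow, hs]
    ring
  rw [h]
  have hlt : q ≤ q ^ k := Nat.le_self_pow (by omega) q
  clear hq
  simp only [HasShift, Polynomial.coeff_add, Polynomial.coeff_C, Polynomial.coeff_C_mul,
    Polynomial.coeff_X_pow, Polynomial.coeff_X]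
  refine ⟨by simp, ?_, fun j hj hjk => ?_⟩
  · rw [if_neg (by omega), if_neg (by omega), if_neg (by omega)]; simp
  · rw [if_neg (by omega), if_neg (by omega), if_neg (by omega)]; simp

lemma quadPf_insert {q m : ℕ} {F : Type*} [Field F] {W : Finset ℕ} {k : ℕ} (hk : k ∉ W) :
    quadPf q m F (insert k W) = xiZero m F * gpf q m F (insert k W)
      + (pairSum (fun a b => gram q (genVec m F) 0 a * gram q (genVec m F) 0 b
          * gpf q m F (insert k ((W.erase a).erase b))) W
        + ∑ b ∈ W, gram q (genVec m F) 0 k * gram q (genVec m F) 0 b * gpf q m F (W.erase b)) := by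
  rw [quadPf, pairSum_insert (fun a b => by rw [mul_comm (gram _ _ _ _), Finset.erase_right_comm]) hk]
  refine congrArg₂ (· + ·) rfl (congrArg₂ (· + ·) ?_ ?_)
  · refine pairSum_congr fun a ha b hb _ => ?_
    have hak : k ≠ a := fun h => hk (h ▸ ha)
    have hbk : k ≠ b := fun h => hk (h ▸ hb)
    rw [Finset.erase_insert_of_ne hak, Finset.erase_insert_of_ne hbk]
  · simp only [Finset.erase_insert hk]

lemma HasShift.pairSum {R : Type*} [CommRing R] {Q n : ℕ} {V : Finset ℕ}
    {p : ℕ → ℕ → Polynomial R} {f f' : ℕ → ℕ → R}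
    (h : ∀ a ∈ V, ∀ b ∈ V, a < b → HasShift Q n (p a b) (f a b) (f' a b)) :
    HasShift Q n (pairSum p V) (pairSum f V) (pairSum f' V) := by
  refine HasShift.sum _ fun a ha => HasShift.sum _ fun b hb => ?_
  by_cases hab : a < b
  · simpa only [if_pos hab] using h a ha b hb hab
  · simp only [if_neg hab]
    exact ⟨rfl, rfl, fun _ _ _ => rfl⟩

lemma map_pairSum {R R' G : Type*} [CommRing R] [CommRing R'] [FunLike G R R'] [RingHomClass G R R']
    (φ : G) (f : ℕ → ℕ → R) (V : Finset ℕ) :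
    φ (pairSum f V) = pairSum (fun a b => φ (f a b)) V := by
  simp only [pairSum, map_sum, apply_ite φ, map_zero]

lemma hasShift_quadPf {q m s : ℕ} {F : Type*} [Field F] [CharP F 2] (hq : q = 2 ^ s)
    (h2 : 2 < q) {k : ℕ} (hk1 : 1 ≤ k) {W : Finset ℕ} (h0 : 0 ∉ W) (hk : k ∉ W) (hk' : k + 1 ∉ W) :
    HasShift (q ^ k) (2 + lowExp q k (insert k W)) (stP q (OIdx m) F (quadPf q m F (insert k W)))
      (quadPf q m F (insert k W)) (quadPf q m F (insert (k + 1) W)) := by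
  have h0' : 0 ∉ insert k W := by
    rw [Finset.mem_insert]
    rintro (h | h)
    · omega
    · exact h0 h
  have hlt := lowExp_add_two_lt h2 hk1 h0'
  have hgk := hasShift_gram (m := m) (F := F) hq h2 (a := 0) (b := k) (by omega) k
  have hg : ∀ b ∈ W, HasShift (q ^ k) (1 + if b < k then q ^ b else 0)
      (stP q (OIdx m) F (gram q (genVec m F) 0 b)) (gram q (genVec m F) 0 b) 0 := by
    intro b hb
    have hb0 : 0 ≠ b := fun h => h0 (h ▸ hb)
    have hbk : b ≠ k := fun h => hk (h ▸ hb)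
    have := hasShift_gram (m := m) (F := F) hq h2 hb0 k
    rwa [if_pos (show 0 < k from hk1), pow_zero, if_neg (show ¬ 0 = k by omega), if_neg hbk] at this
  rw [if_pos (show 0 < k from hk1), pow_zero, if_neg (lt_irrefl k), if_neg (show ¬ 0 = k by omega),
    if_pos rfl] at hgk
  rw [quadPf_insert hk, quadPf_insert hk', map_add, map_add, map_mul, map_pairSum, map_sum]
  have hins : ∀ V ⊆ W, HasShift (q ^ k) (lowExp q k (insert k V))
      (stP q (OIdx m) F (gpf q m F (insert k V))) (gpf q m F (insert k V))
      (gpf q m F (insert (k + 1) V)) := by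
    intro V hV
    have hkV : k ∉ V := fun h => hk (hV h)
    have := hasShift_gpf_of_mem (m := m) (F := F) hq h2 (Finset.mem_insert_self k V)
      (by rw [Finset.mem_insert]; rintro (h | h); exacts [by omega, hk' (hV h)])
    rwa [Finset.erase_insert hkV] at this
  refine HasShift.add ?_ (HasShift.add (HasShift.pairSum fun a ha b hb hab => ?_)
    (HasShift.sum _ fun b hb => ?_))
  · have := (hasShift_xiZero (m := m) (F := F) hq h2 hk1).mul (hins W subset_rfl) hlt
    rwa [zero_mul, zero_add] at this
  · have hba : b ∈ W.erase a := Finset.mem_erase.2 ⟨hab.ne', hb⟩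
    have hl : lowExp q k (insert k W) = (if a < k then q ^ a else 0) + ((if b < k then q ^ b else 0)
        + lowExp q k (insert k ((W.erase a).erase b))) := by
      have hak : k ≠ a := fun h => hk (h ▸ ha)
      have hbk : k ≠ b := fun h => hk (h ▸ hb)
      rw [← lowExp_erase (Finset.mem_insert_of_mem ha), Finset.erase_insert_of_ne hak,
        ← lowExp_erase (Finset.mem_insert_of_mem hba), Finset.erase_insert_of_ne hbk]
    rw [hl] at hlt ⊢
    have := ((hg a ha).mul (hg b hb) (by omega)).mul (hins ((W.erase a).erase b)
      ((Finset.erase_subset _ _).trans (Finset.erase_subset _ _))) (by omega)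
    rw [map_mul, map_mul]
    simp only [mul_zero, zero_mul, zero_add, add_zero] at this
    exact this.mono (le_of_eq (by ring))
  · have hl : lowExp q k (insert k W) = (if b < k then q ^ b else 0) + lowExp q k (W.erase b) := by
      rw [← lowExp_erase (Finset.mem_insert_self k W), Finset.erase_insert hk, if_neg (lt_irrefl k),
        zero_add, lowExp_erase hb]
    rw [hl] at hlt ⊢
    have := (hgk.mul (hg b hb) (by omega)).mul (hasShift_gpf_of_notMem (m := m) (F := F) hq h2
      (T := W.erase b) fun h => hk (Finset.mem_of_mem_erase h)) (by omega)
    rw [map_mul, map_mul]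
    simp only [mul_zero, add_zero] at this
    exact this.mono (le_of_eq (by ring))

lemma pf_gram_image_add {R : Type*} [CommRing R] [CharP R 2] {s q : ℕ} (hq : q = 2 ^ s) {m : ℕ}
    (v : Fin m ⊕ Fin m → R) (T : Finset ℕ) (c : ℕ) :
    pf (gram q v) (T.image (· + c)) = pf (gram q v) T ^ q ^ c := by
  rw [pf_shift (gram_comm _ _)]
  simp only [gram_add hq]
  have h := pf_map (iterateFrobenius R 2 (s * c)) (gram q v) T
  simp only [iterateFrobenius_def, pow_mul, ← hq] at h
  exact h.symm

lemma eSeq_star_step {q m s : ℕ} {F : Type*} [Field F] [CharP F 2] (hq : q = 2 ^ s) (h2 : 2 < q)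
    {k : ℕ} (hk : 1 ≤ k) (hk' : k + 1 ≤ 2 * m - 1) {f f' : MvPolynomial (OIdx m) F}
    (hf : gpf q m F (Finset.range (2 * m)) * f ^ 2
      = gpf q m F ((Finset.range (2 * m + 1)).erase (k + 1))
        + gpf q m F (Finset.range (2 * m)) ^ (q - 1)
          * quadPf q m F ((Finset.Icc 1 (2 * m - 1)).erase (k + 1)))
    (hf' : (stP q (OIdx m) F f).coeff (2 ^ (s * k - 1)) = f') :
    gpf q m F (Finset.range (2 * m)) * f' ^ 2
      = gpf q m F ((Finset.range (2 * m + 1)).erase k)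
        + gpf q m F (Finset.range (2 * m)) ^ (q - 1)
          * quadPf q m F ((Finset.Icc 1 (2 * m - 1)).erase k) := by
  have hs0 : s ≠ 0 := by rintro rfl; simp at hq; omega
  have hpow : q ^ k = 2 * 2 ^ (s * k - 1) := by
    rw [hq, ← pow_mul, ← pow_succ', Nat.sub_add_cancel (Nat.mul_pos (Nat.pos_of_ne_zero hs0) hk)]
  have hlt : q ^ k < q ^ (2 * m - 1) := Nat.pow_lt_pow_right (by omega) (by omega)
  have hu := stP_gpf_range (m := m) (F := F) hq (2 * m - 1)
  rw [Nat.sub_add_cancel (by omega : 1 ≤ 2 * m)] at hu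
  have hk0 : k ∈ Finset.Icc 1 (2 * m - 1) := Finset.mem_Icc.2 ⟨hk, by omega⟩
  have hk1 : k + 1 ∈ Finset.Icc 1 (2 * m - 1) := Finset.mem_Icc.2 ⟨by omega, hk'⟩
  have key := congrArg (fun p => (stP q (OIdx m) F p).coeff (q ^ k)) hf
  beta_reduce at key
  rw [map_mul, map_add, map_mul, map_pow, map_pow, Polynomial.coeff_add] at key
  rw [coeff_mul_of_eq_C_add hu hlt, coeff_mul_of_eq_C_add (pow_eq_C_add hu (q - 1)) hlt,
    hpow, coeff_sq_two_mul, ← hpow, hf'] at key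
  rw [key]
  refine congrArg₂ (· + ·) ?_ (congrArg₂ (· * ·) rfl ?_)
  · have := (hasShift_gpf_of_mem (m := m) (F := F) hq h2 (k := k)
      (T := (Finset.range (2 * m + 1)).erase (k + 1))
      (Finset.mem_erase.2 ⟨by omega, Finset.mem_range.2 (by omega)⟩)
      (Finset.notMem_erase _ _)).2.1
    rw [this, Finset.erase_right_comm, Finset.insert_erase]
    exact Finset.mem_erase.2 ⟨by omega, Finset.mem_range.2 (by omega)⟩
  · have := (hasShift_quadPf (m := m) (F := F) hq h2 hk
      (W := ((Finset.Icc 1 (2 * m - 1)).erase (k + 1)).erase k) (by simp) (by simp) (by simp)).2.1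
    rw [Finset.insert_erase (Finset.mem_erase.2 ⟨by omega, hk0⟩)] at this
    rw [this, Finset.erase_right_comm, Finset.insert_erase (Finset.mem_erase.2 ⟨by omega, hk1⟩)]

/-- The relation `u e_i² = Pf + u^{q-1} s`. -/
lemma eSeq_star {q m s : ℕ} {F : Type*} [Field F] [Fintype F] [CharP F 2] (hs : 2 ≤ s)
    (hm : 2 ≤ m) (hq : q = 2 ^ s) (h2 : 2 < q) (hF : Fintype.card F = q)
    {b1 : MvPolynomial (OIdx m) F}
    (hb1 : b1 ^ 2 = (dickP m F).coeff (q ^ (2 * m - 1))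
      + uM q m F ^ (q - 2) * (deltaOne q m F + xiBar m F * uM1 q m F ^ q))
    {k : ℕ} (hk : 1 ≤ k) (hk' : k ≤ 2 * m - 1) :
    gpf q m F (Finset.range (2 * m)) * eSeq q m s F b1 (2 * m - 1 - k) ^ 2
      = gpf q m F ((Finset.range (2 * m + 1)).erase k)
        + gpf q m F (Finset.range (2 * m)) ^ (q - 1)
          * quadPf q m F ((Finset.Icc 1 (2 * m - 1)).erase k) := by
  obtain ⟨i, hi⟩ : ∃ i, i = 2 * m - 1 - k := ⟨_, rfl⟩
  induction i generalizing k with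
  | zero =>
    obtain rfl : k = 2 * m - 1 := by omega
    rw [← hi, ← gpf_mul_dickP_coeff hF (by omega)]
    have hU : (Finset.Icc 1 (2 * m - 1)).erase (2 * m - 1) = Finset.Icc 1 (2 * m - 2) := by
      ext x; simp only [Finset.mem_erase, Finset.mem_Icc]; omega
    have hpf : gpf q m F (Finset.Icc 1 (2 * m - 2)) = uM1 q m F ^ q := by
      have : Finset.Icc 1 (2 * m - 2) = (Finset.range (2 * m - 2)).image (· + 1) := by
        ext x
        simp only [Finset.mem_Icc, Finset.mem_image, Finset.mem_range]
        constructor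
        · intro h; exact ⟨x - 1, by omega, by omega⟩
        · rintro ⟨y, hy, rfl⟩; omega
      rw [this, gpf, pf_gram_image_add hq, uM1, natSum_eq_gpf hq, pow_one]
    have hq2 : 2 * 2 ^ (s - 1) = q := by rw [hq, ← pow_succ', Nat.sub_add_cancel (by omega)]
    have hz : xiZero m F = X none ^ 2 + xiBar m F := rfl
    have hdelta : pairSum (fun a b => gram q (genVec m F) 0 a * gram q (genVec m F) 0 b
        * gpf q m F (((Finset.Icc 1 (2 * m - 2)).erase a).erase b)) (Finset.Icc 1 (2 * m - 2))
        = deltaOne q m F := by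
      simp only [pairSum, deltaOne, natSum_eq_gpf hq, gram_zero_left]
    rw [hU, quadPf, hdelta, hpf, eSeq, CharTwo.add_sq, hb1, mul_pow, mul_pow, ← pow_mul, ← pow_mul,
      Nat.sub_mul, mul_comm (2 ^ (s - 1)), hq2, one_mul, hz, ← natSum_eq_gpf hq, ← uM,
      show q - 1 = q - 2 + 1 from by omega, pow_succ]
    ring
  | succ i ih =>
    have := ih (k := k + 1) (by omega) (by omega) (by omega)
    refine eSeq_star_step hq h2 hk (by omega) this ?_
    rw [show 2 * m - 1 - k = (2 * m - 1 - (k + 1)) + 1 by omega, eSeq,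
      show 2 * m - 2 - (2 * m - 1 - (k + 1)) = k by omega]

lemma sum_pairSum_erase {R : Type*} [CommRing R] (h : ℕ → ℕ → ℕ → R) (U : Finset ℕ) :
    ∑ k ∈ U, pairSum (h k) (U.erase k)
      = pairSum (fun a b => ∑ k ∈ (U.erase a).erase b, h k a b) U := by
  have e : ∀ (V : Finset ℕ) (c : ℕ) (f : ℕ → R),
      ∑ x ∈ V.erase c, f x = ∑ x ∈ V, if x = c then 0 else f x := by
    intro V c f
    rw [← Finset.filter_ne', Finset.sum_filter]
    exact Finset.sum_congr rfl fun x _ => by by_cases hx : x = c <;> simp [hx]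
  simp only [pairSum, e]
  rw [Finset.sum_comm]
  refine Finset.sum_congr rfl fun a _ => ?_
  have : ∀ k, (if a = k then (0 : R) else
      ∑ x ∈ U, if x = k then 0 else if a < x then h k a x else 0)
      = ∑ x ∈ U, if a = k then 0 else if x = k then 0 else if a < x then h k a x else 0 := by
    intro k
    split_ifs <;> simp
  simp only [this]
  rw [Finset.sum_comm]
  refine Finset.sum_congr rfl fun b _ => ?_
  by_cases hab : a < b
  · simp only [if_pos hab]
    exact Finset.sum_congr rfl fun k _ => by
      by_cases h1 : a = k <;> by_cases h2 : b = k <;> simp [h1, h2, eq_comm (a := k)]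
  · simp [hab]

lemma sum_quadPf_mul_gram {q m : ℕ} {F : Type*} [Field F] [CharP F 2] {U : Finset ℕ} {j : ℕ}
    (hj : j ∈ U) (h0 : 0 ∉ U) :
    ∑ k ∈ U, gram q (genVec m F) j k * quadPf q m F (U.erase k)
      = gram q (genVec m F) 0 j * gpf q m F (insert 0 U)
        + gram q (genVec m F) 0 j ^ 2 * gpf q m F (U.erase j) := by
  have hN := gram_comm q (genVec m F)
  have hN0 := gram_self q (genVec m F)
  have h1 : ∑ k ∈ U, gram q (genVec m F) j k * quadPf q m F (U.erase k)
      = xiZero m F * ∑ k ∈ U, gram q (genVec m F) j k * gpf q m F (U.erase k)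
        + ∑ k ∈ U, pairSum (fun a b => gram q (genVec m F) j k * (gram q (genVec m F) 0 a
          * gram q (genVec m F) 0 b * gpf q m F (((U.erase k).erase a).erase b))) (U.erase k) := by
    rw [Finset.mul_sum, ← Finset.sum_add_distrib]
    refine Finset.sum_congr rfl fun k _ => ?_
    have : ∀ (c : MvPolynomial (OIdx m) F) (g : ℕ → ℕ → MvPolynomial (OIdx m) F) (V : Finset ℕ),
        c * pairSum g V = pairSum (fun a b => c * g a b) V := by
      intro c g V
      simp only [pairSum, Finset.mul_sum, mul_ite, mul_zero]
    rw [quadPf, ← this]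
    ring
  rw [h1, sum_mul_pf_erase_eq_zero hN hN0 hj, mul_zero, zero_add, sum_pairSum_erase]
  have h2 : ∀ a b, ∑ k ∈ (U.erase a).erase b, gram q (genVec m F) j k * (gram q (genVec m F) 0 a
      * gram q (genVec m F) 0 b * gpf q m F (((U.erase k).erase a).erase b))
      = gram q (genVec m F) 0 a * gram q (genVec m F) 0 b
        * ∑ k ∈ (U.erase a).erase b, gram q (genVec m F) j k
          * gpf q m F (((U.erase a).erase b).erase k) := by
    intro a b
    rw [Finset.mul_sum]
    refine Finset.sum_congr rfl fun k _ => ?_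
    rw [Finset.erase_right_comm (a := k), Finset.erase_right_comm (a := k)]
    ring
  simp only [h2]
  have hps : ∀ g : ℕ → ℕ → MvPolynomial (OIdx m) F, (∀ a b, g a b = g b a) →
      pairSum g U = pairSum g (U.erase j) + ∑ b ∈ U.erase j, g j b := by
    intro g hg
    rw [← pairSum_insert hg (Finset.notMem_erase j U), Finset.insert_erase hj]
  rw [hps]
  · have h3 : pairSum (fun a b => gram q (genVec m F) 0 a * gram q (genVec m F) 0 b
        * ∑ k ∈ (U.erase a).erase b, gram q (genVec m F) j k
          * gpf q m F (((U.erase a).erase b).erase k)) (U.erase j) = 0 := by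
      refine Finset.sum_eq_zero fun a ha => Finset.sum_eq_zero fun b hb => ?_
      split_ifs
      · beta_reduce
        rw [sum_mul_pf_erase_eq_zero hN hN0, mul_zero]
        exact Finset.mem_erase.2 ⟨(Finset.mem_erase.1 hb).1.symm,
          Finset.mem_erase.2 ⟨(Finset.mem_erase.1 ha).1.symm, hj⟩⟩
      · rfl
    have h4 : ∀ b ∈ U.erase j, gram q (genVec m F) 0 j * gram q (genVec m F) 0 b
        * ∑ k ∈ (U.erase j).erase b, gram q (genVec m F) j k
          * gpf q m F (((U.erase j).erase b).erase k)
        = gram q (genVec m F) 0 j * (gram q (genVec m F) 0 b * gpf q m F (U.erase b)) := by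
      intro b hb
      rw [pf_insert hN (fun h => Finset.notMem_erase j U (Finset.mem_of_mem_erase h)),
        Finset.erase_right_comm, Finset.insert_erase
          (Finset.mem_erase.2 ⟨(Finset.mem_erase.1 hb).1.symm, hj⟩), mul_assoc]
    rw [h3, zero_add, Finset.sum_congr rfl h4, ← Finset.mul_sum, gpf, ← pf_insert hN h0,
      ← Finset.add_sum_erase U _ hj, mul_add, add_right_comm, ← mul_assoc, ← sq,
      CharTwo.add_self_eq_zero, zero_add]
  · intro a b
    rw [mul_comm (gram _ _ 0 a), Finset.erase_right_comm]

/-- The sequence `e_{2m-1}, …, e_1, 1`. -/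
noncomputable def gSeq (q m s : ℕ) (F : Type*) [Field F] (b1 : MvPolynomial (OIdx m) F) (k : ℕ) :
    MvPolynomial (OIdx m) F :=
  if k = 2 * m - 1 then 1 else eSeq q m s F b1 (2 * m - 2 - k)

lemma range_succ_image_add_one {n : ℕ} : Finset.Icc 1 n = (Finset.range n).image (· + 1) := by
  ext x
  simp only [Finset.mem_Icc, Finset.mem_image, Finset.mem_range]
  constructor
  · intro h; exact ⟨x - 1, by omega, by omega⟩
  · rintro ⟨y, hy, rfl⟩; omega

lemma gSeq_relation {q m s : ℕ} {F : Type*} [Field F] [Fintype F] [CharP F 2] (hs : 2 ≤ s)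
    (hm : 2 ≤ m) (hq : q = 2 ^ s) (h2 : 2 < q) (hF : Fintype.card F = q)
    {b1 : MvPolynomial (OIdx m) F}
    (hb1 : b1 ^ 2 = (dickP m F).coeff (q ^ (2 * m - 1))
      + uM q m F ^ (q - 2) * (deltaOne q m F + xiBar m F * uM1 q m F ^ q))
    {j : ℕ} (hj : j < 2 * m - 1) :
    ∑ k ∈ Finset.range (2 * m), gSeq q m s F b1 k * gram q (genVec m F) k j ^ 2 ^ (s - 1)
      = gpf q m F (Finset.range (2 * m)) ^ (2 ^ (s - 1) - 1) * gram q (genVec m F) 0 (j + 1)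
        * gpf q m F ((Finset.range (2 * m - 1)).erase j) ^ 2 ^ (s - 1) := by
  have hN := gram_comm q (genVec m F)
  have hN0 := gram_self q (genVec m F)
  have hu0 := gpf_range_ne_zero (m := m) hF
  have hqs : 2 ^ (s - 1) * 2 = q := by rw [hq, ← pow_succ, Nat.sub_add_cancel (by omega)]
  set u := gpf q m F (Finset.range (2 * m)) with hu
  set U := Finset.Icc 1 (2 * m - 1) with hU
  have hjU : j + 1 ∈ U := Finset.mem_Icc.2 ⟨by omega, by omega⟩
  have h0U : 0 ∉ U := by simp [hU]
  have hT : Finset.range (2 * m + 1) = insert 0 (insert (2 * m) U) := by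
    ext x; simp only [hU, Finset.mem_insert, Finset.mem_Icc, Finset.mem_range]; omega
  have h2U : 2 * m ∉ U := by simp only [hU, Finset.mem_Icc]; omega
  have h02 : 0 ∉ insert (2 * m) U := by rw [Finset.mem_insert]; rintro (h | h); exacts [by omega, h0U h]
  have hUr : insert 0 U = Finset.range (2 * m) := by
    ext x; simp only [hU, Finset.mem_insert, Finset.mem_Icc, Finset.mem_range]; omega
  have hT0 : gpf q m F ((Finset.range (2 * m + 1)).erase 0) = u ^ q := by
    have : (Finset.range (2 * m + 1)).erase 0 = Finset.Icc 1 (2 * m) := by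
      ext x; simp only [Finset.mem_erase, Finset.mem_Icc, Finset.mem_range]; omega
    rw [this, range_succ_image_add_one, gpf, pf_gram_image_add hq, pow_one]
  have hT2 : gpf q m F ((Finset.range (2 * m + 1)).erase (2 * m)) = u := by
    rw [hu]; congr 1; ext x; simp only [Finset.mem_erase, Finset.mem_range]; omega
  have hplu : ∑ i ∈ Finset.range (2 * m + 1), gram q (genVec m F) (j + 1) i
      * gpf q m F ((Finset.range (2 * m + 1)).erase i) = 0 :=
    sum_mul_pf_erase_eq_zero hN hN0 (Finset.mem_range.2 (by omega))
  conv at hplu => lhs; rw [hT, Finset.sum_insert h02, Finset.sum_insert h2U, ← hT]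
  rw [hT0, hT2] at hplu
  have hstar : ∀ k ∈ U, u * (gram q (genVec m F) (j + 1) k * gSeq q m s F b1 (k - 1) ^ 2)
      = gram q (genVec m F) (j + 1) k * gpf q m F ((Finset.range (2 * m + 1)).erase k)
        + u ^ (q - 1) * (gram q (genVec m F) (j + 1) k * quadPf q m F (U.erase k)) := by
    intro k hk
    rw [hU, Finset.mem_Icc] at hk
    rw [gSeq, if_neg (by omega), show 2 * m - 2 - (k - 1) = 2 * m - 1 - k by omega, mul_left_comm,
      eSeq_star hs hm hq h2 hF hb1 hk.1 hk.2]
    ring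
  have hsum := Finset.sum_congr rfl hstar
  rw [← Finset.mul_sum, Finset.sum_add_distrib, ← Finset.mul_sum, sum_quadPf_mul_gram hjU h0U, hUr,
    ← hu] at hsum
  have hmain : ∑ k ∈ U, gram q (genVec m F) (j + 1) k * gSeq q m s F b1 (k - 1) ^ 2
      + gram q (genVec m F) (j + 1) (2 * m)
      = u ^ (q - 2) * (gram q (genVec m F) 0 (j + 1) ^ 2 * gpf q m F (U.erase (j + 1))) := by
    refine mul_left_cancel₀ hu0 ?_
    have e1 : u ^ q = u ^ (q - 1) * u := by rw [← pow_succ, Nat.sub_add_cancel (by omega)]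
    have e2 : u ^ (q - 1) = u ^ (q - 2) * u := by rw [← pow_succ]; congr 1; omega
    rw [mul_add, hsum]
    rw [hN (j + 1) 0, e1] at hplu
    have h20 : (2 : MvPolynomial (OIdx m) F) = 0 := CharTwo.two_eq_zero
    rw [e2] at hplu ⊢
    linear_combination hplu
  have hUD : U = (Finset.range (2 * m - 1)).image (· + 1) := range_succ_image_add_one
  have hUDj : U.erase (j + 1) = ((Finset.range (2 * m - 1)).erase j).image (· + 1) := by
    rw [hUD, Finset.image_erase (add_left_injective 1)]
  have hgq : ∀ a, gram q (genVec m F) (a + 1) (j + 1)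
      = (gram q (genVec m F) a j ^ 2 ^ (s - 1)) ^ 2 := by
    intro a
    rw [gram_add hq, pow_one, ← pow_mul, hqs]
  rw [hUDj, gpf, pf_gram_image_add hq, hUD, Finset.sum_image (fun x _ y _ h => add_left_injective 1 h),
    pow_one] at hmain
  refine CharTwo.sq_injective ?_
  beta_reduce
  rw [CharTwo.sum_sq, mul_pow, mul_pow, ← pow_mul, ← pow_mul, hqs, Nat.sub_mul, hqs, one_mul,
    mul_assoc, ← hmain, show 2 * m = 2 * m - 1 + 1 by omega, Finset.sum_range_succ,
    Nat.add_sub_cancel]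
  refine congrArg₂ (· + ·) (Finset.sum_congr rfl fun k _ => ?_) ?_
  · rw [mul_pow, ← hgq, hN (k + 1), Nat.add_sub_cancel, mul_comm]
  · rw [mul_pow, ← hgq, hN (2 * m - 1 + 1), gSeq, if_pos rfl, one_pow, one_mul]

/-- Cramer's rule for `gSeq_relation`. -/
lemma gSeq_cramer {q m s : ℕ} {F : Type*} [Field F] [Fintype F] [CharP F 2] (hs : 2 ≤ s)
    (hm : 2 ≤ m) (hq : q = 2 ^ s) (h2 : 2 < q) (hF : Fintype.card F = q)
    {b1 : MvPolynomial (OIdx m) F}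
    (hb1 : b1 ^ 2 = (dickP m F).coeff (q ^ (2 * m - 1))
      + uM q m F ^ (q - 2) * (deltaOne q m F + xiBar m F * uM1 q m F ^ q))
    {k l : ℕ} (hk : k < 2 * m - 1) (hl : l < 2 * m - 1) (hkl : k ≠ l) :
    gpf q m F ((Finset.range (2 * m - 1)).erase l) ^ 2 ^ (s - 1) * gSeq q m s F b1 k
      + gpf q m F ((Finset.range (2 * m - 1)).erase k) ^ 2 ^ (s - 1) * gSeq q m s F b1 l
      = gpf q m F (insert (2 * m - 1) (((Finset.range (2 * m - 1)).erase k).erase l)) ^ 2 ^ (s - 1)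
        + ∑ j ∈ ((Finset.range (2 * m - 1)).erase k).erase l,
          gpf q m F (Finset.range (2 * m)) ^ (2 ^ (s - 1) - 1) * gram q (genVec m F) 0 (j + 1)
            * gpf q m F ((Finset.range (2 * m - 1)).erase j) ^ 2 ^ (s - 1)
            * gpf q m F ((((Finset.range (2 * m - 1)).erase k).erase l).erase j) ^ 2 ^ (s - 1) := by
  have hN := gram_comm q (genVec m F)
  have hN0 := gram_self q (genVec m F)
  set D := Finset.range (2 * m - 1) with hD
  set I := (D.erase k).erase l with hI
  have hkD : k ∈ D := Finset.mem_range.2 hk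
  have hlD : l ∈ D := Finset.mem_range.2 hl
  have hj : ∀ j ∈ I, gpf q m F (Finset.range (2 * m)) ^ (2 ^ (s - 1) - 1)
      * gram q (genVec m F) 0 (j + 1) * gpf q m F (D.erase j) ^ 2 ^ (s - 1)
      * gpf q m F (I.erase j) ^ 2 ^ (s - 1)
      = ∑ i ∈ Finset.range (2 * m), gSeq q m s F b1 i
        * (gram q (genVec m F) i j * gpf q m F (I.erase j)) ^ 2 ^ (s - 1) := by
    intro j hj
    rw [← gSeq_relation hs hm hq h2 hF hb1
      (Finset.mem_range.1 (Finset.mem_of_mem_erase (Finset.mem_of_mem_erase hj))), Finset.sum_mul]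
    exact Finset.sum_congr rfl fun i _ => by rw [mul_pow, mul_assoc]
  rw [Finset.sum_congr rfl hj, Finset.sum_comm]
  simp only [← Finset.mul_sum, ← sum_pow_char_pow]
  have hlDk : l ∈ D.erase k := Finset.mem_erase.2 ⟨hkl.symm, hlD⟩
  have hkDl : k ∈ D.erase l := Finset.mem_erase.2 ⟨hkl, hkD⟩
  have hlI : insert l I = D.erase k := Finset.insert_erase hlDk
  have hkI : insert k I = D.erase l := by rw [hI, Finset.erase_right_comm, Finset.insert_erase hkDl]
  have hnD : 2 * m - 1 ∉ D := Finset.notMem_range_self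
  have hnI : 2 * m - 1 ∉ I := fun h => hnD (Finset.mem_of_mem_erase (Finset.mem_of_mem_erase h))
  have hR : Finset.range (2 * m) = insert (2 * m - 1) D := by
    rw [hD, ← Finset.range_add_one, Nat.sub_add_cancel (by omega)]
  have hz : ∑ i ∈ I, gSeq q m s F b1 i
      * (∑ j ∈ I, gram q (genVec m F) i j * gpf q m F (I.erase j)) ^ 2 ^ (s - 1) = 0 :=
    Finset.sum_eq_zero fun i hi => by
      rw [sum_mul_pf_erase_eq_zero hN hN0 hi, zero_pow (pow_ne_zero _ two_ne_zero), mul_zero]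
  have hDs := Finset.add_sum_erase D (fun i => gSeq q m s F b1 i
    * (∑ j ∈ I, gram q (genVec m F) i j * gpf q m F (I.erase j)) ^ 2 ^ (s - 1)) hkD
  have hDs' := Finset.add_sum_erase (D.erase k) (fun i => gSeq q m s F b1 i
    * (∑ j ∈ I, gram q (genVec m F) i j * gpf q m F (I.erase j)) ^ 2 ^ (s - 1)) hlDk
  have hg1 : gSeq q m s F b1 (2 * m - 1) = 1 := if_pos rfl
  rw [hR, Finset.sum_insert hnD, ← hDs, ← hDs', hz, add_zero, pf_insert hN hnI,
    pf_insert hN (Finset.notMem_erase l _), hlI,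
    pf_insert hN (fun h => Finset.notMem_erase k D (Finset.mem_of_mem_erase h)), hkI, hg1,
    one_mul, mul_comm (gSeq q m s F b1 k), mul_comm (gSeq q m s F b1 l), ← add_assoc,
    CharTwo.add_self_eq_zero, zero_add]

/-- The Frobenius-Toeplitz matrix attached to a sequence `x`: the entry at `a < b`
is `x_{b-a}^{q^a}`. -/
noncomputable def toepl {R : Type*} [CommRing R] (q : ℕ) (x : ℕ → R) (a b : ℕ) : R :=
  if a = b then 0 else x (max a b - min a b) ^ q ^ min a b

lemma toepl_comm {R : Type*} [CommRing R] (q : ℕ) (x : ℕ → R) (a b : ℕ) :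
    toepl q x a b = toepl q x b a := by
  simp only [toepl, eq_comm, max_comm, min_comm]

lemma toepl_self {R : Type*} [CommRing R] (q : ℕ) (x : ℕ → R) (a : ℕ) : toepl q x a a = 0 :=
  if_pos rfl

lemma toepl_of_lt {R : Type*} [CommRing R] (q : ℕ) (x : ℕ → R) {a b : ℕ} (h : a < b) :
    toepl q x a b = x (b - a) ^ q ^ a := by
  rw [toepl, if_neg h.ne, max_eq_right h.le, min_eq_left h.le]

lemma toepl_add {R : Type*} [CommRing R] (q : ℕ) (x : ℕ → R) (a b c : ℕ) :
    toepl q x (a + c) (b + c) = if a = b then 0 else toepl q x a b ^ q ^ c := by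
  by_cases h : a = b
  · rw [if_pos h, h, toepl_self]
  · rw [if_neg h, toepl, toepl, if_neg h, if_neg (by omega), max_add_add_right, min_add_add_right,
      Nat.add_sub_add_right, pow_add, pow_mul]

lemma toepl_map {R R' : Type*} [CommRing R] [CommRing R'] (f : R →+* R') (q : ℕ) (x : ℕ → R)
    (a b : ℕ) : f (toepl q x a b) = toepl q (fun j => f (x j)) a b := by
  simp only [toepl]
  split_ifs <;> simp

/-- Pfaffians of the Frobenius-Toeplitz matrix. -/
noncomputable def tpf {R : Type*} [CommRing R] (q : ℕ) (x : ℕ → R) (T : Finset ℕ) : R :=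
  pf (toepl q x) T

lemma tpf_map {R R' : Type*} [CommRing R] [CommRing R'] (f : R →+* R') (q : ℕ) (x : ℕ → R)
    (T : Finset ℕ) : f (tpf q x T) = tpf q (fun j => f (x j)) T := by
  rw [tpf, pf_map]
  simp only [toepl_map]
  rfl

lemma tpf_congr {R : Type*} [CommRing R] {q : ℕ} {x y : ℕ → R} {T : Finset ℕ}
    (h : ∀ a ∈ T, ∀ b ∈ T, a < b → x (b - a) = y (b - a)) : tpf q x T = tpf q y T :=
  pf_congr fun a ha b hb hab => by
    rw [toepl_of_lt q x hab, toepl_of_lt q y hab, h a ha b hb hab]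

lemma tpf_image_add {R : Type*} [CommRing R] [CharP R 2] {s q : ℕ} (hq : q = 2 ^ s)
    (x : ℕ → R) (T : Finset ℕ) (c : ℕ) : tpf q x (T.image (· + c)) = tpf q x T ^ q ^ c := by
  rw [tpf, pf_shift (toepl_comm _ _)]
  have h := pf_map (iterateFrobenius R 2 (s * c)) (toepl q x) T
  simp only [iterateFrobenius_def, pow_mul, ← hq] at h
  rw [tpf, h]
  refine pf_congr fun a _ b _ hab => ?_
  rw [toepl_add, if_neg hab.ne]

/-- The effect on the Pfaffian of changing one entry. -/
lemma pf_add_edge {R : Type*} [CommRing R] {N N' : ℕ → ℕ → R} (hN : ∀ a b, N a b = N b a)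
    (hN' : ∀ a b, N' a b = N' b a) {T : Finset ℕ} {a b : ℕ} (ha : a ∈ T) (hb : b ∈ T)
    (hab : a < b) (y : R)
    (h : ∀ i ∈ T, ∀ j ∈ T, i < j → N' i j = N i j + if i = a ∧ j = b then y else 0) :
    pf N' T = pf N T + y * pf N ((T.erase a).erase b) := by
  have h1 : ∀ x ∈ T.erase a, N' a x * pf N' ((T.erase a).erase x)
      = N a x * pf N ((T.erase a).erase x)
        + if x = b then y * pf N ((T.erase a).erase b) else 0 := by
    intro x hx
    obtain ⟨hxa, hxT⟩ := Finset.mem_erase.1 hx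
    have h2 : pf N' ((T.erase a).erase x) = pf N ((T.erase a).erase x) := by
      refine pf_congr fun i hi j hj hij => ?_
      have hi' := Finset.mem_erase.1 (Finset.mem_of_mem_erase hi)
      have hj' := Finset.mem_erase.1 (Finset.mem_of_mem_erase hj)
      rw [h i hi'.2 j hj'.2 hij, if_neg (fun h => hi'.1 h.1), add_zero]
    have h3 : N' a x = N a x + if x = b then y else 0 := by
      rcases lt_or_gt_of_ne hxa with hlt | hlt
      · rw [hN', hN a, h x hxT a ha hlt, if_neg (fun h => hxa h.1),
          if_neg (by rintro rfl; omega)]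
      · rw [h a ha x hxT hlt]; simp
    rw [h2, h3]
    split_ifs with hxb
    · rw [hxb]; ring
    · ring
  rw [pf_expand hN' ha, pf_expand hN ha, Finset.sum_congr rfl h1, Finset.sum_add_distrib,
    Finset.sum_ite_eq', if_pos (Finset.mem_erase.2 ⟨hab.ne', hb⟩)]

/-- The sequence `x` with an indeterminate added to its term of index `2n+2`. -/
noncomputable def deform {R : Type*} [CommRing R] (n : ℕ) (x : ℕ → R) (j : ℕ) : Polynomial R :=
  Polynomial.C (x j) + if j = 2 * n + 2 then Polynomial.X else 0

lemma toepl_deform {R : Type*} [CommRing R] [CharP R 2] {s q : ℕ} (hq : q = 2 ^ s) (n : ℕ)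
    (x : ℕ → R) {a b : ℕ} (hab : a < b) :
    toepl q (deform n x) a b = toepl q (fun j => Polynomial.C (x j)) a b
      + if b = a + (2 * n + 2) then Polynomial.X ^ q ^ a else 0 := by
  have hq0 : q ≠ 0 := by rw [hq]; positivity
  rw [toepl_of_lt _ _ hab, toepl_of_lt _ _ hab, deform, add_pow_pow_two hq]
  by_cases h : b - a = 2 * n + 2
  · rw [if_pos h, if_pos (by omega)]
  · rw [if_neg h, if_neg (by omega), zero_pow (pow_ne_zero _ hq0)]

lemma tpf_C {R : Type*} [CommRing R] (q : ℕ) (x : ℕ → R) (T : Finset ℕ) :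
    pf (toepl q fun j => Polynomial.C (x j)) T = Polynomial.C (tpf q x T) :=
  (tpf_map Polynomial.C q x T).symm

lemma tpf_deform_coeff_one {R : Type*} [CommRing R] [CharP R 2] {s q : ℕ} (hq : q = 2 ^ s)
    (x : ℕ → R) (n : ℕ) :
    (tpf q (deform n x) (insert (2 * n + 2) (Finset.range (2 * n + 1)))).coeff 1
      = tpf q x (Finset.range (2 * n)) ^ q := by
  rw [tpf, pf_add_edge (toepl_comm q fun j => Polynomial.C (x j)) (toepl_comm _ _)
    (a := 0) (b := 2 * n + 2) (by simp) (by simp) (by omega) Polynomial.X, tpf_C, tpf_C]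
  · have hS : ((insert (2 * n + 2) (Finset.range (2 * n + 1))).erase 0).erase (2 * n + 2)
        = (Finset.range (2 * n)).image (· + 1) := by
      rw [← range_succ_image_add_one]
      ext i
      simp only [Finset.mem_erase, Finset.mem_insert, Finset.mem_range, Finset.mem_Icc]
      omega
    rw [hS, tpf_image_add hq, pow_one, Polynomial.coeff_add, Polynomial.coeff_C_of_ne_zero one_ne_zero,
      Polynomial.coeff_X_mul, Polynomial.coeff_C_zero, zero_add]
  · intro i hi j hj hij
    rw [toepl_deform hq n x hij]
    simp only [Finset.mem_insert, Finset.mem_range] at hi hj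
    by_cases h : i = 0 ∧ j = 2 * n + 2
    · rw [if_pos h, if_pos (by omega), h.1, pow_zero, pow_one]
    · rw [if_neg h, if_neg (by omega)]

lemma tpf_deform_coeff_add_one {R : Type*} [CommRing R] [CharP R 2] {s q : ℕ} (hq : q = 2 ^ s)
    (h1 : 1 < q) (x : ℕ → R) (n : ℕ) :
    (tpf q (deform n x) (Finset.range (2 * n + 4))).coeff (q + 1)
      = tpf q x (Finset.range (2 * n)) ^ q ^ 2 := by
  set N := toepl q fun j => Polynomial.C (x j) with hN
  set N' : ℕ → ℕ → Polynomial R := fun i j =>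
    N i j + if (i = 0 ∧ j = 2 * n + 2) ∨ (j = 0 ∧ i = 2 * n + 2) then Polynomial.X else 0 with hN'
  have hNc : ∀ a b, N a b = N b a := toepl_comm _ _
  have hN'c : ∀ a b, N' a b = N' b a := fun a b => by
    simp only [hN', hNc a b, or_comm]
  have hedge : ∀ T : Finset ℕ, 0 ∈ T → 2 * n + 2 ∈ T →
      pf N' T = pf N T + Polynomial.X * pf N ((T.erase 0).erase (2 * n + 2)) := by
    intro T h0 h2
    refine pf_add_edge hNc hN'c h0 h2 (by omega) _ fun i _ j _ hij => ?_
    simp only [hN']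
    by_cases h : i = 0 ∧ j = 2 * n + 2
    · rw [if_pos h, if_pos (Or.inl h)]
    · rw [if_neg h, if_neg (by omega)]
  rw [tpf, pf_add_edge hN'c (toepl_comm q (deform n x)) (a := 1) (b := 2 * n + 3) (by simp)
    (by simp) (by omega) (Polynomial.X ^ q), hedge _ (by simp) (by simp),
    hedge _ (by simp) (by simp), hN, tpf_C, tpf_C, tpf_C, tpf_C]
  · have hS : (((((Finset.range (2 * n + 4)).erase 1).erase (2 * n + 3)).erase 0).erase
        (2 * n + 2)) = (Finset.range (2 * n)).image (· + 2) := by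
      ext i
      simp only [Finset.mem_erase, Finset.mem_image, Finset.mem_range]
      constructor
      · intro h
        exact ⟨i - 2, by omega, by omega⟩
      · rintro ⟨j, hj, rfl⟩
        omega
    rw [hS, tpf_image_add hq, mul_add, ← mul_assoc, ← pow_succ]
    simp only [Polynomial.coeff_add, Polynomial.coeff_X_mul, Polynomial.coeff_X_pow_mul',
      Polynomial.coeff_C]
    simp [show q ≠ 0 by omega]
  · intro i hi j hj hij
    rw [toepl_deform hq n x hij]
    simp only [Finset.mem_range] at hi hj
    simp only [hN']
    rcases Nat.lt_or_ge i 2 with h | h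
    · interval_cases i
      · rw [if_neg (by omega : ¬ (0 = 1 ∧ j = 2 * n + 3)), add_zero, pow_zero, pow_one]
        by_cases h : j = 2 * n + 2
        · rw [if_pos (by omega), if_pos (by omega)]
        · rw [if_neg (by omega), if_neg (by omega)]
      · rw [if_neg (by omega : ¬ ((1 = 0 ∧ j = 2 * n + 2) ∨ (j = 0 ∧ 1 = 2 * n + 2))), add_zero,
          pow_one]
        by_cases h : j = 2 * n + 3
        · rw [if_pos (by omega), if_pos (by omega)]
        · rw [if_neg (by omega), if_neg (by omega)]
    · rw [if_neg (by omega), if_neg (by omega), if_neg (by omega), add_zero, add_zero]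

/-- Divisors of elements fixed by a polynomial deformation are fixed. -/
lemma eq_C_of_dvd {R : Type*} [CommRing R] [IsDomain R] (φ : R →+* Polynomial R)
    (hφ : ∀ a, (φ a).eval 0 = a) {a d : R} (ha : a ≠ 0) (hφa : φ a = Polynomial.C a) (hd : d ∣ a) :
    φ d = Polynomial.C d := by
  obtain ⟨c, rfl⟩ := hd
  have hd0 : φ d ≠ 0 := fun h => by
    have := hφ d
    rw [h, Polynomial.eval_zero] at this
    exact ha (by rw [← this, zero_mul])
  have hc0 : φ c ≠ 0 := fun h => by
    have := hφ c
    rw [h, Polynomial.eval_zero] at this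
    exact ha (by rw [← this, mul_zero])
  have h1 := congrArg Polynomial.natDegree hφa
  rw [map_mul, Polynomial.natDegree_mul hd0 hc0, Polynomial.natDegree_C] at h1
  rw [Polynomial.eq_C_of_natDegree_eq_zero (p := φ d) (by omega), Polynomial.coeff_zero_eq_eval_zero,
    hφ]

/-- The substitution adding an indeterminate to the variable of index `2n+2`. -/
noncomputable def deformHom (F : Type*) [Field F] (n : ℕ) :
    MvPolynomial ℕ F →+* Polynomial (MvPolynomial ℕ F) :=
  (aeval (R := F) (deform n X)).toRingHom

lemma deformHom_tpf {F : Type*} [Field F] (n q : ℕ) (T : Finset ℕ) :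
    deformHom F n (tpf q X T) = tpf q (deform n X) T := by
  rw [tpf_map]
  simp [deformHom]

lemma deformHom_eval {F : Type*} [Field F] (n : ℕ) (p : MvPolynomial ℕ F) :
    (deformHom F n p).eval 0 = p := by
  have h : (Polynomial.evalRingHom (0 : MvPolynomial ℕ F)).comp (deformHom F n)
      = RingHom.id _ := by
    ext i
    · simp [deformHom, Polynomial.algebraMap_apply, MvPolynomial.algebraMap_eq]
    · simp only [deformHom, RingHom.comp_apply, AlgHom.toRingHom_eq_coe, RingHom.coe_coe, aeval_X,
        deform]
      split_ifs <;> simp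
  exact RingHom.congr_fun h p

lemma deformHom_tpf_eq_C {F : Type*} [Field F] (n q : ℕ) {T : Finset ℕ}
    (hT : ∀ i ∈ T, i ≤ 2 * n + 1) :
    deformHom F n (tpf q X T) = Polynomial.C (tpf q X T) := by
  rw [deformHom_tpf, tpf_map]
  refine tpf_congr fun a ha b hb hab => ?_
  have := hT b hb
  rw [deform, if_neg (by omega), add_zero]

lemma tpf_X_ne_zero {F : Type*} [Field F] [CharP F 2] {s q : ℕ} (hq : q = 2 ^ s) (h1 : 1 < q) :
    ∀ n, tpf q (X : ℕ → MvPolynomial ℕ F) (Finset.range (2 * n)) ≠ 0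
  | 0 => by simp [tpf, pf_empty]
  | 1 => by
    have h : tpf q (X : ℕ → MvPolynomial ℕ F) (Finset.range (2 * 1)) = X 1 := by
      rw [tpf, pf_expand (toepl_comm _ _) (a := 0) (by simp), Finset.sum_eq_single 1]
      · rw [toepl_of_lt _ _ one_pos, show ((Finset.range (2 * 1)).erase 0).erase 1 = ∅ by decide,
          pf_empty]
        simp
      · intro b hb hb1
        simp only [Finset.mem_erase, Finset.mem_range] at hb
        omega
      · intro h
        exact absurd (by decide) h
    rw [h]
    exact X_ne_zero _
  | n + 2 => fun h => by
    have h2 := tpf_deform_coeff_add_one hq h1 (X : ℕ → MvPolynomial ℕ F) n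
    rw [← deformHom_tpf, show 2 * n + 4 = 2 * (n + 2) by ring, h, map_zero,
      Polynomial.coeff_zero] at h2
    exact pow_ne_zero _ (tpf_X_ne_zero hq h1 n) h2.symm

lemma isRelPrime_tpf {F : Type*} [Field F] [CharP F 2] {s q : ℕ} (hq : q = 2 ^ s) (h1 : 1 < q)
    (n : ℕ) : IsRelPrime (tpf q (X : ℕ → MvPolynomial ℕ F) (Finset.range (2 * n + 2)))
      (tpf q X (Finset.range (2 * n))) := by
  induction n with
  | zero =>
    rw [tpf, tpf, mul_zero, Finset.range_zero, pf_empty]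
    exact isRelPrime_one_right
  | succ n ih =>
    intro d hd hd'
    have h : deformHom F n d = Polynomial.C d :=
      eq_C_of_dvd _ (deformHom_eval n) (tpf_X_ne_zero hq h1 (n + 1))
        (deformHom_tpf_eq_C n q fun i hi => by simp at hi; omega) hd'
    have h3 := map_dvd (deformHom F n) hd
    rw [h, deformHom_tpf, Polynomial.C_dvd_iff_dvd_coeff] at h3
    have h4 := h3 (q + 1)
    rw [show 2 * (n + 1) + 2 = 2 * n + 4 by ring, tpf_deform_coeff_add_one hq h1] at h4
    exact (ih.pow_right (n := q ^ 2)) hd' h4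

lemma isRelPrime_tpf_insert {F : Type*} [Field F] [CharP F 2] {s q : ℕ} (hq : q = 2 ^ s)
    (h1 : 1 < q) (n : ℕ) :
    IsRelPrime (tpf q (X : ℕ → MvPolynomial ℕ F) (Finset.range (2 * n + 2)))
      (tpf q X (insert (2 * n + 2) (Finset.range (2 * n + 1)))) := by
  intro d hd hd'
  have h : deformHom F n d = Polynomial.C d :=
    eq_C_of_dvd _ (deformHom_eval n) (tpf_X_ne_zero hq h1 (n + 1))
      (deformHom_tpf_eq_C n q fun i hi => by simp at hi; omega) hd
  have h3 := map_dvd (deformHom F n) hd'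
  rw [h, deformHom_tpf, Polynomial.C_dvd_iff_dvd_coeff] at h3
  have h4 := h3 1
  rw [tpf_deform_coeff_one hq] at h4
  exact ((isRelPrime_tpf hq h1 n).pow_right (n := q)) hd h4

lemma tpf_dvd_plucker {R : Type*} [CommRing R] [CharP R 2] {s q : ℕ} (hq : q = 2 ^ s)
    (x : ℕ → R) (n : ℕ) {k l : ℕ} (hk : k ∈ Finset.Icc 1 (2 * n + 1))
    (hl : l ∈ Finset.Icc 1 (2 * n + 1)) :
    tpf q x (Finset.range (2 * n + 2)) ∣
      tpf q x ((Finset.Icc 1 (2 * n + 1)).erase l) * tpf q x ((Finset.range (2 * n + 3)).erase k)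
      + tpf q x ((Finset.Icc 1 (2 * n + 1)).erase k)
        * tpf q x ((Finset.range (2 * n + 3)).erase l) := by
  rcases eq_or_ne k l with rfl | hkl
  · rw [CharTwo.add_self_eq_zero]
    exact dvd_zero _
  have hq0 : q ≠ 0 := by rw [hq]; positivity
  rw [Finset.mem_Icc] at hk hl
  set I := ((Finset.Icc 1 (2 * n + 1)).erase k).erase l with hI
  have h := pf_plucker (toepl_comm q x) (toepl_self q x) (I := I) (J := Finset.range (2 * n + 3))
    (fun i hi => by simp [hI] at hi; simp; omega)
  have hJ : Finset.range (2 * n + 3) \ I = {k, l, 0, 2 * n + 2} := by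
    ext i
    simp only [hI, Finset.mem_sdiff, Finset.mem_range, Finset.mem_erase, Finset.mem_Icc,
      Finset.mem_insert, Finset.mem_singleton]
    omega
  have h1 : insert k I = (Finset.Icc 1 (2 * n + 1)).erase l := by
    ext i
    simp only [hI, Finset.mem_erase, Finset.mem_Icc, Finset.mem_insert]
    omega
  have h2 : insert l I = (Finset.Icc 1 (2 * n + 1)).erase k := by
    ext i
    simp only [hI, Finset.mem_erase, Finset.mem_Icc, Finset.mem_insert]
    omega
  have h3 : (Finset.range (2 * n + 3)).erase 0 = (Finset.range (2 * n + 2)).image (· + 1) := by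
    rw [← range_succ_image_add_one]
    ext i
    simp only [Finset.mem_erase, Finset.mem_Icc, Finset.mem_range]
    omega
  have h4 : (Finset.range (2 * n + 3)).erase (2 * n + 2) = Finset.range (2 * n + 2) := by
    ext i
    simp only [Finset.mem_erase, Finset.mem_range]
    omega
  have h5 := tpf_image_add hq x (Finset.range (2 * n + 2)) 1
  rw [hJ, Finset.sum_insert (by simp; omega), Finset.sum_insert (by simp; omega),
    Finset.sum_insert (by simp), Finset.sum_singleton, h1, h2, ← add_assoc] at h
  change tpf q x _ * tpf q x _ + tpf q x _ * tpf q x _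
    + (tpf q x _ * tpf q x _ + tpf q x _ * tpf q x _) = 0 at h
  rw [CharTwo.add_eq_zero.1 h, h3, h4, h5, pow_one]
  exact dvd_add ((dvd_pow_self _ hq0).mul_left _) (dvd_mul_left _ _)

/-- The first half of the maximal Pfaffians lies in the ideal generated by the second half. -/
lemma exists_tpf_erase_eq_sum {F : Type*} [Field F] [CharP F 2] {s q : ℕ} (hq : q = 2 ^ s)
    (h1 : 1 < q) (n : ℕ) :
    ∀ k < n, ∃ α : ℕ → MvPolynomial ℕ F, tpf q X ((Finset.range (2 * n + 1)).erase k)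
      = ∑ l ∈ Finset.Icc n (2 * n), α l * tpf q X ((Finset.range (2 * n + 1)).erase l) := by
  induction n with
  | zero => intro k hk; omega
  | succ n ih =>
    intro k hk
    have hlast : (Finset.range (2 * (n + 1) + 1)).erase (2 * n + 2) = Finset.range (2 * n + 2) := by
      ext i
      simp only [Finset.mem_erase, Finset.mem_range]
      omega
    suffices h : ∃ α : ℕ → MvPolynomial ℕ F, tpf q X (Finset.range (2 * n + 2)) ∣
        tpf q X ((Finset.range (2 * (n + 1) + 1)).erase k) + ∑ l ∈ Finset.Icc (n + 1) (2 * n + 1),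
          α l * tpf q X ((Finset.range (2 * (n + 1) + 1)).erase l) by
      obtain ⟨α, c, hc⟩ := h
      refine ⟨fun l => if l = 2 * n + 2 then c else α l, ?_⟩
      have hI : Finset.Icc (n + 1) (2 * (n + 1))
          = insert (2 * n + 2) (Finset.Icc (n + 1) (2 * n + 1)) := by
        ext i
        simp only [Finset.mem_insert, Finset.mem_Icc]
        omega
      rw [hI, Finset.sum_insert (by simp)]
      beta_reduce
      rw [if_pos rfl, hlast, mul_comm c, ← hc, add_assoc]
      have h2 : ∑ l ∈ Finset.Icc (n + 1) (2 * n + 1), (if l = 2 * n + 2 then c else α l)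
            * tpf q X ((Finset.range (2 * (n + 1) + 1)).erase l)
          = ∑ l ∈ Finset.Icc (n + 1) (2 * n + 1),
            α l * tpf q X ((Finset.range (2 * (n + 1) + 1)).erase l) :=
        Finset.sum_congr rfl fun l hl => by
          rw [if_neg (by have := Finset.mem_Icc.1 hl; omega)]
      rw [h2, CharTwo.add_self_eq_zero, add_zero]
    rcases k with _ | k
    · refine ⟨0, ?_⟩
      have h3 : (Finset.range (2 * (n + 1) + 1)).erase 0
          = (Finset.range (2 * n + 2)).image (· + 1) := by
        rw [← range_succ_image_add_one]
        ext i
        simp only [Finset.mem_erase, Finset.mem_Icc, Finset.mem_range]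
        omega
      simp only [Pi.zero_apply, zero_mul, Finset.sum_const_zero, add_zero]
      rw [h3, tpf_image_add hq, pow_one]
      exact dvd_pow_self _ (by omega)
    obtain ⟨α, hα⟩ := ih k (by omega)
    have hsh : ∀ i, (Finset.Icc 1 (2 * n + 1)).erase (i + 1)
        = ((Finset.range (2 * n + 1)).erase i).image (· + 1) := fun i => by
      rw [range_succ_image_add_one, Finset.image_erase (add_left_injective 1)]
    have hκ : ∀ i, tpf q (X : ℕ → MvPolynomial ℕ F) ((Finset.Icc 1 (2 * n + 1)).erase (i + 1))
        = tpf q X ((Finset.range (2 * n + 1)).erase i) ^ q := fun i => by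
      rw [hsh, tpf_image_add hq, pow_one]
    have hα' : tpf q (X : ℕ → MvPolynomial ℕ F) ((Finset.Icc 1 (2 * n + 1)).erase (k + 1))
        = ∑ l ∈ Finset.Icc (n + 1) (2 * n + 1),
          α (l - 1) ^ q * tpf q X ((Finset.Icc 1 (2 * n + 1)).erase l) := by
      have h5 := sum_pow_pow_two hq 1 (Finset.Icc n (2 * n))
        fun l => α l * tpf q X ((Finset.range (2 * n + 1)).erase l)
      rw [pow_one] at h5
      rw [hκ, hα, h5, ← Finset.image_add_right_Icc,
        Finset.sum_image (fun _ _ _ _ h => add_left_injective 1 h)]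
      refine Finset.sum_congr rfl fun l _ => ?_
      rw [hκ, mul_pow, Nat.add_sub_cancel]
    refine ⟨fun l => α (l - 1) ^ q, ?_⟩
    have hlast' : (Finset.Icc 1 (2 * n + 1)).erase (2 * n + 1)
        = (Finset.range (2 * n)).image (· + 1) := by
      rw [← range_succ_image_add_one]
      ext i
      simp only [Finset.mem_erase, Finset.mem_Icc]
      omega
    refine IsRelPrime.dvd_of_dvd_mul_left
      (y := tpf q X ((Finset.Icc 1 (2 * n + 1)).erase (2 * n + 1))) ?_ ?_
    · rw [hlast', tpf_image_add hq]
      exact (isRelPrime_tpf hq h1 n).pow_right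
    · have hd := tpf_dvd_plucker hq (X : ℕ → MvPolynomial ℕ F) n
        (k := k + 1) (l := 2 * n + 1) (by simp; omega) (by simp)
      have hd' := fun l (hl : l ∈ Finset.Icc (n + 1) (2 * n + 1)) =>
        (tpf_dvd_plucker hq (X : ℕ → MvPolynomial ℕ F) n
          (k := l) (l := 2 * n + 1) (by simp at hl ⊢; omega) (by simp)).mul_left (α (l - 1) ^ q)
      have hd2 := dvd_add hd (Finset.dvd_sum hd')
      rw [hα', Finset.sum_mul] at hd2
      convert hd2 using 1
      rw [mul_add, Finset.mul_sum, add_assoc, ← Finset.sum_add_distrib]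
      have key : ∀ a b c d e : MvPolynomial ℕ F,
          a * (b * c) = b * d * e + b * (a * c + d * e) := fun a b c d e => by
        rw [mul_add, ← mul_assoc b d, add_left_comm, CharTwo.add_self_eq_zero]
        ring
      exact congrArg₂ (· + ·) rfl (Finset.sum_congr rfl fun l _ => key _ _ _ _ _)

/-- The substitution of the first `2m` of the `ξ_j`. -/
noncomputable def evXi (q m : ℕ) (F : Type*) [Field F] :
    MvPolynomial ℕ F →ₐ[F] MvPolynomial (OIdx m) F :=
  aeval fun j => if j < 2 * m then gram q (genVec m F) 0 j else 0

/-- The truncation of a sequence of variables. -/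
noncomputable def truncHom (m : ℕ) (F : Type*) [Field F] : MvPolynomial ℕ F →ₐ[F] MvPolynomial ℕ F :=
  aeval fun j => if 1 ≤ j ∧ j < 2 * m then X j else 0

lemma evXi_truncHom {q m : ℕ} {F : Type*} [Field F] [CharP F 2] (P : MvPolynomial ℕ F) :
    evXi q m F (truncHom m F P) = evXi q m F P := by
  have h : (evXi q m F).comp (truncHom m F) = evXi q m F := by
    ext1 j
    simp only [AlgHom.comp_apply, truncHom, evXi, aeval_X]
    by_cases hj : j < 2 * m
    · rcases j.eq_zero_or_pos with rfl | h0
      · simp [gram_self]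
      · rw [if_pos ⟨h0, hj⟩, aeval_X]
    · simp [hj]
  exact AlgHom.congr_fun h P

lemma evXi_tpf {q m s : ℕ} {F : Type*} [Field F] [CharP F 2] (hq : q = 2 ^ s) {T : Finset ℕ}
    (hT : ∀ i ∈ T, i < 2 * m) : evXi q m F (tpf q X T) = gpf q m F T := by
  have h := tpf_map (evXi q m F).toRingHom q X T
  refine h.trans (pf_congr fun a ha b hb hab => ?_)
  have h2 := gram_add hq (genVec m F) 0 (b - a) a
  rw [zero_add, Nat.sub_add_cancel hab.le] at h2
  rw [toepl_of_lt _ _ hab, h2]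
  have := hT b hb
  simp only [evXi, AlgHom.toRingHom_eq_coe, RingHom.coe_coe, aeval_X]
  rw [if_pos (by omega)]

lemma truncHom_tpf {q m : ℕ} {F : Type*} [Field F] {T : Finset ℕ}
    (hT : ∀ i ∈ T, i < 2 * m) : truncHom m F (tpf q X T) = tpf q X T := by
  have h := tpf_map (truncHom m F).toRingHom q X T
  refine h.trans (tpf_congr fun a ha b hb hab => ?_)
  have := hT b hb
  simp only [truncHom, AlgHom.toRingHom_eq_coe, RingHom.coe_coe, aeval_X]
  rw [if_pos (by omega)]

lemma gpf_mem_range {q m s : ℕ} {F : Type*} [Field F] [CharP F 2] (hq : q = 2 ^ s) {T : Finset ℕ}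
    (hT : ∀ i ∈ T, i < 2 * m) : gpf q m F T ∈ (evXi q m F).range :=
  ⟨_, evXi_tpf hq hT⟩

lemma gram_zero_mem_range {q m : ℕ} {F : Type*} [Field F] {j : ℕ} (hj : j < 2 * m) :
    gram q (genVec m F) 0 j ∈ (evXi q m F).range :=
  ⟨X j, by simp [evXi, hj]⟩

lemma gSeq_cramer_mem {q m s : ℕ} {F : Type*} [Field F] [Fintype F] [CharP F 2] (hs : 2 ≤ s)
    (hm : 2 ≤ m) (hq : q = 2 ^ s) (h2 : 2 < q) (hF : Fintype.card F = q)
    {b1 : MvPolynomial (OIdx m) F}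
    (hb1 : b1 ^ 2 = (dickP m F).coeff (q ^ (2 * m - 1))
      + uM q m F ^ (q - 2) * (deltaOne q m F + xiBar m F * uM1 q m F ^ q))
    {k l : ℕ} (hk : k < 2 * m - 1) (hl : l < 2 * m - 1) :
    gpf q m F ((Finset.range (2 * m - 1)).erase l) ^ 2 ^ (s - 1) * gSeq q m s F b1 k
      + gpf q m F ((Finset.range (2 * m - 1)).erase k) ^ 2 ^ (s - 1) * gSeq q m s F b1 l
      ∈ (evXi q m F).range := by
  rcases eq_or_ne k l with rfl | hkl
  · rw [CharTwo.add_self_eq_zero]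
    exact zero_mem _
  have hT : ∀ T : Finset ℕ, T ⊆ Finset.range (2 * m) → gpf q m F T ∈ (evXi q m F).range :=
    fun T hT => gpf_mem_range hq fun i hi => Finset.mem_range.1 (hT hi)
  rw [gSeq_cramer hs hm hq h2 hF hb1 hk hl hkl]
  refine add_mem (pow_mem (hT _ ?_) _) (sum_mem fun j hj => mul_mem (mul_mem (mul_mem
    (pow_mem (hT _ ?_) _) (gram_zero_mem_range ?_)) (pow_mem (hT _ ?_) _)) (pow_mem (hT _ ?_) _))
  all_goals try intro i hi
  all_goals simp only [Finset.mem_insert, Finset.mem_erase, Finset.mem_range] at *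
  all_goals omega

/-- The elements `e_{m+1}, …, e_{2m-1}` are polynomials in `ξ_1, …, ξ_{2m-1}, e_1, …, e_m`. -/
lemma exists_gSeq_eq {q m s : ℕ} {F : Type*} [Field F] [Fintype F] [CharP F 2] (hs : 2 ≤ s)
    (hm : 2 ≤ m) (hq : q = 2 ^ s) (h2 : 2 < q) (hF : Fintype.card F = q)
    {b1 : MvPolynomial (OIdx m) F}
    (hb1 : b1 ^ 2 = (dickP m F).coeff (q ^ (2 * m - 1))
      + uM q m F ^ (q - 2) * (deltaOne q m F + xiBar m F * uM1 q m F ^ q))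
    (hind : ∀ P, evXi q m F P = 0 → truncHom m F P = 0) {k : ℕ} (hk : k < m - 1) :
    ∃ (R : MvPolynomial ℕ F) (α : ℕ → MvPolynomial ℕ F), gSeq q m s F b1 k = evXi q m F R
      + ∑ l ∈ Finset.Icc (m - 1) (2 * m - 2), evXi q m F (α l) * gSeq q m s F b1 l := by
  obtain ⟨n, rfl⟩ : ∃ n, m = n + 2 := ⟨m - 2, by omega⟩
  rw [show n + 2 - 1 = n + 1 by omega] at hk ⊢
  rw [show 2 * (n + 2) - 2 = 2 * (n + 1) by omega]
  obtain ⟨α, hα⟩ := exists_tpf_erase_eq_sum (F := F) hq (by omega) (n + 1) k hk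
  have hmem := fun k l (hk : k < 2 * (n + 1) + 1) (hl : l < 2 * (n + 1) + 1) =>
    gSeq_cramer_mem hs hm hq h2 hF hb1 (k := k) (l := l) (by omega) (by omega)
  rw [show 2 * (n + 2) - 1 = 2 * (n + 1) + 1 by omega] at hmem
  set κ : ℕ → MvPolynomial ℕ F := fun l => tpf q X ((Finset.range (2 * (n + 1) + 1)).erase l) with hκ
  have hlt : ∀ l, ∀ i ∈ (Finset.range (2 * (n + 1) + 1)).erase l, i < 2 * (n + 2) := fun l i hi => by
    simp only [Finset.mem_erase, Finset.mem_range] at hi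
    omega
  have hev : ∀ l, evXi q (n + 2) F (κ l)
      = gpf q (n + 2) F ((Finset.range (2 * (n + 1) + 1)).erase l) := fun l => evXi_tpf hq (hlt l)
  simp only [← hev] at hmem
  set f := gSeq q (n + 2) s F b1 k + ∑ l ∈ Finset.Icc (n + 1) (2 * (n + 1)),
    evXi q (n + 2) F (α l ^ 2 ^ (s - 1)) * gSeq q (n + 2) s F b1 l with hf
  have hκk : κ k ^ 2 ^ (s - 1) = ∑ l ∈ Finset.Icc (n + 1) (2 * (n + 1)),
      α l ^ 2 ^ (s - 1) * κ l ^ 2 ^ (s - 1) := by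
    simp only [hκ]
    rw [hα, sum_pow_char_pow]
    exact Finset.sum_congr rfl fun l _ => mul_pow _ _ _
  have hfmem : ∀ l0 < 2 * (n + 1) + 1, ∃ P, evXi q (n + 2) F P
      = evXi q (n + 2) F (κ l0) ^ 2 ^ (s - 1) * f := by
    intro l0 hl0
    have h3 := add_mem (hmem k l0 (by omega) hl0) (sum_mem fun l
      (hl : l ∈ Finset.Icc (n + 1) (2 * (n + 1))) => mul_mem (AlgHom.mem_range_self
        (evXi q (n + 2) F) (α l ^ 2 ^ (s - 1)))
          (hmem l l0 (by have := Finset.mem_Icc.1 hl; omega) hl0))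
    obtain ⟨P, hP⟩ := h3
    refine ⟨P, hP.trans ?_⟩
    rw [hf, ← map_pow (evXi q (n + 2) F) (κ k), hκk, map_sum, Finset.sum_mul,
      mul_add (evXi q (n + 2) F (κ l0) ^ 2 ^ (s - 1)), Finset.mul_sum, add_assoc, ← Finset.sum_add_distrib]
    refine congrArg₂ (· + ·) rfl (Finset.sum_congr rfl fun l _ => ?_)
    rw [map_mul, mul_add (evXi q (n + 2) F (α l ^ 2 ^ (s - 1))), ← mul_assoc _ (evXi q (n + 2) F (κ l) ^ _), ← map_pow _ (κ l),
      add_left_comm, CharTwo.add_self_eq_zero, add_zero, mul_left_comm]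
  obtain ⟨P1, hP1⟩ := hfmem (2 * n + 2) (by omega)
  obtain ⟨P2, hP2⟩ := hfmem (2 * n + 1) (by omega)
  have htr : ∀ l, truncHom (n + 2) F (κ l) = κ l := fun l => truncHom_tpf (hlt l)
  have hrel : κ (2 * n + 1) ^ 2 ^ (s - 1) * truncHom (n + 2) F P1
      = κ (2 * n + 2) ^ 2 ^ (s - 1) * truncHom (n + 2) F P2 := by
    rw [← htr (2 * n + 1), ← htr (2 * n + 2), ← map_pow, ← map_pow, ← map_mul, ← map_mul,
      ← sub_eq_zero, ← map_sub]
    refine hind _ ?_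
    rw [map_sub, map_mul, map_mul, hP1, hP2, map_pow, map_pow]
    ring
  have he1 : (Finset.range (2 * (n + 1) + 1)).erase (2 * n + 2) = Finset.range (2 * n + 2) := by
    ext i
    simp only [Finset.mem_erase, Finset.mem_range]
    omega
  have he2 : (Finset.range (2 * (n + 1) + 1)).erase (2 * n + 1)
      = insert (2 * n + 2) (Finset.range (2 * n + 1)) := by
    ext i
    simp only [Finset.mem_erase, Finset.mem_range, Finset.mem_insert]
    omega
  have hcop : IsRelPrime (κ (2 * n + 2) ^ 2 ^ (s - 1)) (κ (2 * n + 1) ^ 2 ^ (s - 1)) := by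
    refine IsRelPrime.pow ?_
    simp only [hκ]
    rw [he1, he2]
    exact isRelPrime_tpf_insert hq (by omega) n
  obtain ⟨R, hR⟩ := hcop.dvd_of_dvd_mul_left (Dvd.intro _ hrel.symm)
  have hne : evXi q (n + 2) F (κ (2 * n + 2)) ^ 2 ^ (s - 1) ≠ 0 := by
    refine pow_ne_zero _ ?_
    rw [hev, he1]
    exact gpf_range_sub_two_ne_zero (m := n + 2) hF (by omega)
  refine ⟨R, fun l => α l ^ 2 ^ (s - 1), ?_⟩
  have hfR : f = evXi q (n + 2) F R := by
    refine mul_left_cancel₀ hne ?_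
    rw [← hP1, ← evXi_truncHom, hR, map_mul, map_pow]
  rw [← hfR, hf, add_assoc, CharTwo.add_self_eq_zero, add_zero]

/-- The standing hypotheses on `q`, `m` and `b_1`. -/
structure OrthData (q m s : ℕ) (F : Type*) [Field F] [Fintype F]
    (b1 : MvPolynomial (OIdx m) F) : Prop where
  hs : 2 ≤ s
  hm : 2 ≤ m
  hq : q = 2 ^ s
  h2 : 2 < q
  hF : Fintype.card F = q
  hb1 : b1 ^ 2 = (dickP m F).coeff (q ^ (2 * m - 1))
      + uM q m F ^ (q - 2) * (deltaOne q m F + xiBar m F * uM1 q m F ^ q)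

lemma xiZero_eq (m : ℕ) (F : Type*) [Field F] : xiZero m F = X none ^ 2 + xiBar m F := rfl

lemma range_evXi_le {q m : ℕ} {F : Type*} [Field F] {E : Subalgebra F (MvPolynomial (OIdx m) F)}
    (hξ : ∀ j < 2 * m, gram q (genVec m F) 0 j ∈ E) : (evXi q m F).range ≤ E := by
  rw [evXi, ← Algebra.adjoin_range_eq_range_aeval, Algebra.adjoin_le_iff]
  rintro _ ⟨j, rfl⟩
  dsimp only
  split_ifs with h
  · exact hξ j h
  · exact E.zero_mem

section Integrality

variable {q m s : ℕ} {F : Type*} [Field F] [Fintype F] [CharP F 2] {b1 : MvPolynomial (OIdx m) F}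

lemma quadPf_mem (hq : q = 2 ^ s) {E : Subalgebra F (MvPolynomial (OIdx m) F)}
    (h0 : xiZero m F ∈ E) (hξ : ∀ j < 2 * m, gram q (genVec m F) 0 j ∈ E) {T : Finset ℕ}
    (hT : ∀ i ∈ T, i < 2 * m) : quadPf q m F T ∈ E := by
  have hmem : ∀ T : Finset ℕ, (∀ i ∈ T, i < 2 * m) → gpf q m F T ∈ E := fun T hT =>
    range_evXi_le hξ (gpf_mem_range hq hT)
  refine add_mem (mul_mem h0 (hmem T hT)) ?_
  rw [pairSum]
  refine sum_mem fun a ha => sum_mem fun b hb => ?_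
  split_ifs
  swap
  · exact zero_mem _
  refine mul_mem (mul_mem (hξ a (hT a ha)) (hξ b (hT b hb))) (hmem _ fun i hi => hT i ?_)
  exact Finset.mem_of_mem_erase (Finset.mem_of_mem_erase hi)

lemma dickP_coeff_mem (H : OrthData q m s F b1) {E : Subalgebra F (MvPolynomial (OIdx m) F)}
    (h0 : xiZero m F ∈ E) (hξ : ∀ j < 2 * m, gram q (genVec m F) 0 j ∈ E)
    (hg : ∀ k < 2 * m - 1, gSeq q m s F b1 k ∈ E) (n : ℕ) : (dickP m F).coeff n ∈ E := by
  have hu := gpf_range_ne_zero (m := m) H.hF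
  have h2 := H.h2
  have humem : gpf q m F (Finset.range (2 * m)) ∈ E :=
    range_evXi_le hξ (gpf_mem_range H.hq fun i hi => Finset.mem_range.1 hi)
  by_cases hn : ∃ k < 2 * m + 1, n = q ^ k
  · obtain ⟨k, hk, rfl⟩ := hn
    have h1 := gpf_mul_dickP_coeff H.hF hk
    rcases k.eq_zero_or_pos with rfl | hk0
    · have h3 : (Finset.range (2 * m + 1)).erase 0 = (Finset.range (2 * m)).image (· + 1) := by
        rw [← range_succ_image_add_one]
        ext i
        simp only [Finset.mem_erase, Finset.mem_Icc, Finset.mem_range]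
        omega
      have h4 : (dickP m F).coeff (q ^ 0) = gpf q m F (Finset.range (2 * m)) ^ (q - 1) := by
        refine mul_left_cancel₀ hu ?_
        rw [h1, h3, gpf, pf_gram_image_add H.hq, pow_one, ← pow_succ', Nat.sub_add_cancel (by omega)]
      rw [h4]
      exact pow_mem humem _
    rcases eq_or_ne k (2 * m) with rfl | hk2
    · have h4 : (dickP m F).coeff (q ^ (2 * m)) = 1 := by
        rw [← H.hF, ← dickP_natDegree]
        exact dickP_monic m F
      rw [h4]
      exact one_mem _
    · have h5 := eSeq_star H.hs H.hm H.hq H.h2 H.hF H.hb1 (k := k) (by omega) (by omega)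
      have h6 : gSeq q m s F b1 (k - 1) = eSeq q m s F b1 (2 * m - 1 - k) := by
        rw [gSeq, if_neg (by omega)]
        congr 1
        omega
      have h4 : (dickP m F).coeff (q ^ k) = gSeq q m s F b1 (k - 1) ^ 2
          + gpf q m F (Finset.range (2 * m)) ^ (q - 2)
            * quadPf q m F ((Finset.Icc 1 (2 * m - 1)).erase k) := by
        refine mul_left_cancel₀ hu ?_
        rw [h1, h6, mul_add, h5, ← mul_assoc, ← pow_succ', show q - 2 + 1 = q - 1 by omega,
          add_assoc, CharTwo.add_self_eq_zero, add_zero]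
      rw [h4]
      refine add_mem (pow_mem (hg _ (by omega)) _) (mul_mem (pow_mem humem _)
        (quadPf_mem H.hq h0 hξ fun i hi => ?_))
      simp only [Finset.mem_erase, Finset.mem_Icc] at hi
      omega
  · have h3 : gpf q m F (Finset.range (2 * m)) * (dickP m F).coeff n = 0 := by
      rw [← Polynomial.coeff_C_mul, C_mul_dickP H.hF, Polynomial.finsetSum_coeff]
      refine Finset.sum_eq_zero fun k hk => ?_
      rw [Polynomial.coeff_C_mul, Polynomial.coeff_X_pow, if_neg, mul_zero]
      exact fun h => hn ⟨k, Finset.mem_range.1 hk, h⟩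
    rw [(mul_eq_zero.1 h3).resolve_left hu]
    exact zero_mem _

/-- Roots of monic polynomials with coefficients in a subalgebra are integral. -/
lemma isIntegral_of_coeff_mem {R S : Type*} [CommRing R] [CommRing S] [Algebra R S]
    {E : Subalgebra R S} {p : Polynomial S} (hp : p.Monic) (hc : ∀ n, p.coeff n ∈ E) {x : S}
    (hx : p.eval x = 0) : IsIntegral E x := by
  have hl : p ∈ Polynomial.lifts (algebraMap E S) := by
    rw [Polynomial.lifts_iff_coeff_lifts]
    exact fun n => ⟨⟨_, hc n⟩, rfl⟩
  obtain ⟨p', hp', -, hmon⟩ := Polynomial.lifts_and_natDegree_eq_and_monic hl hp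
  refine ⟨p', hmon, ?_⟩
  rw [← Polynomial.eval_map, hp', hx]

lemma isIntegral_of_gens (H : OrthData q m s F b1) {E : Subalgebra F (MvPolynomial (OIdx m) F)}
    (h0 : xiZero m F ∈ E) (hξ : ∀ j < 2 * m, gram q (genVec m F) 0 j ∈ E)
    (hg : ∀ k < 2 * m - 1, gSeq q m s F b1 k ∈ E) (f : MvPolynomial (OIdx m) F) :
    IsIntegral E f := by
  have hsome : ∀ i, IsIntegral E (X (some i) : MvPolynomial (OIdx m) F) := fun i => by
    refine isIntegral_of_coeff_mem (dickP_monic m F) (dickP_coeff_mem H h0 hξ hg) ?_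
    have := dickP_eval (F := F) (Pi.single i 1)
    rwa [linForm, Finset.sum_eq_single i (fun j _ hj => by simp [hj]) (by simp), Pi.single_eq_same,
      C_1, one_mul] at this
  have hnone : IsIntegral E (X none : MvPolynomial (OIdx m) F) := by
    refine IsIntegral.of_pow (n := 2) two_pos ?_
    have h : (X none : MvPolynomial (OIdx m) F) ^ 2 = xiZero m F + xiBar m F := by
      rw [xiZero_eq, add_assoc, CharTwo.add_self_eq_zero, add_zero]
    rw [h]
    exact (isIntegral_algebraMap (R := E) (x := ⟨_, h0⟩)).add
      (IsIntegral.sum _ fun j _ => (hsome _).mul (hsome _))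
  induction f using MvPolynomial.induction_on with
  | C a => exact isIntegral_algebraMap (R := E) (x := algebraMap F E a)
  | add p p' h h' => exact h.add h'
  | mul_X p i h =>
    refine h.mul ?_
    rcases i with _ | i
    · exact hnone
    · exact hsome i

end Integrality

/-- Elements integral over `E` become integral over `P` after multiplication by a power of `κ`,
if the same holds for membership. -/
lemma exists_pow_mul_isIntegral {R S : Type*} [CommRing R] [CommRing S] [Algebra R S]
    {E P : Subalgebra R S} {κ : S} (hκ : κ ∈ P) (h : ∀ a ∈ E, ∃ N, κ ^ N * a ∈ P) {c : S}
    (hc : IsIntegral E c) : ∃ N, IsIntegral P (κ ^ N * c) := by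
  obtain ⟨p, hp, hpc⟩ := hc
  choose n hn using h
  set N := ∑ i ∈ Finset.range (p.natDegree + 1), n (p.coeff i : S) (p.coeff i).2
  refine ⟨N, ?_⟩
  have hmem : ∀ i, κ ^ N * (p.coeff i : S) ∈ P := fun i => by
    by_cases hi : i < p.natDegree + 1
    · have hle : n (p.coeff i : S) (p.coeff i).2 ≤ N :=
        Finset.single_le_sum (f := fun i => n (p.coeff i : S) (p.coeff i).2)
          (fun _ _ => Nat.zero_le _) (Finset.mem_range.2 hi)
      rw [← Nat.sub_add_cancel hle, pow_add, mul_assoc]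
      exact mul_mem (pow_mem hκ _) (hn _ _)
    · rw [Polynomial.coeff_eq_zero_of_natDegree_lt (by omega)]
      simp
  set p' := p.map (algebraMap E S)
  have hp' : p'.Monic := hp.map _
  refine isIntegral_of_coeff_mem (p := p'.scaleRoots (κ ^ N))
    ((Polynomial.monic_scaleRoots_iff _).2 hp') (fun i => ?_) ?_
  · rw [Polynomial.coeff_scaleRoots]
    rcases lt_trichotomy i p'.natDegree with hi | hi | hi
    · obtain ⟨d, hd⟩ : ∃ d, p'.natDegree - i = d + 1 := ⟨p'.natDegree - i - 1, by omega⟩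
      rw [hd, pow_succ', mul_left_comm, ← mul_assoc]
      refine mul_mem ?_ (pow_mem (pow_mem hκ _) _)
      rw [Polynomial.coeff_map]
      exact hmem i
    · rw [hi, Polynomial.coeff_natDegree, hp'.leadingCoeff, one_mul]
      exact pow_mem (pow_mem hκ _) _
    · rw [Polynomial.coeff_eq_zero_of_natDegree_lt hi, zero_mul]
      exact zero_mem _
  · have h0 : p'.eval c = 0 := by rw [Polynomial.eval_map, hpc]
    rw [Polynomial.scaleRoots_eval_mul, h0, mul_zero]

/-- Closure properties of `{a | ∃ N, κ ^ N * a ∈ P}`. -/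
lemma exists_pow_mul_mem_of_adjoin {R S : Type*} [CommRing R] [CommRing S] [Algebra R S]
    {P : Subalgebra R S} {κ : S} (hκ : κ ∈ P) {X : Set S} (h : ∀ a ∈ X, ∃ N, κ ^ N * a ∈ P)
    {a : S} (ha : a ∈ Algebra.adjoin R X) : ∃ N, κ ^ N * a ∈ P := by
  induction ha using Algebra.adjoin_induction with
  | mem x hx => exact h x hx
  | algebraMap r => exact ⟨0, by simp⟩
  | add x y _ _ hx hy =>
    obtain ⟨N, hN⟩ := hx
    obtain ⟨M, hM⟩ := hy
    refine ⟨N + M, ?_⟩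
    have : κ ^ (N + M) * (x + y) = κ ^ M * (κ ^ N * x) + κ ^ N * (κ ^ M * y) := by ring
    rw [this]
    exact add_mem (mul_mem (pow_mem hκ _) hN) (mul_mem (pow_mem hκ _) hM)
  | mul x y _ _ hx hy =>
    obtain ⟨N, hN⟩ := hx
    obtain ⟨M, hM⟩ := hy
    refine ⟨N + M, ?_⟩
    have : κ ^ (N + M) * (x * y) = (κ ^ N * x) * (κ ^ M * y) := by ring
    rw [this]
    exact mul_mem hN hM

/-- The algebra generated by `ξ_0`, all `ξ_j` and the `e_i` with shifted index in `J`. -/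
noncomputable def subGen (q m s : ℕ) (F : Type*) [Field F] (b1 : MvPolynomial (OIdx m) F)
    (J : Set ℕ) : Subalgebra F (MvPolynomial (OIdx m) F) :=
  Algebra.adjoin F {p | p = xiZero m F ∨ (∃ j < 2 * m, p = gram q (genVec m F) 0 j) ∨
    ∃ k ∈ J, p = gSeq q m s F b1 k}

/-- A transcendence basis of `S`. -/
noncomputable def xiSys (q m s : ℕ) (F : Type*) [Field F] (b1 : MvPolynomial (OIdx m) F) (l : ℕ) :
    Option (Fin (2 * m)) → MvPolynomial (OIdx m) F
  | none => gSeq q m s F b1 l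
  | some j => if (j : ℕ) = 0 then xiZero m F else gram q (genVec m F) 0 j

section Gens

variable {q m s : ℕ} {F : Type*} [Field F] {b1 : MvPolynomial (OIdx m) F} {J : Set ℕ}

lemma xiZero_mem_subGen : xiZero m F ∈ subGen q m s F b1 J :=
  Algebra.subset_adjoin (Or.inl rfl)

lemma gram_mem_subGen {j : ℕ} (hj : j < 2 * m) :
    gram q (genVec m F) 0 j ∈ subGen q m s F b1 J :=
  Algebra.subset_adjoin (Or.inr (Or.inl ⟨j, hj, rfl⟩))

lemma gSeq_mem_subGen {k : ℕ} (hk : k ∈ J) : gSeq q m s F b1 k ∈ subGen q m s F b1 J :=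
  Algebra.subset_adjoin (Or.inr (Or.inr ⟨k, hk, rfl⟩))

lemma evXi_mem_subGen (P : MvPolynomial ℕ F) : evXi q m F P ∈ subGen q m s F b1 J :=
  range_evXi_le (fun _ hj => gram_mem_subGen hj) ⟨P, rfl⟩

lemma subGen_le {E : Subalgebra F (MvPolynomial (OIdx m) F)} (h0 : xiZero m F ∈ E)
    (hξ : ∀ j < 2 * m, gram q (genVec m F) 0 j ∈ E) (hg : ∀ k ∈ J, gSeq q m s F b1 k ∈ E) :
    subGen q m s F b1 J ≤ E := by
  rw [subGen, Algebra.adjoin_le_iff]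
  rintro p (rfl | ⟨j, hj, rfl⟩ | ⟨k, hk, rfl⟩)
  exacts [h0, hξ j hj, hg k hk]

lemma adjoin_xiSys [CharP F 2] (hm : 1 ≤ m) (l : ℕ) :
    Algebra.adjoin F (Set.range (xiSys q m s F b1 l)) = subGen q m s F b1 {l} := by
  apply le_antisymm
  · rw [Algebra.adjoin_le_iff]
    rintro _ ⟨i, rfl⟩
    rcases i with _ | j
    · exact gSeq_mem_subGen rfl
    · rw [xiSys]
      split_ifs
      · exact xiZero_mem_subGen
      · exact gram_mem_subGen j.2
  · refine subGen_le ?_ (fun j hj => ?_) ?_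
    · exact Algebra.subset_adjoin ⟨some ⟨0, by omega⟩, by simp [xiSys]⟩
    · rcases eq_or_ne j 0 with rfl | hj0
      · rw [gram_self]
        exact zero_mem _
      · exact Algebra.subset_adjoin ⟨some ⟨j, hj⟩, by simp [xiSys, hj0]⟩
    · rintro k rfl
      exact Algebra.subset_adjoin ⟨none, rfl⟩

end Gens

section Transcendence

variable {q m s : ℕ} {F : Type*} [Field F] [Fintype F] [CharP F 2] {b1 : MvPolynomial (OIdx m) F}

lemma isIntegral_subGen (H : OrthData q m s F b1) (f : MvPolynomial (OIdx m) F) :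
    IsIntegral (subGen q m s F b1 (Set.Iio (2 * m - 1))) f :=
  isIntegral_of_gens H xiZero_mem_subGen (fun _ => gram_mem_subGen)
    (fun _ hk => gSeq_mem_subGen hk) f

lemma gpf_erase_mem_subGen {J : Set ℕ} (hq : q = 2 ^ s) (l : ℕ) :
    gpf q m F ((Finset.range (2 * m - 1)).erase l) ∈ subGen q m s F b1 J :=
  range_evXi_le (fun _ => gram_mem_subGen) (gpf_mem_range hq fun i hi => by
    have := Finset.mem_range.1 (Finset.mem_of_mem_erase hi)
    omega)

lemma exists_pow_mul_mem_subGen (H : OrthData q m s F b1) {l : ℕ} (hl : l < 2 * m - 1)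
    {a : MvPolynomial (OIdx m) F} (ha : a ∈ subGen q m s F b1 (Set.Iio (2 * m - 1))) :
    ∃ N, (gpf q m F ((Finset.range (2 * m - 1)).erase l) ^ 2 ^ (s - 1)) ^ N * a
      ∈ subGen q m s F b1 {l} := by
  have hκ := gpf_erase_mem_subGen (b1 := b1) (J := {l}) H.hq (m := m) (F := F)
  refine exists_pow_mul_mem_of_adjoin (pow_mem (hκ l) _) ?_ ha
  rintro p (rfl | ⟨j, hj, rfl⟩ | ⟨k, hk, rfl⟩)
  · exact ⟨0, by simpa using xiZero_mem_subGen⟩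
  · exact ⟨0, by simpa using gram_mem_subGen hj⟩
  · refine ⟨1, ?_⟩
    have h1 := range_evXi_le (E := subGen q m s F b1 {l}) (fun _ => gram_mem_subGen)
      (gSeq_cramer_mem H.hs H.hm H.hq H.h2 H.hF H.hb1 hk hl)
    rw [pow_one]
    exact (add_mem_cancel_right (mul_mem (pow_mem (hκ k) _) (gSeq_mem_subGen rfl))).1 h1

lemma exists_pow_mul_isIntegral_subGen (H : OrthData q m s F b1) {l : ℕ} (hl : l < 2 * m - 1)
    (f : MvPolynomial (OIdx m) F) :
    ∃ N, IsIntegral (subGen q m s F b1 {l})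
      ((gpf q m F ((Finset.range (2 * m - 1)).erase l) ^ 2 ^ (s - 1)) ^ N * f) :=
  exists_pow_mul_isIntegral (pow_mem (gpf_erase_mem_subGen H.hq l) _)
    (fun _ => exists_pow_mul_mem_subGen H hl) (isIntegral_subGen H f)

lemma algebraicIndependent_xiSys (H : OrthData q m s F b1) {l : ℕ} (hl : l < 2 * m - 1)
    (hκ : gpf q m F ((Finset.range (2 * m - 1)).erase l) ≠ 0) :
    AlgebraicIndependent F (xiSys q m s F b1 l) := by
  have hm := H.hm
  have hκ' : gpf q m F ((Finset.range (2 * m - 1)).erase l) ^ 2 ^ (s - 1) ≠ 0 := pow_ne_zero _ hκ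
  have halg : Algebra.IsAlgebraic (Algebra.adjoin F (Set.range (xiSys q m s F b1 l)))
      (MvPolynomial (OIdx m) F) := by
    rw [adjoin_xiSys (by omega)]
    refine ⟨fun f => ?_⟩
    obtain ⟨N, hN⟩ := exists_pow_mul_isIntegral_subGen H hl f
    set κ := gpf q m F ((Finset.range (2 * m - 1)).erase l) ^ 2 ^ (s - 1) with hκd
    have hmem : κ ^ N ∈ subGen q m s F b1 {l} :=
      pow_mem (pow_mem (gpf_erase_mem_subGen H.hq l) _) _
    refine IsAlgebraic.of_mul (y := κ ^ N) (z := f) ?_ ?_ ?_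
    · exact mem_nonZeroDivisors_of_ne_zero (pow_ne_zero _ hκ')
    · exact isAlgebraic_algebraMap (R := subGen q m s F b1 {l}) ⟨_, hmem⟩
    · exact hN.isAlgebraic
  refine (Algebra.IsAlgebraic.isTranscendenceBasis_of_lift_le_trdeg_of_finite F _ ?_).1
  rw [MvPolynomial.trdeg_of_isDomain]
  simp only [Cardinal.mk_fintype, Fintype.card_option, Fintype.card_fin, Fintype.card_sum,
    Cardinal.lift_natCast]
  exact_mod_cast (by omega : 2 * m + 1 ≤ m + m + 1)

lemma truncHom_eq_zero_of_evXi (H : OrthData q m s F b1) {P : MvPolynomial ℕ F}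
    (hP : evXi q m F P = 0) : truncHom m F P = 0 := by
  have hm := H.hm
  have hκ : gpf q m F ((Finset.range (2 * m - 1)).erase (2 * m - 2)) ≠ 0 := by
    have : (Finset.range (2 * m - 1)).erase (2 * m - 2) = Finset.range (2 * m - 2) := by
      ext i
      simp only [Finset.mem_erase, Finset.mem_range]
      omega
    rw [this]
    exact gpf_range_sub_two_ne_zero H.hF (by omega)
  have hx := algebraicIndependent_xiSys H (l := 2 * m - 2) (by omega) hκ
  let τ : MvPolynomial ℕ F →ₐ[F] MvPolynomial (Option (Fin (2 * m))) F :=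
    aeval fun j => if h : 1 ≤ j ∧ j < 2 * m then X (some ⟨j, h.2⟩) else 0
  let σ : MvPolynomial (Option (Fin (2 * m))) F →ₐ[F] MvPolynomial ℕ F :=
    aeval fun i => i.elim 0 fun j => X (j : ℕ)
  have h1 : (aeval (xiSys q m s F b1 (2 * m - 2))).comp τ = evXi q m F := by
    refine MvPolynomial.algHom_ext fun j => ?_
    simp only [AlgHom.comp_apply, τ, aeval_X, evXi]
    rcases j.eq_zero_or_pos with rfl | hj
    · simp [gram_self]
    · by_cases hj2 : j < 2 * m
      · simp [hj2, Nat.one_le_iff_ne_zero.2 hj.ne', xiSys, hj.ne']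
      · simp [hj2]
  have h2 : σ.comp τ = truncHom m F := by
    refine MvPolynomial.algHom_ext fun j => ?_
    simp only [AlgHom.comp_apply, τ, aeval_X, truncHom]
    split_ifs
    · simp [σ]
    · simp
  have h3 : τ P = 0 := by
    refine (algebraicIndependent_iff.1 hx) _ ?_
    rw [← hP, ← h1]
    rfl
  rw [← h2, AlgHom.comp_apply, h3, map_zero]

/-- Only `e_1, …, e_m` are needed among the `e_i`. -/
lemma subGen_Iio_eq (H : OrthData q m s F b1) :
    subGen q m s F b1 (Set.Iio (2 * m - 1)) = subGen q m s F b1 (Set.Icc (m - 1) (2 * m - 2)) := by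
  have hm := H.hm
  apply le_antisymm
  · refine subGen_le xiZero_mem_subGen (fun _ => gram_mem_subGen) fun k (hk : k < _) => ?_
    by_cases hk2 : k < m - 1
    · obtain ⟨R, α, h⟩ := exists_gSeq_eq H.hs H.hm H.hq H.h2 H.hF H.hb1
        (fun _ => truncHom_eq_zero_of_evXi H) hk2
      rw [h]
      exact add_mem (evXi_mem_subGen _) (sum_mem fun l hl => mul_mem (evXi_mem_subGen _)
        (gSeq_mem_subGen (by simpa using hl)))
    · exact gSeq_mem_subGen ⟨by omega, by omega⟩
  · refine subGen_le xiZero_mem_subGen (fun _ => gram_mem_subGen) fun k hk => ?_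
    exact gSeq_mem_subGen (lt_of_le_of_lt hk.2 (by omega))

end Transcendence

lemma MvPolynomial.coeff_two_nsmul_sq {σ R : Type*} [CommRing R] [CharP R 2]
    (p : MvPolynomial σ R) (d : σ →₀ ℕ) : (p ^ 2).coeff (2 • d) = p.coeff d ^ 2 := by
  have : ExpChar R 2 := ExpChar.prime Nat.prime_two
  rw [← MvPolynomial.map_frobenius_expand, MvPolynomial.coeff_map,
    MvPolynomial.coeff_expand_smul _ two_ne_zero]
  rfl

section SqRoot

variable {σ F : Type*} [Field F] [CharP F 2]

lemma MvPolynomial.IsHomogeneous.of_sq {p : MvPolynomial σ F} {n : ℕ}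
    (h : (p ^ 2).IsHomogeneous (2 * n)) : p.IsHomogeneous n := by
  intro d hd
  have h1 : (p ^ 2).coeff (2 • d) ≠ 0 := by
    rw [coeff_two_nsmul_sq]
    exact pow_ne_zero _ hd
  have h2 := h h1
  rw [map_nsmul, smul_eq_mul] at h2
  omega

lemma MvPolynomial.mem_supported_of_sq {p : MvPolynomial σ F} {s : Set σ}
    (h : p ^ 2 ∈ supported F s) : p ∈ supported F s := by
  rw [mem_supported] at h ⊢
  intro i hi
  obtain ⟨d, hd, hid⟩ := (mem_vars_iff_mem_support i).1 hi
  refine h ((mem_vars_iff_mem_support i).2 ⟨2 • d, ?_, ?_⟩)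
  · rw [mem_support_iff, coeff_two_nsmul_sq]
    exact pow_ne_zero _ (mem_support_iff.1 hd)
  · simpa using hid

end SqRoot

lemma MvPolynomial.IsHomogeneous.exists_eq_linear {σ F : Type*} [Fintype σ] [Field F]
    {p : MvPolynomial σ F} (h : p.IsHomogeneous 1) : ∃ c : σ → F, p = ∑ i, C (c i) * X i := by
  have h1 : p ∈ Submodule.span F (Set.range (X : σ → MvPolynomial σ F)) := by
    rw [← homogeneousSubmodule_one_eq_span_X]
    exact h
  obtain ⟨c, rfl⟩ := (Submodule.mem_span_range_iff_exists_fun F).1 h1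
  exact ⟨c, Finset.sum_congr rfl fun i _ => smul_eq_C_mul _ _⟩

lemma pf_mem {R S : Type*} [CommRing R] [CommRing S] [Algebra R S] {E : Subalgebra R S}
    {N : ℕ → ℕ → S} (h : ∀ a b, N a b ∈ E) (T : Finset ℕ) : pf N T ∈ E :=
  sum_mem fun _ _ => prod_mem fun _ _ => h _ _

lemma gram_mem {R S : Type*} [CommRing R] [CommRing S] [Algebra R S] {E : Subalgebra R S}
    {q m : ℕ} {v : Fin m ⊕ Fin m → S} (h : ∀ i, v i ∈ E) (a b : ℕ) : gram q v a b ∈ E := by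
  rw [gram, bform_apply]
  exact sum_mem fun j _ => add_mem (mul_mem (pow_mem (h _) _) (pow_mem (h _) _))
    (mul_mem (pow_mem (h _) _) (pow_mem (h _) _))

lemma dickP_coeff_mem_of_X_mem {m : ℕ} {F : Type*} [Field F] [Fintype F]
    {E : Subalgebra F (MvPolynomial (OIdx m) F)} (h : ∀ i, X (some i) ∈ E) (n : ℕ) :
    (dickP m F).coeff n ∈ E := by
  have h1 : dickP m F ∈ Polynomial.lifts (algebraMap E (MvPolynomial (OIdx m) F)) := by
    refine prod_mem fun c _ => add_mem (Polynomial.X_mem_lifts _) (Polynomial.C'_mem_lifts ?_)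
    exact ⟨⟨∑ i, C (c i) * X (some i),
      sum_mem fun i _ => mul_mem (E.algebraMap_mem (c i)) (h i)⟩, rfl⟩
  obtain ⟨y, hy⟩ := (Polynomial.lifts_iff_coeff_lifts _).1 h1 n
  rw [← hy]
  exact y.2

section

variable {q m s : ℕ} {F : Type*} [Field F] [Fintype F] [CharP F 2] {b1 : MvPolynomial (OIdx m) F}

/-- The polynomial `b_1` does not involve `z`. -/
lemma b1_mem_supported (H : OrthData q m s F b1) : b1 ∈ supported F (Set.range some) := by
  set E := supported F (Set.range (some : Fin m ⊕ Fin m → OIdx m))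
  have hX : ∀ i, (X (some i) : MvPolynomial (OIdx m) F) ∈ E := fun i =>
    X_mem_supported.2 ⟨i, rfl⟩
  have hg : ∀ T, natSum q m F T ∈ E := fun T => by
    rw [natSum_eq_gpf H.hq]
    exact pf_mem (gram_mem hX) T
  refine mem_supported_of_sq ?_
  rw [H.hb1]
  refine add_mem (dickP_coeff_mem_of_X_mem hX _) (mul_mem (pow_mem (hg _) _) (add_mem ?_
    (mul_mem (sum_mem fun j _ => mul_mem (hX _) (hX _)) (pow_mem (hg _) _))))
  refine sum_mem fun j _ => sum_mem fun k _ => ?_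
  split_ifs
  · rw [← gram_zero_left, ← gram_zero_left]
    exact mul_mem (mul_mem (gram_mem hX _ _) (gram_mem hX _ _)) (hg _)
  · exact zero_mem _

end

/-- The fraction field of a subalgebra, inside a field containing the ambient ring. -/
noncomputable abbrev fracSub {F S : Type*} [Field F] [CommRing S] [Algebra F S] (L : Type*)
    [Field L] [Algebra F L] [Algebra S L] (E : Subalgebra F S) : IntermediateField F L :=
  IntermediateField.adjoin F (algebraMap S L '' E)

lemma algebraMap_mem_fracSub {F S : Type*} [Field F] [CommRing S] [Algebra F S] (L : Type*)
    [Field L] [Algebra F L] [Algebra S L] {E : Subalgebra F S} {a : S} (ha : a ∈ E) :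
    algebraMap S L a ∈ fracSub L E :=
  IntermediateField.subset_adjoin _ _ ⟨a, ha, rfl⟩

lemma mem_fracSub_iff {F S L : Type*} [Field F] [CommRing S] [IsDomain S] [Algebra F S] [Field L]
    [Algebra F L] [Algebra S L] [IsScalarTower F S L] [FaithfulSMul S L] {E : Subalgebra F S}
    {x : L} : x ∈ fracSub L E ↔
      ∃ a ∈ E, ∃ b ∈ E, b ≠ 0 ∧ algebraMap S L b * x = algebraMap S L a := by
  have h1 : Algebra.adjoin F (algebraMap S L '' E) = E.map (IsScalarTower.toAlgHom F S L) := by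
    rw [show algebraMap S L '' (E : Set S) = ((E.map (IsScalarTower.toAlgHom F S L) :
      Subalgebra F L) : Set L) from rfl, Algebra.adjoin_eq]
  have hinj := FaithfulSMul.algebraMap_injective S L
  constructor
  · intro hx
    obtain ⟨r, hr, t, ht, rfl⟩ := IntermediateField.mem_adjoin_iff_div.1 hx
    rw [h1] at hr ht
    obtain ⟨a, ha, rfl⟩ := hr
    obtain ⟨b, hb, rfl⟩ := ht
    rcases eq_or_ne b 0 with rfl | hb0
    · exact ⟨0, zero_mem _, 1, one_mem _, one_ne_zero, by simp⟩
    · refine ⟨a, ha, b, hb, hb0, mul_div_cancel₀ _ ?_⟩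
      exact (map_ne_zero_iff _ hinj).2 hb0
  · rintro ⟨a, ha, b, hb, hb0, h⟩
    have hb' : algebraMap S L b ≠ 0 := (map_ne_zero_iff _ hinj).2 hb0
    rw [mul_comm, ← eq_div_iff hb'] at h
    rw [h]
    exact div_mem (algebraMap_mem_fracSub L ha) (algebraMap_mem_fracSub L hb)

section Galois

variable {q m s : ℕ} {F : Type*} [Field F] [Fintype F] [CharP F 2] {b1 : MvPolynomial (OIdx m) F}
  {L : Type*} [Field L] [Algebra F L] [Algebra (MvPolynomial (OIdx m) F) L]
  {E : Subalgebra F (MvPolynomial (OIdx m) F)}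

/-- The Dickson polynomial over the fraction field of `E`. -/
lemma exists_map_eq_dickP (hc : ∀ n, (dickP m F).coeff n ∈ E) :
    ∃ p : Polynomial (fracSub L E), p.map (algebraMap (fracSub L E) L)
      = ∏ c : Fin m ⊕ Fin m → F,
        (Polynomial.X - Polynomial.C (algebraMap (MvPolynomial (OIdx m) F) L (linForm c))) := by
  have h1 : (dickP m F).map (algebraMap (MvPolynomial (OIdx m) F) L)
      ∈ Polynomial.lifts (algebraMap (fracSub L E) L) := by
    rw [Polynomial.lifts_iff_coeff_lifts]
    intro n
    rw [Polynomial.coeff_map]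
    exact ⟨⟨_, algebraMap_mem_fracSub L (hc n)⟩, rfl⟩
  obtain ⟨p, hp⟩ := Polynomial.mem_lifts _ |>.1 h1
  refine ⟨p, hp.trans ?_⟩
  have : CharP L 2 := charP_of_injective_algebraMap (algebraMap F L).injective 2
  rw [dickP, Polynomial.map_prod]
  refine Finset.prod_congr rfl fun c _ => ?_
  rw [Polynomial.map_add, Polynomial.map_X, Polynomial.map_C, CharTwo.sub_eq_add]
  rfl

variable [IsScalarTower F (MvPolynomial (OIdx m) F) L]
  [IsFractionRing (MvPolynomial (OIdx m) F) L]

lemma z_mem_of_X_mem (H : OrthData q m s F b1) {M : Subfield L}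
    (hF : ∀ a, algebraMap F L a ∈ M)
    (hX : ∀ i, algebraMap (MvPolynomial (OIdx m) F) L (X (some i)) ∈ M)
    (he : algebraMap _ L (gSeq q m s F b1 (2 * m - 2)) ∈ M) :
    algebraMap (MvPolynomial (OIdx m) F) L (X none) ∈ M := by
  have hm := H.hm
  let T : Subalgebra F (MvPolynomial (OIdx m) F) :=
    { (M.toSubring.comap (algebraMap (MvPolynomial (OIdx m) F) L)).toSubsemiring with
      algebraMap_mem' := fun r => by
        have := hF r
        rwa [IsScalarTower.algebraMap_apply F (MvPolynomial (OIdx m) F) L] at this }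
  have hT : ∀ f, f ∈ T ↔ algebraMap _ L f ∈ M := fun f => Iff.rfl
  have hXT : ∀ i, X (some i) ∈ T := hX
  have hg : ∀ U, gpf q m F U ∈ T := pf_mem (gram_mem hXT)
  have hb : b1 ∈ T := by
    have hle : supported F (Set.range (some : Fin m ⊕ Fin m → OIdx m)) ≤ T := by
      rw [supported, Algebra.adjoin_le_iff]
      rintro _ ⟨_, ⟨i, rfl⟩, rfl⟩
      exact hXT i
    exact hle (b1_mem_supported H)
  set c := gpf q m F (Finset.range (2 * m)) ^ (2 ^ (s - 1) - 1)
    * gpf q m F (Finset.range (2 * m - 2)) ^ 2 ^ (s - 1) with hc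
  have hc0 : c ≠ 0 := mul_ne_zero (pow_ne_zero _ (gpf_range_ne_zero H.hF))
    (pow_ne_zero _ (gpf_range_sub_two_ne_zero H.hF (by omega)))
  have hcT : c ∈ T := mul_mem (pow_mem (hg _) _) (pow_mem (hg _) _)
  have h1 : gSeq q m s F b1 (2 * m - 2) = c * X none + b1 := by
    rw [gSeq, if_neg (by omega), Nat.sub_self, eSeq, uM, uM1, natSum_eq_gpf H.hq,
      natSum_eq_gpf H.hq]
  have h2 : c * X none ∈ T := by
    rw [← add_sub_cancel_right (c * X none) b1, ← h1]
    exact sub_mem ((hT _).2 he) hb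
  have h3 := (hT _).1 h2
  rw [map_mul] at h3
  have h4 : algebraMap _ L c ≠ 0 := (map_ne_zero_iff _ (IsFractionRing.injective _ L)).2 hc0
  rw [← inv_mul_cancel_left₀ h4 (algebraMap _ L (X none))]
  exact mul_mem (inv_mem hcT) h3

lemma adjoin_X_some_eq_top (H : OrthData q m s F b1) (he : gSeq q m s F b1 (2 * m - 2) ∈ E) :
    IntermediateField.adjoin (fracSub L E)
      (Set.range fun i => algebraMap (MvPolynomial (OIdx m) F) L (X (some i))) = ⊤ := by
  set M := IntermediateField.adjoin (fracSub L E)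
      (Set.range fun i => algebraMap (MvPolynomial (OIdx m) F) L (X (some i)))
  have hK : ∀ x ∈ fracSub L E, x ∈ M := fun x hx => M.algebraMap_mem ⟨x, hx⟩
  have hX : ∀ i, algebraMap (MvPolynomial (OIdx m) F) L (X (some i)) ∈ M := fun i =>
    IntermediateField.subset_adjoin _ _ ⟨i, rfl⟩
  have hFM : ∀ a, algebraMap F L a ∈ M := fun a => hK _ ((fracSub L E).algebraMap_mem a)
  have hz := z_mem_of_X_mem (M := M.toSubfield) H hFM hX (hK _ (algebraMap_mem_fracSub L he))
  have hS : ∀ f, algebraMap (MvPolynomial (OIdx m) F) L f ∈ M := fun f => by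
    induction f using MvPolynomial.induction_on with
    | C a =>
      have := hFM a
      rwa [IsScalarTower.algebraMap_apply F (MvPolynomial (OIdx m) F) L] at this
    | add p p' h h' =>
      rw [map_add]
      exact add_mem h h'
    | mul_X p i h =>
      rw [map_mul]
      rcases i with _ | i
      · exact mul_mem h hz
      · exact mul_mem h (hX i)
  refine eq_top_iff.2 fun x _ => ?_
  obtain ⟨a, b, -, rfl⟩ := IsFractionRing.div_surjective (A := MvPolynomial (OIdx m) F) x
  exact div_mem (hS a) (hS b)

lemma isGalois_fracSub (H : OrthData q m s F b1) (hc : ∀ n, (dickP m F).coeff n ∈ E)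
    (he : gSeq q m s F b1 (2 * m - 2) ∈ E) :
    IsGalois (fracSub L E) L ∧ FiniteDimensional (fracSub L E) L := by
  obtain ⟨p, hp⟩ := exists_map_eq_dickP (L := L) hc
  have hsep : p.Separable := by
    rw [← Polynomial.separable_map (algebraMap (fracSub L E) L), hp,
      Polynomial.separable_prod_X_sub_C_iff]
    exact (IsFractionRing.injective _ L).comp linForm_injective
  have hsplit : p.IsSplittingField (fracSub L E) L := by
    rw [isSplittingField_iff_intermediateField]
    refine ⟨?_, ?_⟩
    · rw [hp]
      exact Polynomial.Splits.prod fun c _ => Polynomial.Splits.X_sub_C _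
    · rw [eq_top_iff, ← adjoin_X_some_eq_top H he]
      refine IntermediateField.adjoin.mono _ _ _ ?_
      rintro _ ⟨i, rfl⟩
      refine Polynomial.mem_rootSet'.2 ⟨Polynomial.map_ne_zero hsep.ne_zero, ?_⟩
      rw [Polynomial.aeval_def, ← Polynomial.eval_map, hp, Polynomial.eval_prod]
      refine Finset.prod_eq_zero (Finset.mem_univ (Pi.single i 1)) ?_
      rw [linForm, Finset.sum_eq_single i (fun j _ hj => by simp [hj]) (by simp)]
      simp
  exact ⟨IsGalois.of_separable_splitting_field hsep,
    Polynomial.IsSplittingField.finiteDimensional L p⟩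

end Galois

lemma linForm_isHomogeneous {m : ℕ} {F : Type*} [Field F] (c : Fin m ⊕ Fin m → F) :
    (linForm c).IsHomogeneous 1 :=
  IsHomogeneous.sum _ _ _ fun i _ => by simpa using (isHomogeneous_C _ (c i)).mul (isHomogeneous_X F (some i))

lemma coeff_single_sum_C_mul_X {σ F : Type*} [Fintype σ] [Field F] (v : σ → F) (i : σ) :
    (∑ j, C (v j) * X j : MvPolynomial σ F).coeff (Finsupp.single i 1) = v i := by
  simp [coeff_sum, coeff_C_mul, coeff_X, Finsupp.single_left_inj]

section Galois

variable {q m s : ℕ} {F : Type*} [Field F] [Fintype F] [CharP F 2]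
  {L : Type*} [Field L] [Algebra F L] [Algebra (MvPolynomial (OIdx m) F) L]
  {E : Subalgebra F (MvPolynomial (OIdx m) F)}

lemma exists_linForm_of_aut (hc : ∀ n, (dickP m F).coeff n ∈ E)
    (σ : Gal(L/fracSub L E)) (i : Fin m ⊕ Fin m) : ∃ c : Fin m ⊕ Fin m → F,
      σ (algebraMap (MvPolynomial (OIdx m) F) L (X (some i)))
        = algebraMap (MvPolynomial (OIdx m) F) L (linForm c) := by
  obtain ⟨p, hp⟩ := exists_map_eq_dickP (L := L) hc
  set x := algebraMap (MvPolynomial (OIdx m) F) L (X (some i))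
  have h1 : Polynomial.aeval x p = 0 := by
    rw [Polynomial.aeval_def, ← Polynomial.eval_map, hp, Polynomial.eval_prod]
    refine Finset.prod_eq_zero (Finset.mem_univ (Pi.single i 1)) ?_
    rw [linForm, Finset.sum_eq_single i (fun j _ hj => by simp [hj]) (by simp)]
    simp [x]
  have h2 : Polynomial.aeval (σ x) p = 0 := by
    rw [Polynomial.aeval_algEquiv, AlgHom.comp_apply, h1]
    exact map_zero _
  rw [Polynomial.aeval_def, ← Polynomial.eval_map, hp, Polynomial.eval_prod,
    Finset.prod_eq_zero_iff] at h2
  obtain ⟨c, -, hc⟩ := h2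
  rw [Polynomial.eval_sub, Polynomial.eval_X, Polynomial.eval_C, sub_eq_zero] at hc
  exact ⟨c, hc⟩

variable [IsScalarTower F (MvPolynomial (OIdx m) F) L] [IsFractionRing (MvPolynomial (OIdx m) F) L]

lemma exists_linear_of_aut (hc : ∀ n, (dickP m F).coeff n ∈ E) (h0 : xiZero m F ∈ E)
    (σ : Gal(L/fracSub L E)) (i : OIdx m) : ∃ c : OIdx m → F,
      σ (algebraMap (MvPolynomial (OIdx m) F) L (X i))
        = algebraMap (MvPolynomial (OIdx m) F) L (∑ j, C (c j) * X j) := by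
  rcases i with _ | i
  · choose c hcc using exists_linForm_of_aut hc σ
    have hchar : CharP L 2 := charP_of_injective_algebraMap (algebraMap F L).injective 2
    have h1 : (X none : MvPolynomial (OIdx m) F) ^ 2 = xiZero m F
        + ∑ j : Fin m, X (some (Sum.inr j)) * X (some (Sum.inl j)) := by
      rw [xiZero, add_assoc, CharTwo.add_self_eq_zero, add_zero]
    set Q : MvPolynomial (OIdx m) F := xiZero m F
      + ∑ j : Fin m, linForm (c (Sum.inr j)) * linForm (c (Sum.inl j)) with hQ
    have h2 : σ (algebraMap (MvPolynomial (OIdx m) F) L (X none)) ^ 2 = algebraMap (MvPolynomial (OIdx m) F) L Q := by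
      rw [← map_pow, ← map_pow, h1, hQ, map_add, map_add, map_add, map_sum, map_sum, map_sum]
      refine congrArg₂ (· + ·) ?_ (Finset.sum_congr rfl fun j _ => ?_)
      · exact σ.commutes ⟨_, algebraMap_mem_fracSub L h0⟩
      · rw [map_mul, map_mul, map_mul, hcc, hcc]
    obtain ⟨y, hy⟩ := IsIntegrallyClosed.exists_algebraMap_eq_of_isIntegral_pow
      (R := MvPolynomial (OIdx m) F) (x := σ (algebraMap (MvPolynomial (OIdx m) F) L (X none))) two_pos
      (by rw [h2]; exact isIntegral_algebraMap)
    have h3 : y ^ 2 = Q := by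
      refine IsFractionRing.injective (MvPolynomial (OIdx m) F) L ?_
      rw [map_pow, hy, h2]
    have h4 : Q.IsHomogeneous (2 * 1) := by
      refine (IsHomogeneous.add ?_ ?_).add ?_
      · exact isHomogeneous_X_pow _ _
      · exact IsHomogeneous.sum _ _ _ fun j _ => (isHomogeneous_X F _).mul (isHomogeneous_X F _)
      · exact IsHomogeneous.sum _ _ _ fun j _ =>
          (linForm_isHomogeneous _).mul (linForm_isHomogeneous _)
    rw [← h3] at h4
    obtain ⟨d, rfl⟩ := h4.of_sq.exists_eq_linear
    exact ⟨d, hy.symm⟩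
  · obtain ⟨c, h⟩ := exists_linForm_of_aut hc σ i
    refine ⟨fun j => j.elim 0 c, h.trans ?_⟩
    simp [linForm, Fintype.sum_option]

/-- Automorphisms over the fraction field of `E` come from orthogonal transformations. -/
lemma exists_act_eq_aut (hc : ∀ n, (dickP m F).coeff n ∈ E) (h0 : xiZero m F ∈ E)
    (σ : Gal(L/fracSub L E)) : ∃ g : (OIdx m → F) ≃ₗ[F] (OIdx m → F),
      act g (xiZero m F) = xiZero m F ∧
      ∀ f, σ (algebraMap (MvPolynomial (OIdx m) F) L f) = algebraMap _ L (act g f) := by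
  choose c hcc using exists_linear_of_aut hc h0 σ
  let φ : MvPolynomial (OIdx m) F →ₐ[F] MvPolynomial (OIdx m) F :=
    aeval fun i => ∑ j, C (c i j) * X j
  have hφ : ∀ f, σ (algebraMap (MvPolynomial (OIdx m) F) L f) = algebraMap _ L (φ f) := by
    intro f
    induction f using MvPolynomial.induction_on with
    | C a =>
      have h1 : algebraMap (MvPolynomial (OIdx m) F) L (C a)
          = algebraMap (fracSub L E) L (algebraMap F _ a) := by
        rw [← IsScalarTower.algebraMap_apply, IsScalarTower.algebraMap_apply F
          (MvPolynomial (OIdx m) F) L]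
        rfl
      have h2 : φ (C a) = C a := φ.commutes a
      rw [h2, h1, σ.commutes]
    | add p p' h h' => rw [map_add, map_add, map_add, map_add, h, h']
    | mul_X p i h =>
      rw [map_mul, map_mul, map_mul, map_mul, h, hcc]
      simp only [φ, aeval_X]
  have hinj : Function.Injective φ := fun f f' h => by
    refine IsFractionRing.injective (MvPolynomial (OIdx m) F) L (σ.injective ?_)
    rw [hφ, hφ, h]
  let M : Matrix (OIdx m) (OIdx m) F := Matrix.of c
  have hM : Function.Injective (Matrix.vecMulLinear M) := by
    rw [injective_iff_map_eq_zero]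
    intro v hv
    have h1 : φ (∑ i, C (v i) * X i) = 0 := by
      have h2 : φ (∑ i, C (v i) * X i) = ∑ j, C ((Matrix.vecMul v M) j) * X j := by
        rw [map_sum]
        simp only [map_mul, φ, aeval_X, algHom_C, Matrix.vecMul, dotProduct, M, Matrix.of_apply,
          map_sum, Finset.sum_mul, Finset.mul_sum]
        rw [Finset.sum_comm]
        simp only [algebraMap_eq, mul_assoc]
      have h3 : Matrix.vecMul v M = 0 := hv
      rw [h2, h3]
      simp
    have h2 := hinj (h1.trans (map_zero φ).symm)
    ext i
    rw [← coeff_single_sum_C_mul_X v i, h2]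
    rfl
  have hunit : IsUnit M := Matrix.vecMul_injective_iff_isUnit.1 hM
  have hdet : IsUnit M.det := (Matrix.isUnit_iff_isUnit_det M).1 hunit
  refine ⟨Matrix.toLin'OfInv (Matrix.nonsing_inv_mul M hdet) (Matrix.mul_nonsing_inv M hdet), ?_⟩
  have hact : act (Matrix.toLin'OfInv (Matrix.nonsing_inv_mul M hdet)
      (Matrix.mul_nonsing_inv M hdet)) = φ := by
    refine MvPolynomial.algHom_ext fun i => ?_
    simp only [act, φ, aeval_X, Matrix.toLin'OfInv_apply, Matrix.toLin'_apply,
      Matrix.mulVec_single_one]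
    rfl
  rw [hact]
  refine ⟨?_, hφ⟩
  refine IsFractionRing.injective (MvPolynomial (OIdx m) F) L ?_
  rw [← hφ]
  exact σ.commutes ⟨_, algebraMap_mem_fracSub L h0⟩

/-- Orthogonal invariants are quotients of elements of `E`. -/
lemma exists_mul_mem_of_invariant (L : Type*) [Field L] [Algebra F L]
    [Algebra (MvPolynomial (OIdx m) F) L]
    [IsScalarTower F (MvPolynomial (OIdx m) F) L]
    [IsFractionRing (MvPolynomial (OIdx m) F) L] {b1 : MvPolynomial (OIdx m) F}
    (H : OrthData q m s F b1)
    (hc : ∀ n, (dickP m F).coeff n ∈ E) (h0 : xiZero m F ∈ E)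
    (he : gSeq q m s F b1 (2 * m - 2) ∈ E) {f : MvPolynomial (OIdx m) F}
    (hf : ∀ g : (OIdx m → F) ≃ₗ[F] (OIdx m → F), act g (xiZero m F) = xiZero m F → act g f = f) :
    ∃ b ∈ E, b ≠ 0 ∧ b * f ∈ E := by
  obtain ⟨hG, hfin⟩ := isGalois_fracSub (L := L) H hc he
  obtain ⟨y, hy⟩ := (IsGalois.mem_range_algebraMap_iff_fixed
    (algebraMap (MvPolynomial (OIdx m) F) L f)).2 fun σ => by
      obtain ⟨g, hg, h⟩ := exists_act_eq_aut hc h0 σ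
      rw [h, hf g hg]
  obtain ⟨a, ha, b, hb, hb0, h⟩ := mem_fracSub_iff.1 y.2
  refine ⟨b, hb, hb0, ?_⟩
  have h1 : (y : L) = algebraMap _ L f := hy
  rw [h1, ← map_mul] at h
  rw [IsFractionRing.injective (MvPolynomial (OIdx m) F) L h]
  exact ha

end Galois

/-- A subring generated by algebraically independent elements is integrally closed. -/
lemma mem_adjoin_of_isIntegral_of_mul_mem {F S ι : Type*} [Field F] [CommRing S] [IsDomain S]
    [Algebra F S] {x : ι → S} (hx : AlgebraicIndependent F x) {b c : S}
    (hb : b ∈ Algebra.adjoin F (Set.range x)) (hb0 : b ≠ 0)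
    (hbc : b * c ∈ Algebra.adjoin F (Set.range x))
    (hc : IsIntegral (Algebra.adjoin F (Set.range x)) c) :
    c ∈ Algebra.adjoin F (Set.range x) := by
  set P := Algebra.adjoin F (Set.range x) with hP
  have hic : IsIntegrallyClosed P := IsIntegrallyClosed.of_equiv hx.aevalEquiv.toRingEquiv
  let L := FractionRing S
  have hinjS : Function.Injective (algebraMap S L) := IsFractionRing.injective S L
  have hinj : Function.Injective (algebraMap P L) := by
    rw [IsScalarTower.algebraMap_eq P S L]
    exact hinjS.comp Subtype.val_injective
  have : FaithfulSMul P L := (faithfulSMul_iff_algebraMap_injective P L).2 hinj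
  let _ : Algebra (FractionRing P) L := FractionRing.liftAlgebra P L
  have : IsScalarTower P (FractionRing P) L := inferInstance
  let k : FractionRing P := algebraMap P _ ⟨b * c, hbc⟩ / algebraMap P _ ⟨b, hb⟩
  have hk : algebraMap (FractionRing P) L k = algebraMap S L c := by
    simp only [k, map_div₀]
    rw [← IsScalarTower.algebraMap_apply, ← IsScalarTower.algebraMap_apply,
      IsScalarTower.algebraMap_apply P S L, IsScalarTower.algebraMap_apply P S L]
    change algebraMap S L (b * c) / algebraMap S L b = _
    rw [map_mul, mul_div_cancel_left₀]
    exact (map_ne_zero_iff _ hinjS).2 hb0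
  have hki : IsIntegral P k := by
    rw [← isIntegral_algebraMap_iff (algebraMap (FractionRing P) L).injective, hk]
    exact hc.algebraMap
  obtain ⟨p, hp⟩ := IsIntegrallyClosed.isIntegral_iff.1 hki
  have h1 : algebraMap S L (p : S) = algebraMap S L c := by
    rw [← hk, ← hp, ← IsScalarTower.algebraMap_apply, IsScalarTower.algebraMap_apply P S L]
    rfl
  rw [← hinjS h1]
  exact p.2

section Invariants

variable {q m s : ℕ} {F : Type*} [Field F] [Fintype F] {b1 : MvPolynomial (OIdx m) F}

/-- The algebra map fixing the scalars and sending each variable `X` to `X + X ^ q ^ d`. -/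
noncomputable def addFrob (q d : ℕ) (σ F : Type*) [Field F] :
    MvPolynomial σ F →ₐ[F] MvPolynomial σ F :=
  aeval fun i => X i + X i ^ q ^ d

lemma act_addFrob [CharP F 2] (hq : q = 2 ^ s) (hF : Fintype.card F = q) (d : ℕ)
    (g : (OIdx m → F) ≃ₗ[F] (OIdx m → F)) (f : MvPolynomial (OIdx m) F) :
    act g (addFrob q d _ F f) = addFrob q d _ F (act g f) := by
  refine DFunLike.congr_fun (f := (act g).comp (addFrob q d _ F))
    (g := (addFrob q d _ F).comp (act g)) (MvPolynomial.algHom_ext fun i => ?_) f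
  have hpow : ∀ a : F, a ^ q ^ d = a := fun a => by rw [← hF]; exact FiniteField.pow_card_pow d a
  simp only [AlgHom.comp_apply, addFrob, act, aeval_X, map_add, map_pow, map_sum, map_mul,
    algHom_C, algebraMap_eq]
  rw [sum_pow_pow_two hq, ← Finset.sum_add_distrib]
  refine Finset.sum_congr rfl fun j _ => ?_
  rw [mul_add, mul_pow, ← C_pow, hpow]

lemma addFrob_xiZero [CharP F 2] (hq : q = 2 ^ s) (d : ℕ) :
    addFrob q d _ F (xiZero m F)
      = xiZero m F + gram q (genVec m F) 0 d + xiZero m F ^ q ^ d := by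
  rw [gram_zero_left, xiGen]
  simp only [xiZero, addFrob, map_add, map_pow, map_sum, map_mul, aeval_X]
  rw [add_pow_pow_two hq d (X none ^ 2), sum_pow_pow_two hq, CharTwo.add_sq]
  have : ∀ j : Fin m, ((X (some (Sum.inr j)) + X (some (Sum.inr j)) ^ q ^ d)
      * (X (some (Sum.inl j)) + X (some (Sum.inl j)) ^ q ^ d) : MvPolynomial (OIdx m) F)
      = X (some (Sum.inr j)) * X (some (Sum.inl j)) + (X (some (Sum.inr j)) * X (some (Sum.inl j)) ^ q ^ d
        + X (some (Sum.inl j)) * X (some (Sum.inr j)) ^ q ^ d)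
        + (X (some (Sum.inr j)) * X (some (Sum.inl j))) ^ q ^ d := fun j => by ring
  rw [Finset.sum_congr rfl fun j _ => this j, Finset.sum_add_distrib, Finset.sum_add_distrib]
  ring

lemma act_gram_zero [CharP F 2] (hq : q = 2 ^ s) (hF : Fintype.card F = q)
    {g : (OIdx m → F) ≃ₗ[F] (OIdx m → F)} (hg : act g (xiZero m F) = xiZero m F) (d : ℕ) :
    act g (gram q (genVec m F) 0 d) = gram q (genVec m F) 0 d := by
  have h := act_addFrob (m := m) hq hF d g (xiZero m F)
  rw [hg, addFrob_xiZero hq, map_add, map_add, map_pow, hg] at h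
  exact add_left_cancel (add_right_cancel h)

lemma act_eq_of_mem_subGen [CharP F 2] (H : OrthData q m s F b1)
    {g : (OIdx m → F) ≃ₗ[F] (OIdx m → F)} (hg : act g (xiZero m F) = xiZero m F)
    {f : MvPolynomial (OIdx m) F} (hf : f ∈ subGen q m s F b1 (Set.Iio (2 * m - 1))) :
    act g f = f := by
  have hm := H.hm
  let E := AlgHom.equalizer (act g) (AlgHom.id F (MvPolynomial (OIdx m) F))
  have hE : ∀ {f}, f ∈ E ↔ act g f = f := Iff.rfl
  have hξ : ∀ d, gram q (genVec m F) 0 d ∈ E := fun d => hE.2 (act_gram_zero H.hq H.hF hg d)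
  have hN : ∀ a b, gram q (genVec m F) a b ∈ E := by
    have : ∀ a b, a ≤ b → gram q (genVec m F) a b ∈ E := fun a b hab => by
      obtain ⟨c, rfl⟩ := Nat.exists_eq_add_of_le' hab
      rw [gram_genVec H.hq, ← gram_zero_left]
      exact pow_mem (hξ c) _
    intro a b
    rcases le_total a b with h | h
    · exact this a b h
    · rw [gram_comm]; exact this b a h
  have hpf : ∀ T, gpf q m F T ∈ E := fun T => pf_mem hN T
  refine subGen_le (E := E) (hE.2 hg) (fun j _ => hξ j) (fun k (hk : k < _) => ?_) hf
  rw [gSeq, if_neg (by omega)]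
  have h := eSeq_star H.hs H.hm H.hq H.h2 H.hF H.hb1 (k := k + 1) (by omega) (by omega)
  rw [show 2 * m - 1 - (k + 1) = 2 * m - 2 - k by omega] at h
  have h1 : gpf q m F (Finset.range (2 * m)) * eSeq q m s F b1 (2 * m - 2 - k) ^ 2 ∈ E := by
    rw [h]
    refine add_mem (hpf _) (mul_mem (pow_mem (hpf _) _) ?_)
    exact quadPf_mem H.hq (hE.2 hg) (fun j _ => hξ j) fun i hi => by
      have := Finset.mem_Icc.1 (Finset.mem_of_mem_erase hi)
      omega
  rw [hE, map_mul, hE.1 (hpf _), map_pow] at h1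
  rw [hE]
  exact CharTwo.sq_injective (mul_left_cancel₀ (gpf_range_ne_zero H.hF) h1)

/-- Orthogonal invariants become elements of `subGen` after multiplication by a power of each of
the Pfaffians of order `2 * m - 2`. -/
lemma exists_pow_mul_mem_of_invariant [CharP F 2] (H : OrthData q m s F b1)
    {f : MvPolynomial (OIdx m) F}
    (hf : ∀ g : (OIdx m → F) ≃ₗ[F] (OIdx m → F), act g (xiZero m F) = xiZero m F → act g f = f)
    {l : ℕ} (hl : l < 2 * m - 1) :
    ∃ N, gpf q m F ((Finset.range (2 * m - 1)).erase l) ^ N * f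
      ∈ subGen q m s F b1 (Set.Iio (2 * m - 1)) := by
  have hm := H.hm
  by_cases hκ : gpf q m F ((Finset.range (2 * m - 1)).erase l) = 0
  · exact ⟨1, by rw [hκ, pow_one, zero_mul]; exact zero_mem _⟩
  set E := subGen q m s F b1 (Set.Iio (2 * m - 1)) with hE
  have hle : subGen q m s F b1 {l} ≤ E := subGen_le xiZero_mem_subGen
    (fun _ => gram_mem_subGen) fun k (hk : k = l) => gSeq_mem_subGen (hk ▸ hl)
  obtain ⟨b, hb, hb0, hbf⟩ := exists_mul_mem_of_invariant (E := E)
    (FractionRing (MvPolynomial (OIdx m) F)) H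
    (dickP_coeff_mem H xiZero_mem_subGen (fun _ => gram_mem_subGen) fun _ hk => gSeq_mem_subGen hk)
    xiZero_mem_subGen (gSeq_mem_subGen (by simp only [Set.mem_Iio]; omega)) hf
  set κ := gpf q m F ((Finset.range (2 * m - 1)).erase l) ^ 2 ^ (s - 1) with hκd
  have hκ' : κ ≠ 0 := pow_ne_zero _ hκ
  have hκmem : κ ∈ subGen q m s F b1 {l} := pow_mem (gpf_erase_mem_subGen H.hq l) _
  obtain ⟨N1, h1⟩ := exists_pow_mul_mem_subGen H hl hb
  obtain ⟨N2, h2⟩ := exists_pow_mul_mem_subGen H hl hbf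
  obtain ⟨N3, h3⟩ := exists_pow_mul_isIntegral_subGen H hl f
  have hx := algebraicIndependent_xiSys H hl hκ
  refine ⟨2 ^ (s - 1) * N3, hle ?_⟩
  rw [pow_mul, ← hκd]
  rw [← adjoin_xiSys (by omega)] at h1 h2 h3 hκmem ⊢
  refine mem_adjoin_of_isIntegral_of_mul_mem hx (b := κ ^ N2 * (κ ^ N1 * b))
    (mul_mem (pow_mem hκmem _) h1)
    (mul_ne_zero (pow_ne_zero _ hκ') (mul_ne_zero (pow_ne_zero _ hκ') hb0)) ?_ h3
  have : κ ^ N2 * (κ ^ N1 * b) * (κ ^ N3 * f) = κ ^ N1 * κ ^ N3 * (κ ^ N2 * (b * f)) := by ring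
  rw [this]
  exact mul_mem (mul_mem (pow_mem hκmem _) (pow_mem hκmem _)) h2

end Invariants

section Graded

variable {σ F : Type*} [Field F]

lemma MvPolynomial.IsHomogeneous.homogeneousComponent_mul {h b : MvPolynomial σ F} {d : ℕ}
    (hh : h.IsHomogeneous d) (n : ℕ) : homogeneousComponent n (h * b)
      = if d ≤ n then h * homogeneousComponent (n - d) b else 0 := by
  have h1 : ∀ k, homogeneousComponent n (h * homogeneousComponent k b)
      = if d + k = n then h * homogeneousComponent k b else 0 := fun k => by
    rw [homogeneousComponent_of_mem (hh.mul (homogeneousComponent_isHomogeneous k b))]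
    simp only [eq_comm]
  conv_lhs => rw [← sum_homogeneousComponent b, Finset.mul_sum, map_sum]
  simp only [h1]
  split_ifs with hd
  · by_cases hn : n - d ∈ Finset.range (b.totalDegree + 1)
    · rw [Finset.sum_eq_single_of_mem _ hn fun k _ hk => if_neg (by omega), if_pos (by omega)]
    · rw [homogeneousComponent_eq_zero _ _ (by simp only [Finset.mem_range] at hn; omega), mul_zero]
      refine Finset.sum_eq_zero fun k hk => if_neg fun h => hn ?_
      rwa [show n - d = k by omega]
  · exact Finset.sum_eq_zero fun k _ => if_neg (by omega)

/-- The span of the monomials of given weight in a family of elements. -/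
noncomputable def wtSpan {τ : Type*} [Fintype τ] (x : τ → MvPolynomial σ F) (w : τ → ℕ) (n : ℕ) :
    Submodule F (MvPolynomial σ F) :=
  Submodule.span F {p | ∃ e : τ → ℕ, ∑ i, e i * w i = n ∧ p = ∏ i, x i ^ e i}

lemma homogeneousComponent_mem_wtSpan {τ : Type*} [Fintype τ] {x : τ → MvPolynomial σ F} {w : τ → ℕ}
    (hx : ∀ i, (x i).IsHomogeneous (w i)) {a : MvPolynomial σ F}
    (ha : a ∈ Algebra.adjoin F (Set.range x)) (n : ℕ) :
    homogeneousComponent n a ∈ wtSpan x w n := by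
  rw [Algebra.adjoin_range_eq_range_aeval] at ha
  obtain ⟨P, rfl⟩ := ha
  induction P using MvPolynomial.induction_on' with
  | monomial e c =>
    have h1 : (∏ i, x i ^ e i).IsHomogeneous (∑ i, e i * w i) :=
      IsHomogeneous.prod _ _ _ fun i _ => by simpa only [mul_comm] using (hx i).pow (e i)
    have h2 : aeval x (monomial e c) = C c * ∏ i, x i ^ e i := by
      rw [aeval_monomial, algebraMap_eq, Finsupp.prod_fintype _ _ fun i => pow_zero _]
    simp only [AlgHom.toRingHom_eq_coe, RingHom.coe_coe, h2]
    rw [homogeneousComponent_C_mul, homogeneousComponent_of_mem h1]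
    split_ifs with h
    · rw [C_mul']
      exact Submodule.smul_mem _ _ (Submodule.subset_span ⟨e, h.symm, rfl⟩)
    · rw [mul_zero]; exact zero_mem _
  | add P P' h h' =>
    simp only [AlgHom.toRingHom_eq_coe, RingHom.coe_coe, map_add] at h h' ⊢
    exact add_mem h h'

lemma homogeneousComponent_mem_adjoin {τ : Type*} [Fintype τ] {x : τ → MvPolynomial σ F} {w : τ → ℕ}
    (hx : ∀ i, (x i).IsHomogeneous (w i)) {a : MvPolynomial σ F}
    (ha : a ∈ Algebra.adjoin F (Set.range x)) (n : ℕ) :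
    homogeneousComponent n a ∈ Algebra.adjoin F (Set.range x) := by
  have h := homogeneousComponent_mem_wtSpan hx ha n
  rw [← Subalgebra.mem_toSubmodule]
  refine (Submodule.span_le.2 ?_ : wtSpan x w n ≤ _) h
  rintro _ ⟨e, -, rfl⟩
  exact Subalgebra.prod_mem _ fun i _ =>
    Subalgebra.pow_mem _ (Algebra.subset_adjoin (Set.mem_range_self i)) _

/-- Graded Nakayama lemma for the subring generated by homogeneous elements `h i`, `y j`. -/
lemma mem_span_of_pow_mem {ι κ : Type*} [Fintype ι] [Fintype κ] {h : ι → MvPolynomial σ F}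
    {y : κ → MvPolynomial σ F} {dh : ι → ℕ} {dy : κ → ℕ} (hh : ∀ i, (h i).IsHomogeneous (dh i))
    (hy : ∀ j, (y j).IsHomogeneous (dy j)) (hpos : ∀ i, 0 < dh i) {p : κ → ℕ}
    {A : Subalgebra F (MvPolynomial σ F)} (hA : A = Algebra.adjoin F (Set.range (Sum.elim h y)))
    (hp : ∀ j, ∃ a : ι → MvPolynomial σ F, (∀ i, a i ∈ A) ∧ y j ^ p j = ∑ i, h i * a i)
    {f : MvPolynomial σ F} (hf : f ∈ A) {n : ℕ} (hfn : f.IsHomogeneous n) :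
    f ∈ Submodule.span F {g | ∃ (e : ι → ℕ) (d : κ → ℕ), ∑ i, e i * dh i + ∑ j, d j * dy j = n ∧
      (∀ j, d j < p j) ∧ g = (∏ i, h i ^ e i) * ∏ j, y j ^ d j} := by
  have hx : ∀ i, (Sum.elim h y i).IsHomogeneous (Sum.elim dh dy i) := by
    rintro (i | j)
    exacts [hh i, hy j]
  have hhA : ∀ i, h i ∈ A := fun i => hA ▸ Algebra.subset_adjoin ⟨Sum.inl i, rfl⟩
  have hyA : ∀ j, y j ∈ A := fun j => hA ▸ Algebra.subset_adjoin ⟨Sum.inr j, rfl⟩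
  induction n using Nat.strong_induction_on generalizing f with
  | _ n ih =>
  set M := Submodule.span F {g | ∃ (e : ι → ℕ) (d : κ → ℕ), ∑ i, e i * dh i + ∑ j, d j * dy j = n ∧
      (∀ j, d j < p j) ∧ g = (∏ i, h i ^ e i) * ∏ j, y j ^ d j} with hM
  have key : ∀ i, ∀ a ∈ A, homogeneousComponent n (h i * a) ∈ M := by
    intro i a ha
    rw [(hh i).homogeneousComponent_mul]
    split_ifs with hd
    swap
    · exact zero_mem _
    have h1 := ih (n - dh i) (by have := hpos i; omega)
      (f := homogeneousComponent (n - dh i) a)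
      (by rw [hA] at ha ⊢; exact homogeneousComponent_mem_adjoin hx ha _)
      (homogeneousComponent_isHomogeneous _ _)
    refine Submodule.span_induction (p := fun g _ => h i * g ∈ M) ?_ (by simp) ?_ ?_ h1
    · rintro _ ⟨e, d, hed, hdp, rfl⟩
      refine Submodule.subset_span ⟨e + Pi.single i 1, d, ?_, hdp, ?_⟩
      · simp only [Pi.add_apply, add_mul, Finset.sum_add_distrib]
        rw [Finset.sum_eq_single i (fun j _ hj => by simp [hj]) (by simp)
          (f := fun j => (Pi.single i 1 : ι → ℕ) j * dh j)]
        simp only [Pi.single_eq_same]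
        omega
      · simp only [Pi.add_apply, pow_add, Finset.prod_mul_distrib]
        rw [Finset.prod_eq_single i (fun j _ hj => by simp [hj]) (by simp)
          (f := fun j => h j ^ (Pi.single i 1 : ι → ℕ) j)]
        simp only [Pi.single_eq_same, pow_one]
        ring
    · intro g g' _ _ hg hg'
      rw [mul_add]; exact add_mem hg hg'
    · intro c g _ hg
      rw [mul_smul_comm]; exact Submodule.smul_mem _ _ hg
  have h1 := homogeneousComponent_mem_wtSpan hx (hA ▸ hf) n
  rw [homogeneousComponent_eq_self hfn] at h1
  refine (Submodule.span_le.2 ?_ : wtSpan _ _ n ≤ _) h1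
  rintro _ ⟨e, he, rfl⟩
  simp only [Fintype.sum_sum_type, Fintype.prod_sum_type, Sum.elim_inl, Sum.elim_inr] at he ⊢
  by_cases hlt : ∀ j, e (Sum.inr j) < p j
  · exact Submodule.subset_span ⟨_, _, he, hlt, rfl⟩
  push Not at hlt
  obtain ⟨j, hj⟩ := hlt
  obtain ⟨a, ha, hya⟩ := hp j
  set g : MvPolynomial σ F := (∏ i, h i ^ e (Sum.inl i)) * ∏ k, y k ^ e (Sum.inr k) with hg
  have hgn : g.IsHomogeneous n := by
    rw [← he]
    refine (IsHomogeneous.prod _ _ _ fun i _ => ?_).mul (IsHomogeneous.prod _ _ _ fun i _ => ?_)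
    · rw [mul_comm]; exact (hh i).pow _
    · rw [mul_comm]; exact (hy i).pow _
  obtain ⟨g', hg'A, hgg⟩ : ∃ g' ∈ A, g = g' * y j ^ p j := by
    refine ⟨(∏ i, h i ^ e (Sum.inl i)) * ((∏ k ∈ Finset.univ.erase j, y k ^ e (Sum.inr k))
      * y j ^ (e (Sum.inr j) - p j)), ?_, ?_⟩
    · exact mul_mem (prod_mem fun i _ => pow_mem (hhA i) _)
        (mul_mem (prod_mem fun k _ => pow_mem (hyA k) _) (pow_mem (hyA j) _))
    · rw [hg, ← Finset.prod_erase_mul _ _ (Finset.mem_univ j), mul_assoc, mul_assoc, ← pow_add,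
        Nat.sub_add_cancel hj]
  rw [← homogeneousComponent_eq_self hgn, hgg, hya, Finset.mul_sum, map_sum]
  refine sum_mem fun i _ => ?_
  rw [mul_left_comm]
  exact key i _ (mul_mem hg'A (ha i))

end Graded

/-- The exponent vectors of weight at most `M`. -/
noncomputable def bddExp {σ : Type*} [Fintype σ] (w : σ → ℕ) (M : ℕ) : Finset (σ → ℕ) :=
  {e ∈ Fintype.piFinset fun _ => Finset.range (M + 1) | ∑ i, e i * w i ≤ M}

lemma mem_bddExp {σ : Type*} [Fintype σ] {w : σ → ℕ} (hw : ∀ i, 0 < w i) {M : ℕ} {e : σ → ℕ} :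
    e ∈ bddExp w M ↔ ∑ i, e i * w i ≤ M := by
  simp only [bddExp, Finset.mem_filter, Fintype.mem_piFinset, Finset.mem_range, and_iff_right_iff_imp]
  intro h i
  have h1 : e i * w i ≤ ∑ i, e i * w i :=
    Finset.single_le_sum (f := fun i => e i * w i) (fun _ _ => Nat.zero_le _) (Finset.mem_univ i)
  have h2 := Nat.le_mul_of_pos_right (e i) (hw i)
  omega

lemma card_bddExp_le {σ : Type*} [Fintype σ] (w : σ → ℕ) (M : ℕ) :
    (bddExp w M).card ≤ (M + 1) ^ Fintype.card σ := by
  refine (Finset.card_filter_le _ _).trans ?_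
  simp

lemma prod_mul_card_bddExp_le {σ : Type*} [Fintype σ] {w : σ → ℕ} (hw : ∀ i, 0 < w i) (M : ℕ) :
    (∏ i, w i) * (bddExp w M).card ≤ (bddExp (1 : σ → ℕ) (M + ∑ i, w i)).card := by
  have h1 : ((Fintype.piFinset fun i => Finset.range (w i)) ×ˢ bddExp w M).card
      = (∏ i, w i) * (bddExp w M).card := by
    rw [Finset.card_product, Fintype.card_piFinset]
    simp
  rw [← h1]
  refine Finset.card_le_card_of_injOn (fun p i => p.1 i + w i * p.2 i) ?_ ?_
  · rintro ⟨r, e⟩ hp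
    rw [Finset.coe_product] at hp
    obtain ⟨hr, he⟩ := hp
    simp only [Finset.mem_coe, Fintype.mem_piFinset, Finset.mem_range] at hr
    have he' := (mem_bddExp hw).1 he
    rw [Finset.mem_coe, mem_bddExp (w := (1 : σ → ℕ)) fun _ => Nat.one_pos]
    simp only [Pi.one_apply, mul_one, Finset.sum_add_distrib]
    have h2 : ∑ i, r i ≤ ∑ i, w i := Finset.sum_le_sum fun i _ => (hr i).le
    have h3 : ∑ i, w i * e i = ∑ i, e i * w i := Finset.sum_congr rfl fun i _ => mul_comm _ _
    dsimp only at he' ⊢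
    omega
  · rintro ⟨r, e⟩ hp ⟨r', e'⟩ hp' h
    rw [Finset.coe_product] at hp hp'
    have hr := hp.1
    have hr' := hp'.1
    simp only [Finset.mem_coe, Fintype.mem_piFinset, Finset.mem_range] at hr hr'
    have h2 : ∀ i, r i = r' i ∧ e i = e' i := fun i => by
      have h3 : r i + w i * e i = r' i + w i * e' i := congrFun h i
      have h4 := congrArg (· % w i) h3
      have h5 := congrArg (· / w i) h3
      simp only [Nat.add_mul_mod_self_left, Nat.mod_eq_of_lt (hr i), Nat.mod_eq_of_lt (hr' i)] at h4
      simp only [Nat.add_mul_div_left _ _ (hw i), Nat.div_eq_of_lt (hr i),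
        Nat.div_eq_of_lt (hr' i)] at h5
      exact ⟨h4, by omega⟩
    rw [Prod.mk.injEq]
    exact ⟨funext fun i => (h2 i).1, funext fun i => (h2 i).2⟩

/-- A function of polynomial growth does not grow exponentially. -/
lemma le_of_poly_growth {f : ℕ → ℕ} {k c a b : ℕ} (hf : ∀ N, f N ≤ (N + 1) ^ k) (h0 : 0 < f 0)
    (h : ∀ N, a * f N ≤ b * f (N + c)) : a ≤ b := by
  by_contra! hab
  have hb : 0 < b := by
    by_contra hb
    have h1 := h 0
    rw [show b = 0 by omega, zero_mul] at h1
    have := Nat.mul_pos (show 0 < a by omega) h0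
    omega
  have h1 : ∀ n, a ^ n * f 0 ≤ b ^ n * f (n * c) := by
    intro n
    induction n with
    | zero => simp
    | succ n ih =>
      calc a ^ (n + 1) * f 0 = a * (a ^ n * f 0) := by ring
        _ ≤ a * (b ^ n * f (n * c)) := Nat.mul_le_mul_left _ ih
        _ = b ^ n * (a * f (n * c)) := by ring
        _ ≤ b ^ n * (b * f (n * c + c)) := Nat.mul_le_mul_left _ (h _)
        _ = b ^ (n + 1) * f ((n + 1) * c) := by rw [show (n + 1) * c = n * c + c by ring]; ring
  have h2 : ∀ n, 1 ≤ n → a ^ n ≤ b ^ n * ((c + 1) ^ k * n ^ k) := fun n hn => by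
    refine (Nat.le_mul_of_pos_right _ h0).trans ((h1 n).trans (Nat.mul_le_mul_left _ ?_))
    refine (hf _).trans ?_
    rw [← mul_pow]
    refine Nat.pow_le_pow_left ?_ k
    nlinarith
  have hr : 1 < (a : ℝ) / b := by
    rw [one_lt_div (by exact_mod_cast hb)]
    exact_mod_cast hab
  have h3 := (tendsto_pow_const_div_const_pow_of_one_lt k hr).const_mul ((c + 1 : ℝ) ^ k)
  rw [mul_zero] at h3
  obtain ⟨n, hn, hn'⟩ := ((h3.eventually (gt_mem_nhds one_pos)).and
    (Filter.eventually_ge_atTop 1)).exists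
  have h4 : (a : ℝ) ^ n ≤ b ^ n * ((c + 1) ^ k * n ^ k) := by exact_mod_cast h2 n hn'
  have hb' : (0 : ℝ) < b := by exact_mod_cast hb
  rw [div_pow, ← mul_div_assoc, div_div_eq_mul_div, div_lt_one (pow_pos (by linarith [show (b:ℝ) < a by exact_mod_cast hab]) n)] at hn
  nlinarith

section Growth

variable {F : Type*} [Field F]

lemma exists_common_denom {S L : Type*} [CommRing S] [IsDomain S] [Algebra F S] [Field L]
    [Algebra F L] [Algebra S L] [IsScalarTower F S L] [FaithfulSMul S L] {E : Subalgebra F S}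
    (s : Finset (fracSub L E)) : ∃ b ∈ E, b ≠ 0 ∧ ∀ x ∈ s, ∃ a ∈ E,
      algebraMap S L b * x = algebraMap S L a := by
  induction s using Finset.induction_on with
  | empty => exact ⟨1, one_mem _, one_ne_zero, by simp⟩
  | insert x s _ ih =>
    obtain ⟨b, hb, hb0, h⟩ := ih
    obtain ⟨a', ha', b', hb', hb0', h'⟩ := mem_fracSub_iff.1 x.2
    refine ⟨b * b', mul_mem hb hb', mul_ne_zero hb0 hb0', fun y hy => ?_⟩
    rcases Finset.mem_insert.1 hy with rfl | hy
    · exact ⟨b * a', mul_mem hb ha', by rw [map_mul, map_mul, mul_assoc, h']⟩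
    · obtain ⟨a, ha, hay⟩ := h y hy
      exact ⟨b' * a, mul_mem hb' ha, by rw [map_mul, map_mul, mul_comm (algebraMap S L b), mul_assoc, hay]⟩

variable {σ : Type*} [Fintype σ]

lemma exists_pow_mem_span {h : σ → MvPolynomial σ F} {dh : σ → ℕ}
    (hh : ∀ i, (h i).IsHomogeneous (dh i))
    (hint : ∀ f : MvPolynomial σ F, IsIntegral (Algebra.adjoin F (Set.range h)) f) (j : σ) :
    ∃ p, ∃ a : σ → MvPolynomial σ F, X j ^ p = ∑ i, h i * a i := by
  obtain ⟨P, hP, hPj⟩ := hint (X j)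
  refine ⟨P.natDegree, ?_⟩
  suffices hmem : (X j : MvPolynomial σ F) ^ P.natDegree ∈ Ideal.span (Set.range h) by
    obtain ⟨a, ha⟩ := Ideal.mem_span_range_iff_exists_fun.1 hmem
    exact ⟨a, by rw [← ha]; exact Finset.sum_congr rfl fun i _ => mul_comm _ _⟩
  rw [Polynomial.eval₂_eq_sum_range, Finset.sum_range_succ, hP.coeff_natDegree, map_one,
    one_mul] at hPj
  have h1 := congrArg (homogeneousComponent P.natDegree) hPj
  rw [map_add, homogeneousComponent_eq_self (isHomogeneous_X_pow _ _), map_zero, map_sum] at h1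
  rw [eq_neg_of_add_eq_zero_right h1]
  refine neg_mem (sum_mem fun k hk => ?_)
  have hk' := Finset.mem_range.1 hk
  rw [mul_comm, (isHomogeneous_X_pow j k).homogeneousComponent_mul, if_pos hk'.le]
  refine Ideal.mul_mem_left _ _ ?_
  have h2 := homogeneousComponent_mem_wtSpan hh (P.coeff k).2 (P.natDegree - k)
  refine (Submodule.span_le.2 ?_ : wtSpan _ _ _ ≤ (Ideal.span (Set.range h)).restrictScalars F) h2
  rintro _ ⟨e, he, rfl⟩
  obtain ⟨i, -, hi⟩ := Finset.exists_ne_zero_of_sum_ne_zero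
    (show ∑ i, e i * dh i ≠ 0 by omega)
  refine Ideal.mem_of_dvd _ ?_ (Ideal.subset_span ⟨i, rfl⟩)
  exact (dvd_pow_self _ (left_ne_zero_of_mul hi)).trans (Finset.dvd_prod_of_mem _ (Finset.mem_univ i))

/-- The degree of the fraction field over a homogeneous system of parameters is at least the
product of the degrees. -/
lemma prod_le_finrank {h : σ → MvPolynomial σ F} {dh : σ → ℕ}
    (hh : ∀ i, (h i).IsHomogeneous (dh i)) (hpos : ∀ i, 0 < dh i)
    (hint : ∀ f : MvPolynomial σ F, IsIntegral (Algebra.adjoin F (Set.range h)) f)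
    (L : Type*) [Field L] [Algebra F L] [Algebra (MvPolynomial σ F) L]
    [IsScalarTower F (MvPolynomial σ F) L] [FaithfulSMul (MvPolynomial σ F) L]
    [FiniteDimensional (fracSub L (Algebra.adjoin F (Set.range h))) L] :
    ∏ i, dh i ≤ Module.finrank (fracSub L (Algebra.adjoin F (Set.range h))) L := by
  set B := Algebra.adjoin F (Set.range h) with hB
  set K := fracSub L B with hK
  choose p a hpa using exists_pow_mem_span hh hint
  let mon : (σ → ℕ) → MvPolynomial σ F := fun d => ∏ j, X j ^ d j
  let T : Finset (σ → ℕ) := Fintype.piFinset fun j => Finset.range (p j)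
  set V := Submodule.span K ((fun d => algebraMap (MvPolynomial σ F) L (mon d)) '' T) with hV
  obtain ⟨v, hv, hspan, -⟩ :
    ∃ v : Fin (Module.finrank K V) → L, (∀ i, v i ∈ _) ∧ Submodule.span K (Set.range v) = V ∧ _ := Submodule.exists_fun_fin_finrank_span_eq K
    ((fun d => algebraMap (MvPolynomial σ F) L (mon d)) '' T)
  have hD : Module.finrank K V ≤ Module.finrank K L := Submodule.finrank_le V
  refine le_trans ?_ hD
  choose δ hδT hδ using hv
  have hk : ∀ d : T, ∃ k : Fin (Module.finrank K V) → K,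
      ∑ i, k i • v i = algebraMap (MvPolynomial σ F) L (mon d) := fun d => by
    rw [← Submodule.mem_span_range_iff_exists_fun, hspan]
    exact Submodule.subset_span ⟨d, d.2, rfl⟩
  choose k hk using hk
  obtain ⟨b, -, hb0, hb⟩ := exists_common_denom
    (Finset.univ.image fun x : T × Fin (Module.finrank K V) => k x.1 x.2)
  have hb' : ∀ d i, ∃ c ∈ B, algebraMap (MvPolynomial σ F) L b * k d i
      = algebraMap (MvPolynomial σ F) L c := fun d i =>
    hb _ (Finset.mem_image.2 ⟨(d, i), Finset.mem_univ _, rfl⟩)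
  choose c hcB hc using hb'
  have hbT : ∀ d : T, b * mon d = ∑ i, c d i * mon (δ i) := fun d => by
    refine FaithfulSMul.algebraMap_injective (MvPolynomial σ F) L ?_
    rw [map_mul, ← hk, Finset.mul_sum, map_sum]
    refine Finset.sum_congr rfl fun i _ => ?_
    rw [map_mul, ← hc, Algebra.smul_def, mul_assoc, ← hδ i]
    rfl
  obtain ⟨C0, hC0⟩ : ∃ C0, ∀ d i, c d i ∈ Submodule.span F
      {g | ∃ e ∈ bddExp dh C0, g = ∏ j, h j ^ e j} := by
    refine ⟨Finset.univ.sup fun x : T × Fin (Module.finrank K V) => (c x.1 x.2).totalDegree,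
      fun d i => ?_⟩
    rw [← sum_homogeneousComponent (c d i)]
    refine sum_mem fun n hn => ?_
    refine Submodule.span_mono ?_ (homogeneousComponent_mem_wtSpan hh (hcB d i) n)
    rintro _ ⟨e, he, rfl⟩
    refine ⟨e, (mem_bddExp hpos).2 ?_, rfl⟩
    rw [he]
    exact (Nat.lt_succ_iff.1 (Finset.mem_range.1 hn)).trans
      (Finset.le_sup (f := fun x : T × Fin (Module.finrank K V) => (c x.1 x.2).totalDegree)
        (Finset.mem_univ (d, i)))
  have hmon : ∀ e, (mon e).IsHomogeneous (∑ i, e i) := fun e =>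
    IsHomogeneous.prod _ _ _ fun i _ => isHomogeneous_X_pow i _
  have hA : (⊤ : Subalgebra F (MvPolynomial σ F))
      = Algebra.adjoin F (Set.range (Sum.elim h (X : σ → MvPolynomial σ F))) := by
    refine (top_le_iff.1 ?_).symm
    rw [← MvPolynomial.adjoin_range_X]
    refine Algebra.adjoin_mono ?_
    rintro _ ⟨i, rfl⟩
    exact ⟨Sum.inr i, rfl⟩
  have hW : ∀ N, ∀ e ∈ bddExp (1 : σ → ℕ) N, b * mon e ∈ Submodule.span F
      (((bddExp dh (N + C0) ×ˢ Finset.univ).image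
        fun x : (σ → ℕ) × Fin (Module.finrank K V) => (∏ j, h j ^ x.1 j) * mon (δ x.2) :
          Finset (MvPolynomial σ F)) : Set (MvPolynomial σ F)) := by
    intro N e he
    set W := Submodule.span F
      (((bddExp dh (N + C0) ×ˢ Finset.univ).image
        fun x : (σ → ℕ) × Fin (Module.finrank K V) => (∏ j, h j ^ x.1 j) * mon (δ x.2) :
          Finset (MvPolynomial σ F)) : Set (MvPolynomial σ F))
    have h1 := mem_span_of_pow_mem hh (fun j => isHomogeneous_X F j) hpos hA
      (fun j => ⟨a j, fun _ => Algebra.mem_top, hpa j⟩) Algebra.mem_top (hmon e)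
    refine Submodule.span_induction (p := fun g _ => b * g ∈ W) ?_ (by simp) ?_ ?_ h1
    · rintro _ ⟨e', d, hed, hdp, rfl⟩
      have hdT : d ∈ T := Fintype.mem_piFinset.2 fun j => Finset.mem_range.2 (hdp j)
      rw [mul_left_comm, show b * (∏ j, X j ^ d j) = _ from hbT ⟨d, hdT⟩, Finset.mul_sum]
      refine sum_mem fun i _ => ?_
      refine Submodule.span_induction
        (p := fun g _ => (∏ j, h j ^ e' j) * (g * mon (δ i)) ∈ W) ?_ (by simp) ?_ ?_ (hC0 ⟨d, hdT⟩ i)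
      · rintro _ ⟨e'', he'', rfl⟩
        refine Submodule.subset_span (Finset.mem_coe.2 (Finset.mem_image.2
          ⟨(e' + e'', i), Finset.mem_product.2 ⟨(mem_bddExp hpos).2 ?_, Finset.mem_univ _⟩, ?_⟩))
        · have h2 := (mem_bddExp hpos).1 he''
          have h3 := (mem_bddExp (w := (1 : σ → ℕ)) fun _ => Nat.one_pos).1 he
          simp only [Pi.one_apply, mul_one] at h3
          simp only [Pi.add_apply, add_mul, Finset.sum_add_distrib]
          omega
        · simp only [Pi.add_apply, pow_add, Finset.prod_mul_distrib, mul_assoc]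
      · intro g g' _ _ hg hg'
        rw [add_mul, mul_add]; exact add_mem hg hg'
      · intro r g _ hg
        rw [smul_mul_assoc, mul_smul_comm]; exact Submodule.smul_mem _ _ hg
    · intro g g' _ _ hg hg'
      rw [mul_add]; exact add_mem hg hg'
    · intro r g _ hg
      rw [mul_smul_comm]; exact Submodule.smul_mem _ _ hg
  have hcount : ∀ N, (bddExp (1 : σ → ℕ) N).card
      ≤ Module.finrank K V * (bddExp dh (N + C0)).card := by
    intro N
    have hli : LinearIndependent F fun e : bddExp (1 : σ → ℕ) N => b * mon e := by
      have h1 : LinearIndependent F fun e : bddExp (1 : σ → ℕ) N => mon e := by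
        have h2 : ∀ e, mon e = basisMonomials σ F (Finsupp.equivFunOnFinite.symm e) := fun e => by
          rw [coe_basisMonomials]
          beta_reduce
          rw [monomial_eq, C_1, one_mul, Finsupp.prod_fintype _ _ (by simp)]
          rfl
        simp only [h2]
        exact (basisMonomials σ F).linearIndependent.comp _
          (Finsupp.equivFunOnFinite.symm.injective.comp Subtype.val_injective)
      exact h1.map' (LinearMap.mulLeft F b)
        (LinearMap.ker_eq_bot.2 (mul_right_injective₀ hb0))
    have h1 := finrank_span_eq_card hli
    rw [Fintype.card_coe] at h1
    rw [← h1]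
    have h2 : Submodule.span F (Set.range fun e : bddExp (1 : σ → ℕ) N => b * mon e)
        ≤ _ := Submodule.span_le.2 (by rintro _ ⟨e, rfl⟩; exact hW N e e.2)
    refine (Submodule.finrank_mono h2).trans ((finrank_span_finset_le_card _).trans ?_)
    refine Finset.card_image_le.trans ?_
    rw [Finset.card_product, Finset.card_univ, Fintype.card_fin, mul_comm]
  refine le_of_poly_growth (f := fun N => (bddExp (1 : σ → ℕ) N).card)
    (k := Fintype.card σ) (c := C0 + ∑ i, dh i) (fun N => card_bddExp_le _ _)
    (Finset.card_pos.2 ⟨0, (mem_bddExp (w := (1 : σ → ℕ)) fun _ => Nat.one_pos).2 (by simp)⟩) fun N => ?_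
  calc (∏ i, dh i) * (bddExp (1 : σ → ℕ) N).card
      ≤ (∏ i, dh i) * (Module.finrank K V * (bddExp dh (N + C0)).card) :=
        Nat.mul_le_mul_left _ (hcount N)
    _ = Module.finrank K V * ((∏ i, dh i) * (bddExp dh (N + C0)).card) := by ring
    _ ≤ Module.finrank K V * (bddExp (1 : σ → ℕ) (N + C0 + ∑ i, dh i)).card :=
        Nat.mul_le_mul_left _ (prod_mul_card_bddExp_le hpos _)
    _ = _ := by rw [add_assoc]

end Growth

section Degrees

lemma MvPolynomial.IsHomogeneous.of_mul_left {σ F : Type*} [Field F] {u x : MvPolynomial σ F}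
    {a b : ℕ} (hu : u.IsHomogeneous a) (hu0 : u ≠ 0) (h : (u * x).IsHomogeneous (a + b)) :
    x.IsHomogeneous b := by
  have h1 := hu.homogeneousComponent_mul (b := x) (a + b)
  rw [if_pos (Nat.le_add_right _ _), Nat.add_sub_cancel_left,
    homogeneousComponent_eq_self h] at h1
  rw [mul_left_cancel₀ hu0 h1]
  exact homogeneousComponent_isHomogeneous _ _

lemma pf_isHomogeneous {σ R : Type*} [CommRing R] {N : ℕ → ℕ → MvPolynomial σ R} {w : ℕ → ℕ}
    (hN : ∀ a b, N a b = N b a) (hw : ∀ a b, (N a b).IsHomogeneous (w a + w b)) (T : Finset ℕ) :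
    (pf N T).IsHomogeneous (∑ i ∈ T, w i) := by
  induction hn : T.card using Nat.strong_induction_on generalizing T with
  | _ n ih =>
  subst hn
  rcases T.eq_empty_or_nonempty with rfl | ⟨a, ha⟩
  · rw [pf_empty, Finset.sum_empty]
    exact isHomogeneous_one _ _
  · rw [pf_expand hN ha]
    refine IsHomogeneous.sum _ _ _ fun b hb => ?_
    rw [← Finset.add_sum_erase _ _ ha, ← Finset.add_sum_erase _ _ hb, ← add_assoc]
    refine (hw a b).mul (ih _ ?_ _ rfl)
    exact ((Finset.card_erase_lt_of_mem hb).trans (Finset.card_erase_lt_of_mem ha))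

variable {q m s : ℕ} {F : Type*} [Field F]

lemma gram_isHomogeneous (a b : ℕ) :
    (gram q (genVec m F) a b).IsHomogeneous (q ^ a + q ^ b) := by
  rw [gram, bform_apply]
  refine IsHomogeneous.sum _ _ _ fun j _ => IsHomogeneous.add ?_ ?_ <;>
  exact (isHomogeneous_X_pow _ _).mul (isHomogeneous_X_pow _ _)

lemma gpf_isHomogeneous (T : Finset ℕ) : (gpf q m F T).IsHomogeneous (∑ i ∈ T, q ^ i) :=
  pf_isHomogeneous (gram_comm _ _) gram_isHomogeneous T

lemma xiZero_isHomogeneous : (xiZero m F).IsHomogeneous 2 := by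
  rw [xiZero]
  refine (isHomogeneous_X_pow _ _).add (IsHomogeneous.sum _ _ _ fun j _ => ?_)
  exact (isHomogeneous_X _ _).mul (isHomogeneous_X _ _)

lemma quadPf_isHomogeneous (V : Finset ℕ) :
    (quadPf q m F V).IsHomogeneous (2 + ∑ i ∈ V, q ^ i) := by
  rw [quadPf, pairSum]
  refine (xiZero_isHomogeneous.mul (gpf_isHomogeneous V)).add
    (IsHomogeneous.sum _ _ _ fun a ha => IsHomogeneous.sum _ _ _ fun b hb => ?_)
  split_ifs with hab
  · have h := ((gram_isHomogeneous (q := q) (m := m) (F := F) 0 a).mul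
      (gram_isHomogeneous (q := q) 0 b)).mul (gpf_isHomogeneous (q := q) ((V.erase a).erase b))
    have hb' : b ∈ V.erase a := Finset.mem_erase.2 ⟨hab.ne', hb⟩
    rw [← Finset.add_sum_erase _ _ ha, ← Finset.add_sum_erase _ _ hb']
    convert h using 1
    rw [pow_zero]
    ring
  · exact isHomogeneous_zero _ _ _

lemma gSeq_isHomogeneous [Fintype F] [CharP F 2] {b1 : MvPolynomial (OIdx m) F}
    (H : OrthData q m s F b1) {k d : ℕ} (hk : k < 2 * m - 1)
    (hd : 2 * d + q ^ (k + 1) = q ^ (2 * m)) : (gSeq q m s F b1 k).IsHomogeneous d := by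
  have hm := H.hm
  have hq2 := H.h2
  rw [gSeq, if_neg (by omega), show 2 * m - 2 - k = 2 * m - 1 - (k + 1) by omega]
  refine IsHomogeneous.of_sq ((gpf_isHomogeneous _).of_mul_left (gpf_range_ne_zero H.hF) ?_)
  rw [eSeq_star H.hs H.hm H.hq H.h2 H.hF H.hb1 (by omega) (by omega)]
  set U := ∑ i ∈ Finset.range (2 * m), q ^ i with hU
  have e1 : ∑ i ∈ (Finset.range (2 * m + 1)).erase (k + 1), q ^ i = U + 2 * d := by
    have := Finset.add_sum_erase (Finset.range (2 * m + 1)) (fun i => q ^ i)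
      (a := k + 1) (by simp; omega)
    rw [Finset.sum_range_succ] at this
    omega
  have e2 : U * (q - 1) + (2 + ∑ i ∈ (Finset.Icc 1 (2 * m - 1)).erase (k + 1), q ^ i)
      = U + 2 * d := by
    have h1 := Finset.add_sum_erase (Finset.Icc 1 (2 * m - 1)) (fun i => q ^ i)
      (a := k + 1) (by simp; omega)
    have h2 : U = 1 + ∑ i ∈ Finset.Icc 1 (2 * m - 1), q ^ i := by
      rw [hU, show 2 * m = 2 * m - 1 + 1 by omega, Finset.sum_range_succ', pow_zero, add_comm]
      congr 1
      rw [Nat.add_sub_cancel, range_succ_image_add_one, Finset.sum_image fun a _ b _ h => by simpa using h]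
    have h4 : U * (q - 1) + 1 = q ^ (2 * m) := by
      have := geom_sum_mul_add (q - 1) (2 * m)
      rwa [Nat.sub_add_cancel (by omega)] at this
    omega
  have h1 := gpf_isHomogeneous (q := q) (m := m) (F := F)
    ((Finset.range (2 * m + 1)).erase (k + 1))
  have h2 := ((gpf_isHomogeneous (q := q) (m := m) (F := F) (Finset.range (2 * m))).pow (q - 1)).mul
    (quadPf_isHomogeneous (q := q) ((Finset.Icc 1 (2 * m - 1)).erase (k + 1)))
  rw [e1] at h1
  rw [← hU, e2] at h2
  exact h1.add h2

end Degrees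

/-- The system of parameters `ξ_0, …, ξ_m, e_1, …, e_m`. -/
noncomputable def hSys (q m s : ℕ) (F : Type*) [Field F] (b1 : MvPolynomial (OIdx m) F) :
    OIdx m → MvPolynomial (OIdx m) F
  | none => xiZero m F
  | some (Sum.inl i) => gram q (genVec m F) 0 (i + 1)
  | some (Sum.inr i) => gSeq q m s F b1 (2 * m - 2 - i)

/-- The degrees of the system of parameters. -/
def hDeg (q m : ℕ) : OIdx m → ℕ
  | none => 2
  | some (Sum.inl i) => q ^ 0 + q ^ ((i : ℕ) + 1)
  | some (Sum.inr i) => (q ^ (2 * m) - q ^ (2 * m - 1 - (i : ℕ))) / 2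

/-- The remaining generators `ξ_{2m-1}, …, ξ_{m+1}` of the ring of invariants. -/
noncomputable def ySys (q m : ℕ) (F : Type*) [Field F] (j : Fin (m - 1)) : MvPolynomial (OIdx m) F :=
  gram q (genVec m F) 0 (2 * m - 1 - j)

/-- Exponents of the basis monomials. -/
abbrev YIdx (m s : ℕ) := ∀ j : Fin (m - 1), Fin (2 ^ (s * ((j : ℕ) + 1) - 1))

/-- The basis monomials. -/
noncomputable def yMono (q m s : ℕ) (F : Type*) [Field F] (d : YIdx m s) : MvPolynomial (OIdx m) F :=
  ∏ j, ySys q m F j ^ (d j : ℕ)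

lemma isIntegral_of_subalgebra_le {R S : Type*} [CommRing R] [CommRing S] [Algebra R S]
    {B A : Subalgebra R S} (hBA : B ≤ A) (hA : ∀ a ∈ A, IsIntegral B a) {f : S}
    (hf : IsIntegral A f) : IsIntegral B f := by
  let _ : Algebra B A := (Subalgebra.inclusion hBA).toAlgebra
  have : IsScalarTower B A S := IsScalarTower.of_algebraMap_eq fun _ => rfl
  have : Algebra.IsIntegral B A := ⟨fun a =>
    (isIntegral_algebraMap_iff (Subtype.val_injective : Function.Injective
      (algebraMap A S))).1 (hA a a.2)⟩
  exact isIntegral_trans (R := B) (A := A) f hf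

section Parameters

variable {q m s : ℕ} {F : Type*} [Field F] [Fintype F] [CharP F 2] {b1 : MvPolynomial (OIdx m) F}

lemma two_mul_hDeg (H : OrthData q m s F b1) (i : Fin m) :
    2 * hDeg q m (some (Sum.inr i)) + q ^ (2 * m - 1 - (i : ℕ)) = q ^ (2 * m) := by
  have hs := H.hs
  have hm := H.hm
  have h2 : 2 ∣ q := H.hq ▸ dvd_pow_self 2 (by omega)
  have h3 : 2 ∣ q ^ (2 * m) := h2.trans (dvd_pow_self q (by omega))
  have h4 : 2 ∣ q ^ (2 * m - 1 - (i : ℕ)) := h2.trans (dvd_pow_self q (by omega))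
  have h5 : q ^ (2 * m - 1 - (i : ℕ)) ≤ q ^ (2 * m) :=
    Nat.pow_le_pow_right (by have := H.h2; omega) (by omega)
  simp only [hDeg]
  omega

lemma hSys_isHomogeneous (H : OrthData q m s F b1) (i : OIdx m) :
    (hSys q m s F b1 i).IsHomogeneous (hDeg q m i) := by
  have hm := H.hm
  rcases i with _ | i | i
  · exact xiZero_isHomogeneous
  · exact gram_isHomogeneous _ _
  · refine gSeq_isHomogeneous H (by omega) ?_
    rw [← two_mul_hDeg H i, show 2 * m - 2 - (i : ℕ) + 1 = 2 * m - 1 - i by omega]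

lemma hDeg_pos (H : OrthData q m s F b1) (i : OIdx m) : 0 < hDeg q m i := by
  have hm := H.hm
  rcases i with _ | i | i
  · exact Nat.two_pos
  · simp [hDeg]
  · have h1 := two_mul_hDeg H i
    have h5 : q ^ (2 * m - 1 - (i : ℕ)) < q ^ (2 * m) :=
      Nat.pow_lt_pow_right (by have := H.h2; omega) (by omega)
    omega

lemma subGen_eq_adjoin (H : OrthData q m s F b1) : subGen q m s F b1 (Set.Iio (2 * m - 1))
    = Algebra.adjoin F (Set.range (Sum.elim (hSys q m s F b1) (ySys q m F))) := by
  have hm := H.hm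
  apply le_antisymm
  · rw [subGen_Iio_eq H]
    refine subGen_le ?_ (fun j hj => ?_) fun k hk => ?_
    · exact Algebra.subset_adjoin ⟨Sum.inl none, rfl⟩
    · rcases j.eq_zero_or_pos with rfl | hj0
      · rw [gram_self]
        exact zero_mem _
      by_cases hjm : j ≤ m
      · refine Algebra.subset_adjoin ⟨Sum.inl (some (Sum.inl ⟨j - 1, by omega⟩)), ?_⟩
        simp only [Sum.elim_inl, hSys]
        rw [Nat.sub_add_cancel hj0]
      · refine Algebra.subset_adjoin ⟨Sum.inr ⟨2 * m - 1 - j, by omega⟩, ?_⟩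
        simp only [Sum.elim_inr, ySys]
        rw [show 2 * m - 1 - (2 * m - 1 - j) = j by omega]
    · obtain ⟨hk1, hk2⟩ := hk
      refine Algebra.subset_adjoin ⟨Sum.inl (some (Sum.inr ⟨2 * m - 2 - k, by omega⟩)), ?_⟩
      simp only [Sum.elim_inl, hSys]
      rw [show 2 * m - 2 - (2 * m - 2 - k) = k by omega]
  · rw [Algebra.adjoin_le_iff]
    rintro _ ⟨(_ | i | i) | j, rfl⟩
    · exact xiZero_mem_subGen
    · exact gram_mem_subGen (by omega)
    · exact gSeq_mem_subGen (Set.mem_Iio.2 (by omega))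
    · exact gram_mem_subGen (by omega)

lemma adjoin_hSys_le (H : OrthData q m s F b1) : Algebra.adjoin F (Set.range (hSys q m s F b1))
    ≤ subGen q m s F b1 (Set.Iio (2 * m - 1)) := by
  rw [subGen_eq_adjoin H]
  refine Algebra.adjoin_mono ?_
  rintro _ ⟨i, rfl⟩
  exact ⟨Sum.inl i, rfl⟩

lemma ySys_pow_eq (H : OrthData q m s F b1) (j : Fin (m - 1)) :
    ∃ a : OIdx m → MvPolynomial (OIdx m) F,
      (∀ i, a i ∈ subGen q m s F b1 (Set.Iio (2 * m - 1))) ∧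
      ySys q m F j ^ 2 ^ (s * ((j : ℕ) + 1) - 1) = ∑ i, hSys q m s F b1 i * a i := by
  have hm := H.hm
  have hs := H.hs
  set A := subGen q m s F b1 (Set.Iio (2 * m - 1)) with hA
  set I := Submodule.span A (Set.range (hSys q m s F b1)) with hI
  have hmul : ∀ i, ∀ a ∈ A, hSys q m s F b1 i * a ∈ I := fun i a ha => by
    rw [mul_comm]
    exact I.smul_mem ⟨a, ha⟩ (Submodule.subset_span ⟨i, rfl⟩)
  have hgram : ∀ i, 1 ≤ i → i ≤ m → ∀ a ∈ A, gram q (genVec m F) 0 i * a ∈ I := fun i hi hi' a ha => by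
    have := hmul (some (Sum.inl ⟨i - 1, by omega⟩)) a ha
    simpa only [hSys, Nat.sub_add_cancel hi] using this
  have hN : ∀ a b, a < b → gram q (genVec m F) b a = gram q (genVec m F) 0 (b - a) ^ q ^ a :=
    fun a b hab => by
      rw [gram_comm, ← gram_add H.hq, zero_add, Nat.sub_add_cancel hab.le]
  suffices h : ySys q m F j ^ 2 ^ (s * ((j : ℕ) + 1) - 1) ∈ I by
    obtain ⟨c, hc⟩ := (Submodule.mem_span_range_iff_exists_fun A).1 h
    refine ⟨fun i => c i, fun i => (c i).2, ?_⟩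
    rw [← hc]
    exact Finset.sum_congr rfl fun i _ => by rw [Subalgebra.smul_def, smul_eq_mul, mul_comm]
  have hrel := gSeq_relation H.hs H.hm H.hq H.h2 H.hF H.hb1 (j := (j : ℕ)) (by omega)
  rw [show 2 * m = 2 * m - 1 + 1 by omega, Finset.sum_range_succ,
    show 2 * m - 1 + 1 = 2 * m by omega] at hrel
  have hy : gSeq q m s F b1 (2 * m - 1) * gram q (genVec m F) (2 * m - 1) j ^ 2 ^ (s - 1)
      = ySys q m F j ^ 2 ^ (s * ((j : ℕ) + 1) - 1) := by
    rw [gSeq, if_pos rfl, one_mul, hN _ _ (by omega), ← pow_mul, ySys, H.hq, ← pow_mul, ← pow_add]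
    congr 2
    rw [mul_add, mul_one]
    omega
  rw [hy] at hrel
  have hrel' := eq_sub_of_add_eq' hrel
  rw [hrel']
  refine I.sub_mem ?_ (I.sum_mem fun k hk => ?_)
  · rw [mul_right_comm, mul_comm]
    refine hgram _ (by omega) (by omega) _ (mul_mem (pow_mem ?_ _) (pow_mem ?_ _))
    · exact range_evXi_le (fun _ => gram_mem_subGen) (gpf_mem_range H.hq fun i hi =>
        Finset.mem_range.1 hi)
    · exact gpf_erase_mem_subGen H.hq _
  · rw [Finset.mem_range] at hk
    have hgA : ∀ a < 2 * m, ∀ n, gram q (genVec m F) 0 a ^ n ∈ A := fun a ha n =>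
      pow_mem (gram_mem_subGen ha) n
    have hq0 : ∀ n, q ^ n * 2 ^ (s - 1) ≠ 0 := fun n =>
      mul_ne_zero (pow_ne_zero _ (by have := H.h2; omega)) (by positivity)
    by_cases hkm : m - 1 ≤ k
    · have := hmul (some (Sum.inr ⟨2 * m - 2 - k, by omega⟩))
        (gram q (genVec m F) k j ^ 2 ^ (s - 1)) (pow_mem (by
          rcases lt_trichotomy (j : ℕ) k with h | h | h
          · rw [hN _ _ h]
            exact hgA _ (by omega) _
          · rw [h, gram_self]
            exact zero_mem _
          · rw [gram_comm, hN _ _ h]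
            exact hgA _ (by omega) _) _)
      simpa only [hSys, show 2 * m - 2 - (2 * m - 2 - k) = k by omega] using this
    · have hg : gSeq q m s F b1 k ∈ A := gSeq_mem_subGen (Set.mem_Iio.2 hk)
      rcases lt_trichotomy (j : ℕ) k with h | h | h
      · rw [hN _ _ h, ← pow_mul, mul_comm, ← Nat.succ_pred_eq_of_ne_zero (hq0 _), pow_succ',
          mul_assoc]
        exact hgram _ (by omega) (by omega) _ (mul_mem (hgA _ (by omega) _) hg)
      · rw [h, gram_self, zero_pow (by positivity), mul_zero]
        exact zero_mem _
      · rw [gram_comm, hN _ _ h, ← pow_mul, mul_comm, ← Nat.succ_pred_eq_of_ne_zero (hq0 _),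
          pow_succ', mul_assoc]
        exact hgram _ (by omega) (by omega) _ (mul_mem (hgA _ (by omega) _) hg)

lemma exists_eq_sum_yMono (H : OrthData q m s F b1) {f : MvPolynomial (OIdx m) F}
    (hf : f ∈ subGen q m s F b1 (Set.Iio (2 * m - 1))) :
    f ∈ Submodule.span (Algebra.adjoin F (Set.range (hSys q m s F b1)))
      (Set.range (yMono q m s F)) := by
  set B := Algebra.adjoin F (Set.range (hSys q m s F b1)) with hB
  set M := Submodule.span B (Set.range (yMono q m s F)) with hM
  have hy : ∀ j, (ySys q m F j).IsHomogeneous (q ^ 0 + q ^ (2 * m - 1 - (j : ℕ))) := fun j =>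
    gram_isHomogeneous _ _
  have hx : ∀ i, (Sum.elim (hSys q m s F b1) (ySys q m F) i).IsHomogeneous
      (Sum.elim (hDeg q m) (fun j : Fin (m - 1) => q ^ 0 + q ^ (2 * m - 1 - (j : ℕ))) i) := by
    rintro (i | j)
    exacts [hSys_isHomogeneous H i, hy j]
  rw [← sum_homogeneousComponent f]
  refine M.sum_mem fun n _ => ?_
  have h1 : homogeneousComponent n f ∈ subGen q m s F b1 (Set.Iio (2 * m - 1)) := by
    rw [subGen_eq_adjoin H] at hf ⊢
    exact homogeneousComponent_mem_adjoin hx hf n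
  have h2 := mem_span_of_pow_mem (hSys_isHomogeneous H) hy (hDeg_pos H) (subGen_eq_adjoin H)
    (ySys_pow_eq H) h1 (homogeneousComponent_isHomogeneous n f)
  refine (Submodule.span_le (p := M.restrictScalars F)).2 ?_ h2
  rintro _ ⟨e, d, -, hd, rfl⟩
  have hB : ∏ i, hSys q m s F b1 i ^ e i ∈ B :=
    Subalgebra.prod_mem _ fun i _ => Subalgebra.pow_mem _ (Algebra.subset_adjoin (Set.mem_range_self i)) _
  have hy : yMono q m s F (fun j => ⟨d j, hd j⟩) ∈ M := Submodule.subset_span ⟨_, rfl⟩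
  exact M.smul_mem (⟨_, hB⟩ : B) hy

lemma yMono_mem (d : YIdx m s) : yMono q m s F d ∈ subGen q m s F b1 (Set.Iio (2 * m - 1)) :=
  Subalgebra.prod_mem _ fun j _ => Subalgebra.pow_mem _ (gram_mem_subGen (by omega)) _

lemma isIntegral_adjoin_hSys_of_mem (H : OrthData q m s F b1) {f : MvPolynomial (OIdx m) F}
    (hf : f ∈ subGen q m s F b1 (Set.Iio (2 * m - 1))) :
    IsIntegral (Algebra.adjoin F (Set.range (hSys q m s F b1))) f := by
  have hm := H.hm
  set B := Algebra.adjoin F (Set.range (hSys q m s F b1)) with hB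
  set M := Submodule.span B (Set.range (yMono q m s F)) with hM
  have h1 : (1 : MvPolynomial (OIdx m) F) ∈ M := exists_eq_sum_yMono H (one_mem _)
  refine isIntegral_of_smul_mem_submodule M (fun h => ?_)
    (Submodule.fg_span (Set.finite_range _)) f fun n hn => ?_
  · rw [h, Submodule.mem_bot] at h1
    exact one_ne_zero h1
  · refine exists_eq_sum_yMono H (mul_mem hf ?_)
    obtain ⟨c, rfl⟩ := (Submodule.mem_span_range_iff_exists_fun B).1 hn
    exact sum_mem fun d _ => mul_mem (adjoin_hSys_le H (c d).2) (yMono_mem d)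

/-- `S` is integral over the algebra generated by the system of parameters. -/
lemma isIntegral_adjoin_hSys (H : OrthData q m s F b1) (f : MvPolynomial (OIdx m) F) :
    IsIntegral (Algebra.adjoin F (Set.range (hSys q m s F b1))) f := by
  exact isIntegral_of_subalgebra_le (adjoin_hSys_le H) (fun a => isIntegral_adjoin_hSys_of_mem H)
    (isIntegral_subGen H f)

lemma algebraicIndependent_hSys (H : OrthData q m s F b1) :
    AlgebraicIndependent F (hSys q m s F b1) := by
  have : Algebra.IsAlgebraic (Algebra.adjoin F (Set.range (hSys q m s F b1)))
      (MvPolynomial (OIdx m) F) := ⟨fun x => (isIntegral_adjoin_hSys H x).isAlgebraic⟩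
  refine (Algebra.IsAlgebraic.isTranscendenceBasis_of_lift_le_trdeg_of_finite F _ ?_).1
  rw [MvPolynomial.trdeg_of_isDomain, Cardinal.lift_lift]

end Parameters

section Frames

variable {F : Type*} [Field F] [Fintype F] {m : ℕ}

lemma card_bform_solutions_le {k : ℕ} {f : Fin k → Fin m ⊕ Fin m → F} (hf : LinearIndependent F f)
    (g : Fin k → F) : (Finset.univ.filter fun v : Fin m ⊕ Fin m → F =>
      ∀ i, bform F m (f i) v = g i).card ≤ Fintype.card F ^ (2 * m - k) := by
  set U := (bform F m).orthogonal (Submodule.span F (Set.range f)) with hU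
  have hfin : Module.finrank F U = 2 * m - k := by
    rw [hU, LinearMap.BilinForm.finrank_orthogonal (bform_nondegenerate F m)
      , finrank_span_eq_card hf,
      Module.finrank_fintype_fun_eq_card]
    simp only [Fintype.card_sum, Fintype.card_fin]
    congr 1
    omega
  have hcard : Fintype.card U = Fintype.card F ^ (2 * m - k) := by
    rw [← hfin, Module.card_eq_pow_finrank (K := F)]
  rw [← hcard]
  set T := Finset.univ.filter fun v : Fin m ⊕ Fin m → F => ∀ i, bform F m (f i) v = g i with hT
  rcases T.eq_empty_or_nonempty with h | ⟨v0, hv0⟩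
  · rw [h, Finset.card_empty]
    exact Nat.zero_le _
  · rw [hT, Finset.mem_filter] at hv0
    rw [← Fintype.card_coe]
    refine Fintype.card_le_of_injective (fun v => ⟨v - v0, ?_⟩) fun v w h => ?_
    · have hv := (Finset.mem_filter.1 v.2).2
      rw [hU, LinearMap.BilinForm.mem_orthogonal_iff]
      intro n hn
      induction hn using Submodule.span_induction with
      | mem x hx =>
        obtain ⟨i, rfl⟩ := hx
        rw [map_sub, hv i, hv0.2 i, sub_self]
      | zero => simp
      | add x y _ _ hx hy => rw [map_add, LinearMap.add_apply, hx, hy, add_zero]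
      | smul a x _ hx => rw [map_smul, LinearMap.smul_apply, hx, smul_zero]
    · exact Subtype.ext (sub_left_injective (congrArg Subtype.val h))

/-- Independent families with prescribed Gram matrix. -/
noncomputable def frames (F : Type*) [Field F] [Fintype F] (m : ℕ) (G : ℕ → ℕ → F) (k : ℕ) :
    Finset (Fin k → Fin m ⊕ Fin m → F) :=
  Finset.univ.filter fun f => LinearIndependent F f ∧
    ∀ i j, i < j → bform F m (f i) (f j) = G i j

lemma card_frames_le {G : ℕ → ℕ → F} (hG : ∀ k, Even k → ∀ i < k, G i k = 0) (k : ℕ) :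
    (frames F m G k).card ≤ ∏ t ∈ Finset.range k,
      (if Even t then Fintype.card F ^ (2 * m - t) - 1 else Fintype.card F ^ (2 * m - t)) := by
  induction k with
  | zero => simpa using Finset.card_le_one_of_subsingleton _
  | succ k ih =>
    rw [Finset.prod_range_succ, mul_comm]
    refine le_trans ?_ (Nat.mul_le_mul_left _ ih)
    refine Finset.card_le_mul_card_image_of_maps_to (f := Fin.init) (fun f hf => ?_) _
      fun f hf => ?_
    · obtain ⟨h1, h2⟩ := (Finset.mem_filter.1 hf).2
      exact Finset.mem_filter.2 ⟨Finset.mem_univ _, h1.comp _ (Fin.castSucc_injective k),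
        fun i j hij => h2 _ _ hij⟩
    · obtain ⟨h1, h2⟩ := (Finset.mem_filter.1 hf).2
      set T := Finset.univ.filter fun v : Fin m ⊕ Fin m → F => ∀ i, bform F m (f i) v = G i k with hT
      have hcard : T.card ≤ _ := card_bform_solutions_le h1 _
      have hsub : ∀ g ∈ (frames F m G (k + 1)).filter (fun g => Fin.init g = f),
          g (Fin.last k) ∈ T ∧ g (Fin.last k) ≠ 0 := fun g hg => by
        obtain ⟨hg1, rfl⟩ := Finset.mem_filter.1 hg
        obtain ⟨h3, h4⟩ := (Finset.mem_filter.1 hg1).2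
        refine ⟨Finset.mem_filter.2 ⟨Finset.mem_univ _, fun i => ?_⟩, h3.ne_zero _⟩
        have := h4 i.castSucc (Fin.last k) (Fin.castSucc_lt_last i)
        rwa [Fin.val_castSucc, Fin.val_last] at this
      have hinj : Set.InjOn (fun g : Fin (k + 1) → Fin m ⊕ Fin m → F => g (Fin.last k))
          ((frames F m G (k + 1)).filter (fun g => Fin.init g = f)) := fun g hg g' hg' h => by
        rw [← Fin.snoc_init_self g, ← Fin.snoc_init_self g', (Finset.mem_filter.1 hg).2,
          (Finset.mem_filter.1 hg').2]
        exact congrArg _ h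
      split_ifs with hk
      · have h0 : (0 : Fin m ⊕ Fin m → F) ∈ T :=
          Finset.mem_filter.2 ⟨Finset.mem_univ _, fun i => by rw [map_zero, hG k hk i i.2]⟩
        refine le_trans (Finset.card_le_card_of_injOn (t := T.erase 0) _ (fun g hg => ?_) hinj) ?_
        · exact Finset.mem_erase.2 ⟨(hsub g hg).2, (hsub g hg).1⟩
        · rw [Finset.card_erase_of_mem h0]
          exact Nat.sub_le_sub_right hcard 1
      · exact (Finset.card_le_card_of_injOn (t := T) _ (fun g hg => (hsub g hg).1) hinj).trans hcard

/-- The Gram matrix of a symplectic basis. -/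
def symG (F : Type*) [Field F] (i j : ℕ) : F := if Even i ∧ j = i + 1 then 1 else 0

lemma bform_single_single (a b : Fin m ⊕ Fin m) :
    bform F m (Pi.single a 1) (Pi.single b 1) = if b = a.swap then 1 else 0 := by
  rw [bform_apply]
  rcases a with a | a <;> rcases b with b | b <;> simp [Pi.single_apply, eq_comm]

/-- The `n`-th vector of the standard symplectic basis. -/
def symIdx (m : ℕ) (i : Fin (2 * m)) : Fin m ⊕ Fin m :=
  if Even (i : ℕ) then Sum.inl ⟨i / 2, by omega⟩ else Sum.inr ⟨i / 2, by omega⟩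

lemma symIdx_surjective (m : ℕ) : Function.Surjective (symIdx m) := by
  rintro (j | j)
  · exact ⟨⟨2 * j, by omega⟩, by simp [symIdx]⟩
  · refine ⟨⟨2 * j + 1, by omega⟩, ?_⟩
    simp only [symIdx, Nat.not_even_bit1, if_false]
    congr
    omega

lemma symIdx_injective (m : ℕ) : Function.Injective (symIdx m) :=
  ((Fintype.bijective_iff_surjective_and_card _).2
    ⟨symIdx_surjective m, by simp; omega⟩).1

lemma bform_symIdx {i j : Fin (2 * m)} (hij : i < j) :
    bform F m (Pi.single (symIdx m i) 1) (Pi.single (symIdx m j) 1) = symG F i j := by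
  rw [bform_single_single, symG]
  have hij' : (i : ℕ) < j := hij
  congr 1
  simp only [symIdx, Nat.even_iff]
  split_ifs <;> simp [Fin.ext_iff] <;> omega

end Frames

section AutBound

variable {q m s : ℕ} {F : Type*} [Field F] [Fintype F] [CharP F 2] {b1 : MvPolynomial (OIdx m) F}

lemma single_add_single_inj {σ : Type*} (hq : 2 ≤ q) {a b a' b' : σ}
    (h : Finsupp.single a 1 + Finsupp.single b q = Finsupp.single a' 1 + Finsupp.single b' q) :
    a = a' ∧ b = b' := by
  have h1 : a = a' := by
    by_contra hne
    have := DFunLike.congr_fun h a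
    simp only [Finsupp.add_apply, Finsupp.single_apply, if_true, if_neg (Ne.symm hne)] at this
    split_ifs at this <;> omega
  subst h1
  exact ⟨rfl, Finsupp.single_left_injective (by omega) (add_left_cancel h)⟩

lemma coeff_sum_C_mul_X_mul_X_pow {σ : Type*} [Fintype σ] (hq : 2 ≤ q)
    (M : σ → σ → F) (a b : σ) :
    (∑ i, ∑ j, C (M i j) * (X i * X j ^ q) : MvPolynomial σ F).coeff
      (Finsupp.single a 1 + Finsupp.single b q) = M a b := by
  have h : ∀ i j : σ, (X i * X j ^ q : MvPolynomial σ F)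
      = monomial (Finsupp.single i 1 + Finsupp.single j q) 1 := fun i j => by
    rw [X_pow_eq_monomial, X, monomial_mul, one_mul]
  simp only [h, coeff_sum, coeff_C_mul, coeff_monomial]
  rw [Finset.sum_eq_single a, Finset.sum_eq_single b]
  · simp
  · exact fun j _ hj => by rw [if_neg fun h => hj (single_add_single_inj hq h).2, mul_zero]
  · simp
  · exact fun i _ hi => Finset.sum_eq_zero fun j _ => by
      rw [if_neg fun h => hi (single_add_single_inj hq h).1, mul_zero]
  · simp

lemma gram_linForm (hq : q = 2 ^ s) (hF : Fintype.card F = q)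
    (c : Fin m ⊕ Fin m → Fin m ⊕ Fin m → F) :
    gram q (fun i => linForm (c i)) 0 1
      = rename some (∑ a, ∑ b, C (bform F m (fun i => c i a) (fun i => c i b)) * (X a * X b ^ q)) := by
  have h0 : (fun i => linForm (c i) ^ q ^ 0)
      = ∑ a, (X (some a) : MvPolynomial (OIdx m) F) • fun i => C (c i a) := by
    funext i
    simp [linForm, mul_comm]
  have h1 : (fun i => linForm (c i) ^ q ^ 1)
      = ∑ a, (X (some a) ^ q : MvPolynomial (OIdx m) F) • fun i => C (c i a) := by
    funext i
    rw [linForm, sum_pow_pow_two hq, Finset.sum_apply]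
    refine Finset.sum_congr rfl fun a _ => ?_
    rw [mul_pow, ← C_pow, pow_one, ← hF, FiniteField.pow_card, Pi.smul_apply, smul_eq_mul, mul_comm]
  rw [gram, h0, h1]
  simp only [map_sum, map_smul, LinearMap.sum_apply, LinearMap.smul_apply, smul_eq_mul, map_mul,
    map_pow, rename_X, rename_C]
  rw [Finset.sum_comm]
  simp only [Finset.mul_sum]
  refine Finset.sum_congr rfl fun a _ => Finset.sum_congr rfl fun b _ => ?_
  rw [bform_map (C : F →+* MvPolynomial (OIdx m) F)]
  ring

lemma bform_eq_of_gram_linForm (hq : q = 2 ^ s) (hF : Fintype.card F = q)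
    {c : Fin m ⊕ Fin m → Fin m ⊕ Fin m → F}
    (h : gram q (fun i => linForm (c i)) 0 1 = gram q (genVec m F) 0 1) (a b : Fin m ⊕ Fin m) :
    bform F m (fun i => c i a) (fun i => c i b) = bform F m (Pi.single a 1) (Pi.single b 1) := by
  have h1 : genVec m F = fun i => linForm (Pi.single i 1) := by
    funext i
    rw [linForm, Finset.sum_eq_single i (fun j _ hj => by simp [hj]) (by simp)]
    simp [genVec]
  have hq2 : 2 ≤ q := hF ▸ Fintype.one_lt_card
  rw [h1, gram_linForm hq hF, gram_linForm hq hF] at h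
  have h2 := congrArg (coeff (Finsupp.single a 1 + Finsupp.single b q))
    (rename_injective _ (Option.some_injective _) h)
  rw [coeff_sum_C_mul_X_mul_X_pow hq2, coeff_sum_C_mul_X_mul_X_pow hq2] at h2
  rw [h2]
  congr 1
  · congr 1
    funext i
    simp [Pi.single_apply, eq_comm]
  · funext i
    simp [Pi.single_apply, eq_comm]

variable {L : Type*} [Field L] [Algebra F L] [Algebra (MvPolynomial (OIdx m) F) L]
  [IsScalarTower F (MvPolynomial (OIdx m) F) L] [IsFractionRing (MvPolynomial (OIdx m) F) L]
  {E : Subalgebra F (MvPolynomial (OIdx m) F)}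

/-- The degree of `L` over the fraction field of the algebra of known invariants is at most the
order of the symplectic group. -/
lemma finrank_fracSub_le (H : OrthData q m s F b1) (hc : ∀ n, (dickP m F).coeff n ∈ E)
    (he : gSeq q m s F b1 (2 * m - 2) ∈ E) (hξ : gram q (genVec m F) 0 1 ∈ E) :
    Module.finrank (fracSub L E) L ≤ ∏ t ∈ Finset.range (2 * m),
      (if Even t then q ^ (2 * m - t) - 1 else q ^ (2 * m - t)) := by
  obtain ⟨hG, hfd⟩ := isGalois_fracSub (L := L) H hc he
  rw [← IsGalois.card_aut_eq_finrank]
  have hinj : Function.Injective (algebraMap (MvPolynomial (OIdx m) F) L) :=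
    IsFractionRing.injective _ L
  choose c hcσ using exists_linForm_of_aut (L := L) hc
  have hgram : ∀ σ, gram q (fun i => linForm (c σ i)) 0 1 = gram q (genVec m F) 0 1 := fun σ => by
    apply hinj
    have h1 := σ.commutes ⟨_, algebraMap_mem_fracSub L hξ⟩
    change σ (algebraMap (MvPolynomial (OIdx m) F) L (gram q (genVec m F) 0 1)) = algebraMap (MvPolynomial (OIdx m) F) L _ at h1
    rw [← h1, gram_map (algebraMap (MvPolynomial (OIdx m) F) L) q (genVec m F),
      gram_map (algebraMap (MvPolynomial (OIdx m) F) L)]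
    have h2 := gram_map (σ : L →+* L) q
      (fun i => algebraMap (MvPolynomial (OIdx m) F) L (genVec m F i)) 0 1
    refine Eq.trans ?_ h2.symm
    congr 1
    funext i
    exact (hcσ σ i).symm
  have hb := fun σ => bform_eq_of_gram_linForm H.hq H.hF (hgram σ)
  have hfr : ∀ σ, (fun i a => c σ a (symIdx m i)) ∈ frames F m (symG F) (2 * m) := fun σ => by
    refine Finset.mem_filter.2 ⟨Finset.mem_univ _, ?_, fun i j hij => ?_⟩
    · have hli : LinearIndependent F fun a i => c σ i a := by
        rw [Fintype.linearIndependent_iff]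
        intro g hg
        have hz : ∀ b, bform F m g (Pi.single b 1) = 0 := fun b => by
          have h1 := congrArg (fun v => bform F m v fun i => c σ i b) hg
          simp only [map_sum, map_smul, LinearMap.sum_apply, LinearMap.smul_apply, hb, map_zero,
            LinearMap.zero_apply] at h1
          rw [← h1]
          conv_lhs => rw [pi_eq_sum_univ' g]
          simp only [map_sum, map_smul, LinearMap.sum_apply, LinearMap.smul_apply]
        have h0 : g = 0 := by
          refine (bform_nondegenerate F m).1 g fun w => ?_
          rw [pi_eq_sum_univ' w]
          simp [hz]
        simp [h0]
      exact hli.comp _ (symIdx_injective m)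
    · rw [hb, bform_symIdx hij]
  rw [← H.hF]
  refine le_trans ?_ (card_frames_le (m := m) (G := symG F) (fun k hk i hi => ?_) (2 * m))
  · rw [← Nat.card_eq_finsetCard]
    refine Nat.card_le_card_of_injective (fun σ => ⟨_, hfr σ⟩) fun σ τ hστ => ?_
    have h1 : c σ = c τ := by
      funext i a
      obtain ⟨k, rfl⟩ := symIdx_surjective m a
      exact congrFun (congrFun (congrArg Subtype.val hστ) k) i
    have h2 := adjoin_X_some_eq_top (L := L) H he
    refine AlgEquiv.ext fun x => ?_
    have hx : x ∈ IntermediateField.adjoin (fracSub L E)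
        (Set.range fun i => algebraMap (MvPolynomial (OIdx m) F) L (X (some i))) := by
      rw [h2]
      trivial
    induction hx using IntermediateField.adjoin_induction with
    | mem x hx =>
      obtain ⟨i, rfl⟩ := hx
      exact (hcσ σ i).trans (h1 ▸ (hcσ τ i).symm)
    | algebraMap x => rw [σ.commutes, τ.commutes]
    | add x y _ _ hx hy => rw [map_add, map_add, hx, hy]
    | inv x _ hx => rw [map_inv₀, map_inv₀, hx]
    | mul x y _ _ hx hy => rw [map_mul, map_mul, hx, hy]
  · rw [symG, if_neg]
    rintro ⟨h1, h2⟩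
    rw [h2] at hk
    exact (Nat.even_add_one.1 hk) h1

end AutBound

section Arithmetic

lemma prod_range_pow_add {R : Type*} [CommSemiring R] (q : R) (m : ℕ) :
    ∏ i ∈ Finset.range m, q ^ (m + i) = q ^ m ^ 2 * ∏ i ∈ Finset.range m, q ^ i := by
  rw [Finset.prod_pow_eq_pow_sum, Finset.prod_pow_eq_pow_sum, Finset.sum_add_distrib, ← pow_add]
  simp [sq]

lemma prod_range_pow_odd {R : Type*} [CommSemiring R] (q : R) (m : ℕ) :
    ∏ i ∈ Finset.range m, q ^ (2 * i + 1) = q ^ m ^ 2 := by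
  induction m with
  | zero => simp
  | succ m ih => rw [Finset.prod_range_succ, ih, ← pow_add]; ring_nf

lemma prod_range_two_mul {R : Type*} [CommMonoid R] (f : ℕ → R) (m : ℕ) :
    ∏ i ∈ Finset.range (2 * m), f i = ∏ i ∈ Finset.range m, (f (2 * i) * f (2 * i + 1)) := by
  induction m with
  | zero => simp
  | succ m ih =>
    rw [Finset.prod_range_succ, ← ih, show 2 * (m + 1) = 2 * m + 1 + 1 by ring,
      Finset.prod_range_succ, Finset.prod_range_succ, mul_assoc]

lemma prod_sympl_order (q m : ℕ) :
    ∏ t ∈ Finset.range (2 * m), (if Even t then q ^ (2 * m - t) - 1 else q ^ (2 * m - t))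
      = q ^ m ^ 2 * ∏ t ∈ Finset.range m, (q ^ (2 * (t + 1)) - 1) := by
  rw [prod_range_two_mul, ← Finset.prod_range_reflect, ← prod_range_pow_odd,
    ← Finset.prod_mul_distrib]
  refine Finset.prod_congr rfl fun t ht => ?_
  rw [Finset.mem_range] at ht
  rw [if_pos (even_two_mul _), if_neg (by simp), mul_comm]
  congr 2
  · omega
  · congr 1
    omega

lemma prod_hDeg {q m s : ℕ} (hs : 2 ≤ s) (hm : 2 ≤ m) (hq : q = 2 ^ s) :
    ∏ i, hDeg q m i = Fintype.card (YIdx m s) * ∏ t ∈ Finset.range (2 * m),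
      (if Even t then q ^ (2 * m - t) - 1 else q ^ (2 * m - t)) := by
  have hq0 : 0 < q := hq ▸ by positivity
  rw [prod_sympl_order, Fintype.prod_option, Fintype.prod_sum_type, Fintype.card_pi]
  simp only [Fintype.card_fin]
  rw [Fin.prod_univ_eq_prod_range (fun j => 2 ^ (s * (j + 1) - 1)) (m - 1)]
  refine Nat.eq_of_mul_eq_mul_left (show 0 < 2 ^ m by positivity) ?_
  have h1 : 2 ^ m * ∏ i : Fin m, hDeg q m (some (Sum.inr i))
      = (∏ i ∈ Finset.range m, q ^ (m + i)) * ∏ i ∈ Finset.range m, (q ^ (i + 1) - 1) := by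
    rw [← Finset.prod_range_reflect (fun i => q ^ (m + i)), ← Finset.prod_mul_distrib,
      ← Fin.prod_univ_eq_prod_range, show 2 ^ m = ∏ _i : Fin m, 2 by simp,
      ← Finset.prod_mul_distrib]
    refine Finset.prod_congr rfl fun i _ => ?_
    have h2 : 2 ∣ q := hq ▸ dvd_pow_self 2 (by omega)
    have h3 : 2 ∣ q ^ (2 * m) := h2.trans (dvd_pow_self q (by omega))
    have h4 : 2 ∣ q ^ (2 * m - 1 - (i : ℕ)) := h2.trans (dvd_pow_self q (by omega))
    rw [hDeg, Nat.mul_div_cancel' (Nat.dvd_sub h3 h4), Nat.mul_sub, mul_one, ← pow_add]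
    congr 2 <;> omega
  have h2 : ∏ i : Fin m, hDeg q m (some (Sum.inl i)) = ∏ i ∈ Finset.range m, (q ^ (i + 1) + 1) := by
    rw [← Fin.prod_univ_eq_prod_range]
    exact Finset.prod_congr rfl fun i _ => by rw [hDeg, pow_zero, add_comm]
  have h3 : (∏ i ∈ Finset.range m, (q ^ (i + 1) + 1)) * ∏ i ∈ Finset.range m, (q ^ (i + 1) - 1)
      = ∏ t ∈ Finset.range m, (q ^ (2 * (t + 1)) - 1) := by
    rw [← Finset.prod_mul_distrib]
    refine Finset.prod_congr rfl fun i _ => ?_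
    rw [mul_comm 2, pow_mul, ← Nat.sq_sub_sq, one_pow]
  have h4 : 2 ^ m * ∏ j ∈ Finset.range (m - 1), 2 ^ (s * (j + 1) - 1)
      = 2 * ∏ i ∈ Finset.range m, q ^ i := by
    obtain ⟨n, rfl⟩ : ∃ n, m = n + 1 := ⟨m - 1, by omega⟩
    rw [Nat.add_sub_cancel, pow_succ', mul_assoc, Finset.prod_range_succ', pow_zero, mul_one]
    congr 1
    rw [show 2 ^ n = ∏ _i ∈ Finset.range n, 2 by simp, ← Finset.prod_mul_distrib]
    refine Finset.prod_congr rfl fun j _ => ?_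
    have : 1 ≤ s * (j + 1) := Nat.mul_pos (by omega) (by omega)
    rw [hq, ← pow_mul, ← pow_succ', Nat.sub_add_cancel this]
  rw [prod_range_pow_add] at h1
  rw [h2, ← h3]
  calc _ = hDeg q m none * (∏ i ∈ Finset.range m, (q ^ (i + 1) + 1))
        * (2 ^ m * ∏ i : Fin m, hDeg q m (some (Sum.inr i))) := by ring
    _ = (2 * ∏ i ∈ Finset.range m, q ^ i) * (q ^ m ^ 2
        * ((∏ i ∈ Finset.range m, (q ^ (i + 1) + 1)) * ∏ i ∈ Finset.range m, (q ^ (i + 1) - 1))) := by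
      rw [h1, hDeg]; ring
    _ = _ := by rw [← h4]; ring

lemma degree_quotient {q m : ℕ} (hm : 1 ≤ m) (hq : 1 < q) :
    (2 * ∏ i ∈ Finset.Icc 1 m, ((q : ℚ) ^ i + 1))
        * (∏ j ∈ Finset.Icc 1 m, (q : ℚ) ^ (2 * m - j) * ((q : ℚ) ^ j - 1) / 2)
        / ((q : ℚ) ^ (m ^ 2) * ∏ k ∈ Finset.Icc 1 m, ((q : ℚ) ^ (2 * k) - 1))
      = ∏ i ∈ Finset.Icc 1 (m - 1), (q : ℚ) ^ i / 2 := by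
  have hq0 : (q : ℚ) ≠ 0 := by positivity
  have hI : ∀ (n : ℕ) (f : ℕ → ℚ), ∏ i ∈ Finset.Icc 1 n, f i = ∏ i ∈ Finset.range n, f (i + 1) :=
    fun n f => by
      rw [range_succ_image_add_one, Finset.prod_image fun a _ b _ h => by simpa using h]
  have hne : ∏ k ∈ Finset.Icc 1 m, ((q : ℚ) ^ (2 * k) - 1) ≠ 0 := by
    refine Finset.prod_ne_zero_iff.2 fun k hk => ?_
    have : (1 : ℚ) < (q : ℚ) ^ (2 * k) :=
      one_lt_pow₀ (by exact_mod_cast hq) (by have := (Finset.mem_Icc.1 hk).1; omega)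
    linarith
  have h1 : (∏ i ∈ Finset.Icc 1 m, ((q : ℚ) ^ i + 1)) * ∏ j ∈ Finset.Icc 1 m, ((q : ℚ) ^ j - 1)
      = ∏ k ∈ Finset.Icc 1 m, ((q : ℚ) ^ (2 * k) - 1) := by
    rw [← Finset.prod_mul_distrib]
    exact Finset.prod_congr rfl fun i _ => by ring
  have h2 : ∏ j ∈ Finset.Icc 1 m, (q : ℚ) ^ (2 * m - j)
      = (q : ℚ) ^ m ^ 2 * ∏ i ∈ Finset.Icc 1 (m - 1), (q : ℚ) ^ i := by
    obtain ⟨n, rfl⟩ : ∃ n, m = n + 1 := ⟨m - 1, by omega⟩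
    have h := prod_range_pow_add (q : ℚ) (n + 1)
    rw [Finset.prod_range_succ' (fun i => (q : ℚ) ^ i), pow_zero, mul_one] at h
    rw [hI, hI, Nat.add_sub_cancel, ← h, ← Finset.prod_range_reflect]
    refine Finset.prod_congr rfl fun i hi => ?_
    rw [Finset.mem_range] at hi
    congr 1
    omega
  rw [div_eq_iff (mul_ne_zero (pow_ne_zero _ hq0) hne), Finset.prod_div_distrib,
    Finset.prod_div_distrib, Finset.prod_mul_distrib, h2, ← h1]
  simp only [Finset.prod_const, Nat.card_Icc]
  obtain ⟨n, rfl⟩ : ∃ n, m = n + 1 := ⟨m - 1, by omega⟩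
  simp only [Nat.add_sub_cancel, pow_succ (2 : ℚ)]
  field_simp

end Arithmetic

/-! ### Independence of the basis monomials -/

lemma finrank_le_finrank_span_mul_of_tower {K K' L : Type*} [Field K] [Field K'] [Field L]
    [Algebra K K'] [Algebra K' L] [Algebra K L] [IsScalarTower K K' L] [FiniteDimensional K' L]
    {ι : Type*} [Fintype ι] {v : ι → L}
    (hv : ∀ x : K', algebraMap K' L x ∈ Submodule.span K (Set.range v)) :
    FiniteDimensional K L ∧ Module.finrank K L
      ≤ Module.finrank K (Submodule.span K (Set.range v)) * Module.finrank K' L := by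
  let φ : K' →ₗ[K] Submodule.span K (Set.range v) :=
    LinearMap.codRestrict _ (IsScalarTower.toAlgHom K K' L).toLinearMap hv
  have hφ : Function.Injective φ := fun x y hxy => (algebraMap K' L).injective
    (congrArg (fun z : Submodule.span K (Set.range v) => (z : L)) hxy)
  have : FiniteDimensional K (Submodule.span K (Set.range v)) :=
    FiniteDimensional.span_of_finite K (Set.finite_range v)
  have : FiniteDimensional K K' := FiniteDimensional.of_injective φ hφ
  refine ⟨FiniteDimensional.trans K K' L, ?_⟩
  rw [← Module.finrank_mul_finrank K K' L]
  exact Nat.mul_le_mul_right _ (LinearMap.finrank_le_finrank_of_injective hφ)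

lemma finrank_le_finrank_span_mul {F L : Type*} [Field F] [Field L] [Algebra F L]
    {K K' : IntermediateField F L} (h : K ≤ K') [FiniteDimensional K' L] {ι : Type*} [Fintype ι]
    {v : ι → L} (hv : ∀ x ∈ K', x ∈ Submodule.span K (Set.range v)) :
    FiniteDimensional K L ∧ Module.finrank K L
      ≤ Module.finrank K (Submodule.span K (Set.range v)) * Module.finrank K' L := by
  let _ : Algebra K K' := (IntermediateField.inclusion h).toAlgebra
  have : IsScalarTower K K' L := IsScalarTower.of_algebraMap_eq fun _ => rfl
  exact finrank_le_finrank_span_mul_of_tower fun x : K' => hv x x.2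

lemma exists_mul_mem_of_isIntegral {F S : Type*} [Field F] [CommRing S] [IsDomain S] [Algebra F S]
    {B A : Subalgebra F S} (hBA : B ≤ A) {b : S} (hb : b ∈ A) (hb0 : b ≠ 0)
    (hi : IsIntegral B b) : ∃ a ∈ A, a * b ∈ B ∧ a * b ≠ 0 := by
  let _ : Algebra B A := (Subalgebra.inclusion hBA).toAlgebra
  have : IsScalarTower B A S := IsScalarTower.of_algebraMap_eq fun _ => rfl
  have hi' : IsIntegral B (⟨b, hb⟩ : A) :=
    (isIntegral_algebraMap_iff (Subtype.val_injective : Function.Injective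
      (algebraMap A S))).1 hi
  obtain ⟨r, hr, a, ha⟩ := hi'.isAlgebraic.exists_nonzero_dvd
    (mem_nonZeroDivisors_of_ne_zero fun h => hb0 (congrArg Subtype.val h))
  have ha' : (r : S) = b * a := congrArg Subtype.val ha
  refine ⟨a, a.2, ?_, ?_⟩
  · rw [mul_comm, ← ha']
    exact r.2
  · rw [mul_comm, ← ha']
    exact fun h => hr (Subtype.ext h)

section Independence

variable {q m s : ℕ} {F : Type*} [Field F] [Fintype F] [CharP F 2] {b1 : MvPolynomial (OIdx m) F}

lemma dickP_coeff_mem_subGen (H : OrthData q m s F b1) (n : ℕ) :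
    (dickP m F).coeff n ∈ subGen q m s F b1 (Set.Iio (2 * m - 1)) :=
  dickP_coeff_mem H xiZero_mem_subGen (fun _ => gram_mem_subGen) (fun _ hk => gSeq_mem_subGen hk) n

lemma mem_span_yMono {L : Type*} [Field L] [Algebra F L] [Algebra (MvPolynomial (OIdx m) F) L]
    [IsScalarTower F (MvPolynomial (OIdx m) F) L] [FaithfulSMul (MvPolynomial (OIdx m) F) L]
    (H : OrthData q m s F b1) {x : L}
    (hx : x ∈ fracSub L (subGen q m s F b1 (Set.Iio (2 * m - 1)))) :
    x ∈ Submodule.span (fracSub L (Algebra.adjoin F (Set.range (hSys q m s F b1))))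
      (Set.range fun d => algebraMap (MvPolynomial (OIdx m) F) L (yMono q m s F d)) := by
  set B := Algebra.adjoin F (Set.range (hSys q m s F b1))
  have hinj := FaithfulSMul.algebraMap_injective (MvPolynomial (OIdx m) F) L
  obtain ⟨a, ha, b, hb, hb0, hab⟩ := mem_fracSub_iff.1 hx
  obtain ⟨c, hc, hcb, hcb0⟩ := exists_mul_mem_of_isIntegral (adjoin_hSys_le H) hb hb0
    (isIntegral_adjoin_hSys H b)
  obtain ⟨e, he⟩ := (Submodule.mem_span_range_iff_exists_fun B).1
    (exists_eq_sum_yMono H (mul_mem hc ha))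
  have hne : algebraMap (MvPolynomial (OIdx m) F) L (c * b) ≠ 0 := by
    rwa [Ne, map_eq_zero_iff _ hinj]
  have hxe : x = (algebraMap (MvPolynomial (OIdx m) F) L (c * b))⁻¹
      * ∑ d, algebraMap (MvPolynomial (OIdx m) F) L (e d : MvPolynomial (OIdx m) F)
        * algebraMap (MvPolynomial (OIdx m) F) L (yMono q m s F d) := by
    rw [eq_inv_mul_iff_mul_eq₀ hne, map_mul, mul_assoc, hab, ← map_mul, ← he, map_sum]
    exact Finset.sum_congr rfl fun d _ => by rw [← map_mul]; rfl
  rw [hxe, Finset.mul_sum]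
  refine sum_mem fun d _ => ?_
  rw [← mul_assoc]
  refine Submodule.smul_mem _ (⟨_, mul_mem (inv_mem (algebraMap_mem_fracSub L hcb))
    (algebraMap_mem_fracSub L (e d).2)⟩ : fracSub L B) (Submodule.subset_span ⟨d, rfl⟩)

lemma yMono_unique (H : OrthData q m s F b1)
    {c : YIdx m s → MvPolynomial (OIdx m) F}
    (hc : ∀ d, c d ∈ Algebra.adjoin F (Set.range (hSys q m s F b1)))
    (h : ∑ d, c d * yMono q m s F d = 0) (d : YIdx m s) : c d = 0 := by
  set B := Algebra.adjoin F (Set.range (hSys q m s F b1)) with hB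
  set A := subGen q m s F b1 (Set.Iio (2 * m - 1)) with hA
  let L := FractionRing (MvPolynomial (OIdx m) F)
  let v : YIdx m s → L := fun d => algebraMap (MvPolynomial (OIdx m) F) L (yMono q m s F d)
  have hm := H.hm
  have hAe : gSeq q m s F b1 (2 * m - 2) ∈ A := gSeq_mem_subGen (by simp only [Set.mem_Iio]; omega)
  have hKK : fracSub L B ≤ fracSub L A :=
    IntermediateField.adjoin.mono _ _ _ (Set.image_mono (adjoin_hSys_le H))
  have hfin : FiniteDimensional (fracSub L A) L :=
    (isGalois_fracSub H (dickP_coeff_mem_subGen H) hAe).2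
  obtain ⟨hfin', hle⟩ := finrank_le_finrank_span_mul (v := v) hKK fun x hx => mem_span_yMono H hx
  have h1 := prod_le_finrank (hSys_isHomogeneous H) (hDeg_pos H) (isIntegral_adjoin_hSys H) L
  have h2 := finrank_fracSub_le (L := L) H (dickP_coeff_mem_subGen H) hAe
    (gram_mem_subGen (by omega))
  rw [prod_hDeg H.hs H.hm H.hq] at h1
  have hpos : 0 < ∏ t ∈ Finset.range (2 * m),
      (if Even t then q ^ (2 * m - t) - 1 else q ^ (2 * m - t)) := by
    refine Finset.prod_pos fun t ht => ?_
    rw [Finset.mem_range] at ht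
    have : 1 < q ^ (2 * m - t) := Nat.one_lt_pow (by omega) (by have := H.h2; omega)
    split_ifs <;> omega
  have h3 : Fintype.card (YIdx m s)
      ≤ Module.finrank (fracSub L B) (Submodule.span (fracSub L B) (Set.range v)) :=
    Nat.le_of_mul_le_mul_right (h1.trans (hle.trans (Nat.mul_le_mul_left _ h2))) hpos
  have hli : LinearIndependent (fracSub L B) v := linearIndependent_iff_card_le_finrank_span.2 h3
  have h4 := Fintype.linearIndependent_iff.1 hli
    (fun d => ⟨_, algebraMap_mem_fracSub L (hc d)⟩) (by
      rw [← map_zero (algebraMap (MvPolynomial (OIdx m) F) L), ← h, map_sum]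
      exact Finset.sum_congr rfl fun d _ => by rw [map_mul]; rfl) d
  have h5 : algebraMap (MvPolynomial (OIdx m) F) L (c d) = 0 := congrArg Subtype.val h4
  exact (map_eq_zero_iff _ (IsFractionRing.injective _ L)).1 h5

end Independence

/-! ### The ring of invariants -/

lemma linForm_eq_zero_iff {m : ℕ} {F : Type*} [Field F] {c : Fin m ⊕ Fin m → F} :
    linForm c = 0 ↔ c = 0 := by
  rw [← linForm_injective.eq_iff (a := c) (b := 0)]
  simp [linForm]

lemma linForm_prime {m : ℕ} {F : Type*} [Field F] {c : Fin m ⊕ Fin m → F} (hc : c ≠ 0) :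
    Prime (linForm c) := by
  have h0 : linForm c ≠ 0 := fun h => hc (linForm_eq_zero_iff.1 h)
  refine (MvPolynomial.irreducible_of_totalDegree_eq_one
    ((linForm_isHomogeneous c).totalDegree h0) fun x hx => isUnit_iff_ne_zero.2 ?_).prime
  rintro rfl
  exact h0 (MvPolynomial.ext _ _ fun i => by rw [zero_dvd_iff.1 (hx i), coeff_zero])

lemma exists_smul_eq_of_linForm_dvd {m : ℕ} {F : Type*} [Field F] {c d : Fin m ⊕ Fin m → F}
    (h : linForm c ∣ linForm d) : ∃ a : F, d = a • c := by
  by_cases hd : d = 0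
  · exact ⟨0, by rw [hd, zero_smul]⟩
  obtain ⟨g, hg⟩ := h
  have hd0 : linForm d ≠ 0 := fun h => hd (linForm_eq_zero_iff.1 h)
  have hc0 : linForm c ≠ 0 := fun h => hd0 (by rw [hg, h, zero_mul])
  have hg0 : g ≠ 0 := fun h => hd0 (by rw [hg, h, mul_zero])
  have h1 := congrArg totalDegree hg
  rw [totalDegree_mul_of_isDomain hc0 hg0, (linForm_isHomogeneous c).totalDegree hc0,
    (linForm_isHomogeneous d).totalDegree hd0] at h1
  obtain ⟨a, rfl⟩ : ∃ a, g = C a := ⟨_, totalDegree_eq_zero_iff_eq_C.1 (by omega)⟩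
  refine ⟨a, linForm_injective ?_⟩
  rw [hg, linForm, linForm, Finset.sum_mul]
  refine Finset.sum_congr rfl fun i _ => ?_
  rw [Pi.smul_apply, smul_eq_mul, C_mul]
  ring

lemma exists_ideal_of_conductor {B A S : Type*} [CommRing B] [CommRing A] [CommRing S]
    [IsDomain S] [Algebra A S] [Algebra.IsIntegral A S] [FaithfulSMul A S] (f : B →+* A) {p : B}
    (hp : Prime p) {J : Ideal A} (hJ : ∀ b, f b ∈ J → p ∣ b) :
    ∃ P : Ideal S, P.IsPrime ∧ (∀ a ∈ J, algebraMap A S a ∈ P) ∧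
      ∀ b, algebraMap A S (f b) ∈ P → p ∣ b := by
  have hprime : (Ideal.span {p}).IsPrime := (Ideal.span_singleton_prime hp.ne_zero).2 hp
  obtain ⟨Q, hQ, hJQ, hdis⟩ := Ideal.exists_le_prime_disjoint J
    ((Ideal.span {p}).primeCompl.map f) (by
      rw [Set.disjoint_left]
      rintro _ ha ⟨b, hb, rfl⟩
      exact hb (Ideal.mem_span_singleton.2 (hJ b ha)))
  obtain ⟨P, hP, hPQ⟩ := Ideal.exists_ideal_over_prime_of_isIntegral_of_isDomain (S := S) Q (by
    rw [(RingHom.injective_iff_ker_eq_bot _).1 (FaithfulSMul.algebraMap_injective A S)]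
    exact bot_le)
  refine ⟨P, hP, fun a ha => ?_, fun b hb => ?_⟩
  · rw [← Ideal.mem_comap, hPQ]
    exact hJQ ha
  · rw [← Ideal.mem_comap, hPQ] at hb
    by_contra hpb
    exact Set.disjoint_left.1 hdis hb ⟨b, fun h => hpb (Ideal.mem_span_singleton.1 h), rfl⟩

lemma exists_ideal_of_mul_mem {F S : Type*} [Field F] [CommRing S] [IsDomain S] [Algebra F S]
    {B A : Subalgebra F S} (hBA : B ≤ A) (hint : ∀ f : S, IsIntegral A f) {p : B} (hp : Prime p)
    {f : S} (hJ : ∀ b : B, b * f ∈ A → p ∣ b) :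
    ∃ P : Ideal S, P.IsPrime ∧ (∀ a ∈ A, a * f ∈ A → a ∈ P) ∧ ∀ b : B, (b : S) ∈ P → p ∣ b := by
  let J : Ideal A :=
    { carrier := {a | (a : S) * f ∈ A}
      add_mem' := fun {a a'} ha ha' => by
        rw [Set.mem_ofPred_eq, Subalgebra.coe_add, add_mul]
        exact add_mem ha ha'
      zero_mem' := by
        rw [Set.mem_ofPred_eq, Subalgebra.coe_zero, zero_mul]
        exact zero_mem _
      smul_mem' := fun a a' ha => by
        rw [Set.mem_ofPred_eq, smul_eq_mul, Subalgebra.coe_mul, mul_assoc]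
        exact mul_mem a.2 ha }
  have hint : Algebra.IsIntegral A S := ⟨hint⟩
  obtain ⟨P, hP, hJP, hPp⟩ := exists_ideal_of_conductor (S := S) (J := J)
    (Subalgebra.inclusion hBA).toRingHom hp hJ
  exact ⟨P, hP, fun a ha haf => hJP ⟨a, ha⟩ haf, hPp⟩

lemma exists_algHom_ker_eq.{u, v} (F : Type v) {S : Type u} [Field F] [CommRing S] [Algebra F S]
    {P : Ideal S} (hP : P.IsPrime) :
    ∃ (K : Type u) (_ : Field K) (_ : Algebra F K) (φ : S →ₐ[F] K), ∀ f, φ f = 0 ↔ f ∈ P := by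
  refine ⟨FractionRing (S ⧸ P), inferInstance, inferInstance,
    (IsScalarTower.toAlgHom F (S ⧸ P) (FractionRing (S ⧸ P))).comp (Ideal.Quotient.mkₐ F P),
    fun f => ?_⟩
  rw [← Ideal.Quotient.eq_zero_iff_mem]
  exact map_eq_zero_iff _ (IsFractionRing.injective (S ⧸ P) (FractionRing (S ⧸ P)))

lemma exists_linForm_map_eq_zero {q m s : ℕ} {F K : Type*} [Field F] [Fintype F] [CharP F 2]
    [Field K] [Algebra F K] (hm : 2 ≤ m) (hq : q = 2 ^ s) (hF : Fintype.card F = q)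
    (φ : MvPolynomial (OIdx m) F →ₐ[F] K) (h : ∀ l, m - 1 ≤ l → l < 2 * m - 1 →
      φ (gpf q m F ((Finset.range (2 * m - 1)).erase l)) = 0) :
    ∃ c d : Fin m ⊕ Fin m → F, c ≠ 0 ∧ φ (linForm c) = 0 ∧ φ (linForm d) = 0 ∧
      ∀ a : F, d ≠ a • c := by
  have hchar : CharP K 2 := charP_of_injective_algebraMap (algebraMap F K).injective 2
  let v : Fin m ⊕ Fin m → K := fun i => φ (X (some i))
  have hv : Module.finrank F (Submodule.span F (Set.range v)) ≤ 2 * m - 2 := by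
    by_contra hlt
    obtain ⟨k, hk1, hk2, hk⟩ := exists_pf_erase_ne_zero (hF.trans hq) hm (v := v) (by omega)
    refine hk ?_
    have h1 := h k hk1 hk2
    rw [gpf, ← AlgHom.coe_toRingHom, pf_map] at h1
    rw [hF, ← h1]
    congr 1
    funext a b
    rw [gram_map]
    rfl
  have hlin : ∀ c : Fin m ⊕ Fin m → F, Fintype.linearCombination F v c = φ (linForm c) := fun c => by
    rw [Fintype.linearCombination_apply, linForm, map_sum]
    refine Finset.sum_congr rfl fun i _ => ?_
    rw [map_mul, ← algebraMap_eq, AlgHom.commutes, Algebra.smul_def]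
  have hker : 2 ≤ Module.finrank F (LinearMap.ker (Fintype.linearCombination F v)) := by
    have h1 := LinearMap.finrank_range_add_finrank_ker (Fintype.linearCombination F v)
    rw [Fintype.range_linearCombination, Module.finrank_fintype_fun_eq_card] at h1
    simp only [Fintype.card_sum, Fintype.card_fin] at h1
    omega
  obtain ⟨w, hw⟩ := exists_linearIndependent_of_le_finrank hker
  have hmem : ∀ i, φ (linForm (w i : Fin m ⊕ Fin m → F)) = 0 := fun i => by
    rw [← hlin]
    exact (w i).2
  refine ⟨w 0, w 1, fun h0 => hw.ne_zero 0 (Subtype.ext h0), hmem 0, hmem 1, fun a ha => ?_⟩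
  have h2 := Fintype.linearIndependent_iff.1 hw ![a, -1] (Subtype.ext (by
    simp [Fin.sum_univ_two, ha])) 1
  simp at h2

/-- A prime ideal containing the relevant pfaffians contains two independent linear forms. -/
lemma exists_linForm_mem_of_gpf_mem {q m s : ℕ} {F : Type*} [Field F] [Fintype F] [CharP F 2]
    (hm : 2 ≤ m) (hq : q = 2 ^ s) (hF : Fintype.card F = q) {P : Ideal (MvPolynomial (OIdx m) F)}
    (hP : P.IsPrime) (h : ∀ l, m - 1 ≤ l → l < 2 * m - 1 →
      gpf q m F ((Finset.range (2 * m - 1)).erase l) ∈ P) :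
    ∃ c d : Fin m ⊕ Fin m → F, c ≠ 0 ∧ linForm c ∈ P ∧ linForm d ∈ P ∧
      ∀ a : F, d ≠ a • c := by
  obtain ⟨K, _, _, φ, hφ⟩ := exists_algHom_ker_eq F hP
  simp only [← hφ] at h ⊢
  exact exists_linForm_map_eq_zero hm hq hF φ h

section Invariants

variable {q m s : ℕ} {F : Type*} [Field F] [Fintype F] [CharP F 2] {b1 : MvPolynomial (OIdx m) F}

lemma mem_subGen_of_prime_mul_mem (H : OrthData q m s F b1)
    {p : Algebra.adjoin F (Set.range (hSys q m s F b1))} (hp : Prime p)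
    {f : MvPolynomial (OIdx m) F}
    (hf : ∀ l < 2 * m - 1, ∃ N, gpf q m F ((Finset.range (2 * m - 1)).erase l) ^ N * f
      ∈ subGen q m s F b1 (Set.Iio (2 * m - 1)))
    (hpf : p * f ∈ subGen q m s F b1 (Set.Iio (2 * m - 1))) :
    f ∈ subGen q m s F b1 (Set.Iio (2 * m - 1)) := by
  have hm := H.hm
  obtain ⟨b, hb⟩ := (Submodule.mem_span_range_iff_exists_fun _).1 (exists_eq_sum_yMono H hpf)
  have hp0 : (p : MvPolynomial (OIdx m) F) ≠ 0 := fun h => hp.ne_zero (Subtype.ext h)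
  have hb' : ∑ d, (b d : MvPolynomial (OIdx m) F) * yMono q m s F d = p * f := hb
  by_cases hdvd : ∀ d, p ∣ b d
  · choose c hc using hdvd
    have : f = ∑ d, (c d : MvPolynomial (OIdx m) F) * yMono q m s F d := by
      refine mul_left_cancel₀ hp0 ?_
      rw [← hb', Finset.mul_sum]
      refine Finset.sum_congr rfl fun d _ => ?_
      rw [hc, Subalgebra.coe_mul, mul_assoc]
    rw [this]
    exact sum_mem fun d _ => mul_mem (adjoin_hSys_le H (c d).2) (yMono_mem d)
  exfalso
  push Not at hdvd
  obtain ⟨d, hd⟩ := hdvd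
  have hJp : ∀ a : Algebra.adjoin F (Set.range (hSys q m s F b1)),
      a * f ∈ subGen q m s F b1 (Set.Iio (2 * m - 1)) → p ∣ a := fun a ha => by
    obtain ⟨c, hc⟩ := (Submodule.mem_span_range_iff_exists_fun _).1
      (exists_eq_sum_yMono H ha)
    have hc' : ∑ d, (c d : MvPolynomial (OIdx m) F) * yMono q m s F d = a * f := hc
    have h1 := yMono_unique H (c := fun d => ((a * b d - p * c d :
      Algebra.adjoin F (Set.range (hSys q m s F b1))) : MvPolynomial (OIdx m) F))
      (fun d => Subtype.property _) (by
        have h2 : (a : MvPolynomial (OIdx m) F) * ∑ d, (b d : MvPolynomial (OIdx m) F)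
            * yMono q m s F d - p * ∑ d, (c d : MvPolynomial (OIdx m) F) * yMono q m s F d = 0 := by
          rw [hb', hc']
          ring
        rw [← h2, Finset.mul_sum, Finset.mul_sum, ← Finset.sum_sub_distrib]
        refine Finset.sum_congr rfl fun d _ => ?_
        rw [Subalgebra.coe_sub, Subalgebra.coe_mul, Subalgebra.coe_mul]
        ring) d
    have h3 : a * b d = p * c d := sub_eq_zero.1 (Subtype.ext h1)
    exact (hp.dvd_or_dvd ⟨c d, h3⟩).resolve_right hd
  obtain ⟨P, hP, hJP, hPp⟩ := exists_ideal_of_mul_mem (adjoin_hSys_le H) (isIntegral_subGen H)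
    hp hJp
  obtain ⟨c, e, hc0, hc, he, hce⟩ := exists_linForm_mem_of_gpf_mem (s := s) hm H.hq H.hF hP
    fun l _ hl => by
      obtain ⟨N, hN⟩ := hf l hl
      exact hP.mem_of_pow_mem N (hJP _ (pow_mem (gpf_erase_mem_subGen H.hq l) N) hN)
  have hI : (Ideal.span {linForm c}).IsPrime :=
    (Ideal.span_singleton_prime (linForm_prime hc0).ne_zero).2 (linForm_prime hc0)
  have hIP : Ideal.span {linForm c} ≤ P := (Ideal.span_singleton_le_iff_mem _).2 hc
  have hlt := Ideal.comap_lt_comap_of_integral_mem_sdiff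
    (R := Algebra.adjoin F (Set.range (hSys q m s F b1))) hIP
    (x := linForm e) ⟨he, fun h => by
      obtain ⟨a, ha⟩ := exists_smul_eq_of_linForm_dvd (Ideal.mem_span_singleton.1 h)
      exact hce a ha⟩ (isIntegral_adjoin_hSys H _)
  have hne := Ideal.comap_ne_bot_of_integral_mem
    (R := Algebra.adjoin F (Set.range (hSys q m s F b1))) (linForm_prime hc0).ne_zero
    (Ideal.mem_span_singleton_self (linForm c)) (isIntegral_adjoin_hSys H _)
  have hufd : UniqueFactorizationMonoid (Algebra.adjoin F (Set.range (hSys q m s F b1))) :=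
    (algebraicIndependent_hSys H).aevalEquiv.toMulEquiv.uniqueFactorizationMonoid inferInstance
  obtain ⟨x, hx, hxp⟩ := (hI.comap _).exists_mem_prime_of_ne_bot hne
  have hpx : p ∣ x := hPp x (hIP hx)
  have hxp' : x ∣ p := (hp.irreducible.associated_of_dvd hxp.irreducible hpx).symm.dvd
  refine not_le_of_gt hlt fun y hy => ?_
  exact Ideal.mem_of_dvd _ (hxp'.trans (hPp y hy)) hx

lemma mem_subGen_of_mul_mem (H : OrthData q m s F b1)
    (b : Algebra.adjoin F (Set.range (hSys q m s F b1))) : b ≠ 0 →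
    ∀ f : MvPolynomial (OIdx m) F,
      (∀ g : (OIdx m → F) ≃ₗ[F] (OIdx m → F), act g (xiZero m F) = xiZero m F → act g f = f) →
      b * f ∈ subGen q m s F b1 (Set.Iio (2 * m - 1)) →
      f ∈ subGen q m s F b1 (Set.Iio (2 * m - 1)) := by
  have hufd : UniqueFactorizationMonoid (Algebra.adjoin F (Set.range (hSys q m s F b1))) :=
    (algebraicIndependent_hSys H).aevalEquiv.toMulEquiv.uniqueFactorizationMonoid inferInstance
  induction b using UniqueFactorizationMonoid.induction_on_prime with
  | h₁ => exact fun h => absurd rfl h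
  | h₂ x hx =>
    obtain ⟨y, hy⟩ := hx.exists_left_inv
    intro _ f _ h
    have h1 := mul_mem (adjoin_hSys_le H y.2) h
    rwa [← mul_assoc, ← Subalgebra.coe_mul, hy, Subalgebra.coe_one, one_mul] at h1
  | h₃ a p ha hp ih =>
    intro _ f hf h
    refine ih ha f hf (mem_subGen_of_prime_mul_mem H hp (fun l hl =>
      exists_pow_mul_mem_of_invariant H (fun g hg => ?_) hl) ?_)
    · rw [map_mul, hf g hg, act_eq_of_mem_subGen H hg (adjoin_hSys_le H a.2)]
    · rwa [← mul_assoc]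

lemma mem_subGen_iff (H : OrthData q m s F b1) {f : MvPolynomial (OIdx m) F} :
    f ∈ subGen q m s F b1 (Set.Iio (2 * m - 1)) ↔
      ∀ g : (OIdx m → F) ≃ₗ[F] (OIdx m → F), act g (xiZero m F) = xiZero m F → act g f = f := by
  refine ⟨fun hf g hg => act_eq_of_mem_subGen H hg hf, fun hf => ?_⟩
  have hm := H.hm
  obtain ⟨b, hb, hb0, hbf⟩ := exists_mul_mem_of_invariant (FractionRing (MvPolynomial (OIdx m) F)) H
    (dickP_coeff_mem_subGen H) xiZero_mem_subGen
    (gSeq_mem_subGen (by simp only [Set.mem_Iio]; omega)) hf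
  obtain ⟨a, ha, hab, hab0⟩ := exists_mul_mem_of_isIntegral (adjoin_hSys_le H) hb hb0
    (isIntegral_adjoin_hSys H b)
  refine mem_subGen_of_mul_mem H ⟨_, hab⟩ (fun h => hab0 (congrArg Subtype.val h)) f hf ?_
  change a * b * f ∈ _
  rw [mul_assoc]
  exact mul_mem ha hbf

end Invariants

lemma card_yIdx (m s : ℕ) : Fintype.card (YIdx m s) = ∏ i ∈ Finset.Icc 1 (m - 1), 2 ^ (s * i - 1) := by
  rw [Fintype.card_pi, range_succ_image_add_one, Finset.prod_image fun a _ b _ h => by simpa using h,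
    ← Fin.prod_univ_eq_prod_range (fun i => 2 ^ (s * (i + 1) - 1))]
  simp

lemma adjoin_hSys_eq {q m s : ℕ} {F : Type*} [Field F] [Fintype F] [CharP F 2]
    {b1 : MvPolynomial (OIdx m) F} (H : OrthData q m s F b1) :
    Algebra.adjoin F (Set.range (hSys q m s F b1)) = Algebra.adjoin F
      {p | p = xiZero m F ∨ (∃ i ∈ Finset.Icc 1 m, p = xiGen q m F i) ∨
        ∃ i ∈ Finset.Icc 1 m, p = eSeq q m s F b1 (i - 1)} := by
  have hm := H.hm
  have hg : ∀ i < m, gSeq q m s F b1 (2 * m - 2 - i) = eSeq q m s F b1 i := fun i hi => by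
    rw [gSeq, if_neg (by omega), show 2 * m - 2 - (2 * m - 2 - i) = i by omega]
  congr 1
  ext p
  simp only [Set.mem_range, Set.mem_ofPred_eq, Finset.mem_Icc]
  constructor
  · rintro ⟨_ | i | i, rfl⟩
    · exact Or.inl rfl
    · exact Or.inr (Or.inl ⟨i + 1, by omega, by rw [hSys, gram_zero_left]⟩)
    · exact Or.inr (Or.inr ⟨i + 1, by omega, by rw [hSys, hg i i.2, Nat.add_sub_cancel]⟩)
  · rintro (rfl | ⟨i, hi, rfl⟩ | ⟨i, hi, rfl⟩)
    · exact ⟨none, rfl⟩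
    · refine ⟨some (Sum.inl ⟨i - 1, by omega⟩), ?_⟩
      rw [hSys, gram_zero_left, Nat.sub_add_cancel hi.1]
    · refine ⟨some (Sum.inr ⟨i - 1, by omega⟩), ?_⟩
      rw [hSys, hg _ (by dsimp only; omega)]

/-- For `q = 2^s > 2` and `m ≥ 2`: the invariant ring of `O_{2m+1}(F_q)` is a
free module over `F_q[H]`, `H = {ξ_0,ξ_1,…,ξ_m,e_1,…,e_m}`, of rank
`Π_{i=1}^{m-1} q^i/2`; equivalently, the product of the degrees of `H` divided
by `|O_{2m+1}(F_q)|` equals `Π_{i=1}^{m-1} q^i/2`. -/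
theorem stmt_19 {F : Type*} [Field F] [Fintype F] (s m q : ℕ) (hs : 2 ≤ s)
    (hm : 2 ≤ m) (hq : q = 2 ^ s) (h2 : 2 < q) (hF : Fintype.card F = q)
    (b1 : MvPolynomial (OIdx m) F)
    (hb1 : b1 ^ 2 = (dickP m F).coeff (q ^ (2 * m - 1))
      + uM q m F ^ (q - 2) * (deltaOne q m F + xiBar m F * uM1 q m F ^ q))
    (B : Subalgebra F (MvPolynomial (OIdx m) F))
    (hB : B = Algebra.adjoin F
      {p | p = xiZero m F ∨ (∃ i ∈ Finset.Icc 1 m, p = xiGen q m F i) ∨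
        ∃ i ∈ Finset.Icc 1 m, p = eSeq q m s F b1 (i - 1)})
    (r : ℕ) (hr : r = ∏ i ∈ Finset.Icc 1 (m - 1), 2 ^ (s * i - 1)) :
    (∃ bas : Fin r → MvPolynomial (OIdx m) F,
      (∀ f : MvPolynomial (OIdx m) F,
        (∀ g : (OIdx m → F) ≃ₗ[F] (OIdx m → F),
          act g (xiZero m F) = xiZero m F → act g f = f) ↔
        ∃ c : Fin r → B, f = ∑ i, (c i : MvPolynomial (OIdx m) F) * bas i) ∧
      (∀ c c' : Fin r → B,
        ∑ i, (c i : MvPolynomial (OIdx m) F) * bas i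
          = ∑ i, (c' i : MvPolynomial (OIdx m) F) * bas i → c = c')) ∧
    (2 * ∏ i ∈ Finset.Icc 1 m, ((q : ℚ) ^ i + 1))
        * (∏ j ∈ Finset.Icc 1 m, (q : ℚ) ^ (2 * m - j) * ((q : ℚ) ^ j - 1) / 2)
        / ((q : ℚ) ^ (m ^ 2) * ∏ k ∈ Finset.Icc 1 m, ((q : ℚ) ^ (2 * k) - 1))
      = ∏ i ∈ Finset.Icc 1 (m - 1), (q : ℚ) ^ i / 2 := by
  have : Fact (Nat.Prime 2) := ⟨Nat.prime_two⟩
  have hchar : CharP F 2 := charP_of_card_eq_prime_pow (hF.trans hq)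
  have H : OrthData q m s F b1 := ⟨hs, hm, hq, h2, hF, hb1⟩
  refine ⟨?_, degree_quotient (by omega) (by omega)⟩
  obtain rfl := hB.trans (adjoin_hSys_eq H).symm
  let e := Fintype.equivFinOfCardEq ((card_yIdx m s).trans hr.symm)
  have hsum : ∀ c : Fin r → MvPolynomial (OIdx m) F,
      ∑ i, c i * yMono q m s F (e.symm i) = ∑ d, c (e d) * yMono q m s F d := fun c =>
    (Fintype.sum_equiv e _ _ fun d => by rw [Equiv.symm_apply_apply]).symm
  refine ⟨fun i => yMono q m s F (e.symm i), fun f => ?_, fun c c' h => ?_⟩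
  · rw [← mem_subGen_iff H]
    constructor
    · intro hf
      obtain ⟨c, hc⟩ := (Submodule.mem_span_range_iff_exists_fun _).1 (exists_eq_sum_yMono H hf)
      refine ⟨fun i => c (e.symm i), ?_⟩
      rw [hsum fun i => (c (e.symm i) : MvPolynomial (OIdx m) F), ← hc]
      exact Finset.sum_congr rfl fun d _ => by rw [Equiv.symm_apply_apply]; rfl
    · rintro ⟨c, rfl⟩
      exact sum_mem fun i _ => mul_mem (adjoin_hSys_le H (c i).2) (yMono_mem _)
  · funext i
    have h1 := yMono_unique H (c := fun d => (c (e d) : MvPolynomial (OIdx m) F) - c' (e d))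
      (fun d => sub_mem (c (e d)).2 (c' (e d)).2) (by
        simp only [sub_mul, Finset.sum_sub_distrib]
        rw [← hsum fun i => (c i : MvPolynomial (OIdx m) F),
          ← hsum fun i => (c' i : MvPolynomial (OIdx m) F), h, sub_self]) (e.symm i)
    rw [Equiv.apply_symm_apply] at h1
    exact Subtype.ext (sub_eq_zero.1 h1)
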